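/- arXiv:1910.08025 — 12 statements merged into one kernel-verified Lean document; each statement's English description precedes it below -/
import Mathlib

section
/- There exist universal constants c ≥ 1 and N₁ ≥ 2 such that the following holds. Let G be a graph with m ≥ 2 edges, let φ ∈ (0,1], and let r ≥ 1 be an integer with m^{1/r} ≥ N₁. Then there exists a partition (A,B) of V(G) (with B possibly empty) such that |E_G(A,B)| ≤ φ·(log₂ m)^{c·r²}·Vol(G), and either (i) Vol_G(A) ≥ Vol(G)/3 and Vol_G(B) ≥ Vol(G)/3, or (ii) Vol_G(A) ≥ Vol(G)/2 and the induced subgraph G[A] has conductance Φ(G[A]) ≥ φ. -/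
open Finset
open scoped Classical

variable {V : Type*}

/-- The number of edges of `G` with one endpoint in `A` and the other in `B`
(for disjoint `A`, `B`). -/
noncomputable def interEdges (G : SimpleGraph V) (A B : Finset V) : ℕ :=
  ((A ×ˢ B).filter fun p => G.Adj p.1 p.2).card

/-- The degree of a vertex. -/
noncomputable def deg [Fintype V] (G : SimpleGraph V) (v : V) : ℕ :=
  (Finset.univ.filter fun u => G.Adj v u).card

/-- The volume of a vertex set: the sum of the degrees of its vertices. -/
noncomputable def vol [Fintype V] (G : SimpleGraph V) (S : Finset V) : ℕ :=
  ∑ v ∈ S, deg G v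

/-- The degree of `v` inside the induced subgraph `G[U]`. -/
noncomputable def degWithin (G : SimpleGraph V) (U : Finset V) (v : V) : ℕ :=
  (U.filter fun u => G.Adj v u).card

/-- The volume of `S` inside the induced subgraph `G[U]`. -/
noncomputable def volWithin (G : SimpleGraph V) (U S : Finset V) : ℕ :=
  ∑ v ∈ S, degWithin G U v

/-- The induced subgraph `G[U]` has conductance at least `φ`
(vacuously true if `G[U]` admits no cut, matching the convention `min ∅ = +∞`). -/
def conductanceGe (G : SimpleGraph V) (U : Finset V) (φ : ℝ) : Prop :=
  ∀ S ⊆ U, S.Nonempty → (U \ S).Nonempty →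
    φ * ((min (volWithin G U S) (volWithin G U (U \ S)) : ℕ) : ℝ) ≤
      (interEdges G S (U \ S) : ℝ)

theorem interEdges_comm (G : SimpleGraph V) (A B : Finset V) :
    interEdges G A B = interEdges G B A := by
  unfold interEdges
  refine Finset.card_bij' (fun p _ => p.swap) (fun p _ => p.swap) ?_ ?_ ?_ ?_
  · simp +contextual [G.adj_comm]
  · simp +contextual [G.adj_comm]
  · simp
  · simp

theorem interEdges_mono (G : SimpleGraph V) {A A' B B' : Finset V} (hA : A ⊆ A') (hB : B ⊆ B') :
    interEdges G A B ≤ interEdges G A' B' :=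
  Finset.card_le_card (Finset.filter_subset_filter _ (Finset.product_subset_product hA hB))

theorem interEdges_union_right_le (G : SimpleGraph V) (A B C : Finset V) :
    interEdges G A (B ∪ C) ≤ interEdges G A B + interEdges G A C := by
  unfold interEdges
  rw [Finset.product_union, Finset.filter_union]
  exact Finset.card_union_le _ _

theorem vol_union [Fintype V] (G : SimpleGraph V) {A B : Finset V} (h : Disjoint A B) :
    vol G (A ∪ B) = vol G A + vol G B :=
  Finset.sum_union h

theorem volWithin_le_vol [Fintype V] (G : SimpleGraph V) (U S : Finset V) :
    volWithin G U S ≤ vol G S :=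
  Finset.sum_le_sum fun _ _ =>
    Finset.card_le_card (Finset.filter_subset_filter _ (Finset.subset_univ U))

/-- Moving the sparse side `Q` of a cut of `P ∪ Q` to the complement keeps the number of cut edges
at most `φ` times the volume of the complement. -/
theorem interEdges_prune_le [Fintype V] (G : SimpleGraph V) {φ : ℝ} (hφ : 0 ≤ φ)
    {P Q R : Finset V} (hQR : Disjoint Q R)
    (hR : (interEdges G (P ∪ Q) R : ℝ) ≤ φ * vol G R)
    (hPQ : (interEdges G P Q : ℝ) ≤ φ * volWithin G (P ∪ Q) Q) :
    (interEdges G P (Q ∪ R) : ℝ) ≤ φ * vol G (Q ∪ R) := by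
  have h₁ : (interEdges G P (Q ∪ R) : ℝ) ≤ interEdges G P Q + interEdges G P R := by
    exact_mod_cast interEdges_union_right_le G P Q R
  have h₂ : (interEdges G P R : ℝ) ≤ interEdges G (P ∪ Q) R := by
    exact_mod_cast interEdges_mono G Finset.subset_union_left subset_rfl
  have h₃ : φ * (volWithin G (P ∪ Q) Q : ℝ) ≤ φ * vol G Q :=
    mul_le_mul_of_nonneg_left (by exact_mod_cast volWithin_le_vol G _ Q) hφ
  rw [vol_union G hQR]
  push_cast
  linarith

/-- A set of induced conductance less than `φ` splits into two nonempty parts such that the part of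
smaller volume is sparsely connected to the other one. -/
theorem exists_sparse_cut_of_not_conductanceGe [Fintype V] (G : SimpleGraph V) {φ : ℝ}
    (hφ : 0 ≤ φ) {A : Finset V} (h : ¬ conductanceGe G A φ) :
    ∃ P Q : Finset V, P ∪ Q = A ∧ Disjoint P Q ∧ Q.Nonempty ∧ vol G Q ≤ vol G P ∧
      (interEdges G P Q : ℝ) ≤ φ * volWithin G A Q := by
  unfold conductanceGe at h
  push Not at h
  obtain ⟨S, hSA, hS, hAS, hcut⟩ := h
  have hmin : ∀ x : ℕ, min (volWithin G A S) (volWithin G A (A \ S)) ≤ x →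
      (interEdges G S (A \ S) : ℝ) ≤ φ * x := fun x hx =>
    hcut.le.trans (mul_le_mul_of_nonneg_left (by exact_mod_cast hx) hφ)
  rcases le_total (vol G S) (vol G (A \ S)) with hv | hv
  · exact ⟨A \ S, S, Finset.sdiff_union_of_subset hSA, Finset.sdiff_disjoint, hS, hv,
      interEdges_comm G S (A \ S) ▸ hmin _ (min_le_left _ _)⟩
  · exact ⟨S, A \ S, Finset.union_sdiff_of_subset hSA, Finset.disjoint_sdiff, hAS, hv,
      hmin _ (min_le_right _ _)⟩

/-- Every graph has a cut `(A, Aᶜ)` with at most `φ * vol G univ` edges that is either balanced, or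
whose large side `A` induces a subgraph of conductance at least `φ`. -/
theorem exists_balanced_cut_or_conductanceGe [Fintype V] (G : SimpleGraph V) {φ : ℝ}
    (hφ : 0 ≤ φ) :
    ∃ A : Finset V, (interEdges G A Aᶜ : ℝ) ≤ φ * vol G Finset.univ ∧
      ((vol G Finset.univ ≤ 3 * vol G A ∧ vol G Finset.univ ≤ 3 * vol G Aᶜ) ∨
        (vol G Finset.univ ≤ 2 * vol G A ∧ conductanceGe G A φ)) := by
  have hcompl (A : Finset V) : vol G A + vol G Aᶜ = vol G Finset.univ := by
    rw [← vol_union G disjoint_compl_right, Finset.union_compl]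
  have hbound {A : Finset V} (h : (interEdges G A Aᶜ : ℝ) ≤ φ * vol G Aᶜ) :
      (interEdges G A Aᶜ : ℝ) ≤ φ * vol G Finset.univ :=
    h.trans (mul_le_mul_of_nonneg_left (by exact_mod_cast (hcompl A).le.trans' (by omega)) hφ)
  let good := Finset.univ.filter fun A : Finset V =>
    (interEdges G A Aᶜ : ℝ) ≤ φ * vol G Aᶜ ∧ 2 * vol G Finset.univ ≤ 3 * vol G A
  have hgood : good.Nonempty := ⟨Finset.univ, by simp [good, interEdges, vol]; omega⟩
  obtain ⟨A, hA, hAmin⟩ := good.exists_min_image Finset.card hgood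
  obtain ⟨hcut, hvol⟩ := (Finset.mem_filter.mp hA).2
  by_cases hcond : conductanceGe G A φ
  · exact ⟨A, hbound hcut, Or.inr ⟨by omega, hcond⟩⟩
  obtain ⟨P, Q, rfl, hPQ, hQ, hle, hsparse⟩ := exists_sparse_cut_of_not_conductanceGe G hφ hcond
  have hPc : Q ∪ (P ∪ Q)ᶜ = Pᶜ := by
    ext v
    have : v ∈ P → v ∉ Q := fun h => Finset.disjoint_left.mp hPQ h
    simp only [Finset.mem_union, Finset.mem_compl]
    tauto
  have hcutP := interEdges_prune_le G hφ
    (disjoint_compl_right.mono_left Finset.subset_union_right) hcut hsparse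
  rw [hPc] at hcutP
  have hsmall : 3 * vol G P < 2 * vol G Finset.univ := by
    by_contra! hbig
    have hcard := hAmin P (Finset.mem_filter.mpr ⟨Finset.mem_univ _, hcutP, hbig⟩)
    rw [Finset.card_union_of_disjoint hPQ] at hcard
    have := hQ.card_pos
    omega
  rw [vol_union G hPQ] at hvol
  have := hcompl P
  exact ⟨P, hbound hcutP, Or.inl ⟨by omega, by omega⟩⟩

/-- the combinatorial content of the main `BalCutPrune` theorem. -/
theorem balCutPrune_exists :
    ∃ c N₁ : ℕ, 1 ≤ c ∧ 2 ≤ N₁ ∧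
      ∀ (V : Type) [Fintype V] [DecidableEq V] (G : SimpleGraph V) (φ : ℝ) (r : ℕ),
        2 ≤ G.edgeSet.ncard → 0 < φ → φ ≤ 1 → 1 ≤ r →
        (N₁ : ℝ) ≤ (G.edgeSet.ncard : ℝ) ^ ((1 : ℝ) / (r : ℝ)) →
        ∃ A B : Finset V, Disjoint A B ∧ A ∪ B = Finset.univ ∧
          (interEdges G A B : ℝ) ≤
            φ * Real.logb 2 (G.edgeSet.ncard) ^ (c * r ^ 2) * (vol G Finset.univ : ℝ) ∧
          (((vol G Finset.univ : ℝ) / 3 ≤ (vol G A : ℝ) ∧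
              (vol G Finset.univ : ℝ) / 3 ≤ (vol G B : ℝ)) ∨
            ((vol G Finset.univ : ℝ) / 2 ≤ (vol G A : ℝ) ∧ conductanceGe G A φ)) := by
  refine ⟨1, 2, le_rfl, le_rfl, ?_⟩
  intro V _ _ G φ r hm hφ _ _ _
  obtain ⟨A, hcut, hA⟩ := exists_balanced_cut_or_conductanceGe G hφ.le
  have hlog : 1 ≤ Real.logb 2 (G.edgeSet.ncard) := by
    rw [Real.le_logb_iff_rpow_le one_lt_two (by exact_mod_cast (by omega : 0 < G.edgeSet.ncard))]
    simpa using (by exact_mod_cast hm : (2 : ℝ) ≤ G.edgeSet.ncard)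
  refine ⟨A, Aᶜ, disjoint_compl_right, Finset.union_compl A, ?_, ?_⟩
  · calc (interEdges G A Aᶜ : ℝ) ≤ φ * vol G Finset.univ := by convert hcut
      _ ≤ φ * Real.logb 2 (G.edgeSet.ncard) ^ (1 * r ^ 2) * vol G Finset.univ := by
        gcongr
        exact le_mul_of_one_le_right hφ.le (one_le_pow₀ hlog)
  · refine hA.imp (fun h => ⟨?_, ?_⟩) (fun h => ⟨?_, h.2⟩)
    · rw [div_le_iff₀' three_pos]
      exact_mod_cast h.1
    · rw [div_le_iff₀' three_pos]
      norm_cast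
      convert h.2
    · rw [div_le_iff₀' two_pos]
      exact_mod_cast h.1
end

section
/- For every constant c₁ > 0 there exist constants c₂, c₃ > 0 such that the following holds. Let G' be a graph on n' ≥ 3 vertices whose maximum vertex degree is at most c₁·log n'. Then either (i) there is a subset S ⊆ V(G') with |S| ≥ 2n'/3 such that the induced subgraph G'[S] is a (c₂/log⁵ n')-expander, or (ii) there is a partition (X,Y) of V(G') with |X| ≥ c₃·n'/log⁵ n', |Y| ≥ c₃·n'/log⁵ n' and Ψ_{G'}(X,Y) ≤ 1/100. Here log denotes the natural logarithm. -/
open Finset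
open scoped Classical

variable {V : Type*}

/-- The induced subgraph `G[U]` is a `ψ`-expander. -/
def expanderGe (G : SimpleGraph V) (U : Finset V) (ψ : ℝ) : Prop :=
  ∀ S ⊆ U, S.Nonempty → (U \ S).Nonempty →
    ψ * ((min S.card (U \ S).card : ℕ) : ℝ) ≤ (interEdges G S (U \ S) : ℝ)

/-- The boundary of `T ∪ A` is covered by the boundary of `T` and the edges leaving `A` outside
`T`. -/
theorem interEdges_union_sdiff_le [Fintype V] (G : SimpleGraph V) (T A : Finset V) :
    interEdges G (T ∪ A) (univ \ (T ∪ A)) ≤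
      interEdges G T (univ \ T) + interEdges G A ((univ \ T) \ A) := by
  unfold interEdges
  refine (Finset.card_le_card ?_).trans (Finset.card_union_le _ _)
  intro p
  simp only [mem_filter, mem_product, mem_union, mem_sdiff, mem_univ, true_and]
  tauto

/-- A set which does not induce a `ψ`-expander has a sparse cut, witnessed by its smaller side. -/
theorem exists_sparse_of_not_expanderGe {G : SimpleGraph V} {U : Finset V} {ψ : ℝ}
    (h : ¬ expanderGe G U ψ) :
    ∃ A ⊆ U, A.Nonempty ∧ 2 * A.card ≤ U.card ∧
      (interEdges G A (U \ A) : ℝ) ≤ ψ * A.card := by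
  unfold expanderGe at h
  push Not at h
  obtain ⟨S, hSU, hS, hS', hlt⟩ := h
  have hcard : (U \ S).card + S.card = U.card := card_sdiff_add_card_eq_card hSU
  rcases le_total S.card (U \ S).card with hle | hle
  · rw [min_eq_left hle] at hlt
    exact ⟨S, hSU, hS, by omega, hlt.le⟩
  · rw [min_eq_right hle] at hlt
    refine ⟨U \ S, sdiff_subset, hS', by omega, ?_⟩
    rw [Finset.sdiff_sdiff_eq_self hSU, interEdges_comm]
    exact hlt.le

/-- Every graph has an induced `ψ`-expander on at least two thirds of its vertices, or a cut of
sparsity at most `2ψ` whose sides both contain at least a third of the vertices. -/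
theorem exists_expanderGe_or_balanced_cut [Fintype V] (G : SimpleGraph V) {ψ : ℝ} (hψ : 0 ≤ ψ) :
    (∃ S : Finset V, 2 * Fintype.card V ≤ 3 * S.card ∧ expanderGe G S ψ) ∨
      ∃ X Y : Finset V, Disjoint X Y ∧ (∀ v, v ∈ X ∨ v ∈ Y) ∧
        Fintype.card V ≤ 3 * X.card ∧ Fintype.card V ≤ 3 * Y.card ∧
        (interEdges G X Y : ℝ) ≤ 2 * ψ * ((min X.card Y.card : ℕ) : ℝ) := by
  obtain ⟨T, hT, hmax⟩ := Finset.exists_max_image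
    (univ.filter fun T : Finset V => 3 * T.card ≤ Fintype.card V ∧
      (interEdges G T (univ \ T) : ℝ) ≤ ψ * T.card) Finset.card
    ⟨∅, mem_filter.2 ⟨mem_univ _, by simp, by simp [interEdges]⟩⟩
  simp only [mem_filter, mem_univ, true_and] at hT hmax
  obtain ⟨hTcard, hTcut⟩ := hT
  have hcompl : (univ \ T).card + T.card = Fintype.card V :=
    card_sdiff_add_card_eq_card (subset_univ T)
  by_cases hexp : expanderGe G (univ \ T) ψ
  · exact Or.inl ⟨univ \ T, by omega, hexp⟩
  right
  obtain ⟨A, hAU, hA, hAcard, hAcut⟩ := exists_sparse_of_not_expanderGe hexp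
  have hdisj : Disjoint T A := disjoint_sdiff.mono_right hAU
  have hunion : (T ∪ A).card = T.card + A.card := card_union_of_disjoint hdisj
  have hcompl' : (univ \ (T ∪ A)).card + (T ∪ A).card = Fintype.card V :=
    card_sdiff_add_card_eq_card (subset_univ _)
  have hcut : (interEdges G (T ∪ A) (univ \ (T ∪ A)) : ℝ) ≤ ψ * (T ∪ A).card := by
    have h : (interEdges G (T ∪ A) (univ \ (T ∪ A)) : ℝ) ≤
        interEdges G T (univ \ T) + interEdges G A ((univ \ T) \ A) := by
      exact_mod_cast interEdges_union_sdiff_le G T A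
    rw [hunion]
    push_cast
    linarith
  have hlarge : Fintype.card V < 3 * (T ∪ A).card := by
    by_contra hsmall
    have := hmax (T ∪ A) ⟨by omega, hcut⟩
    have := hA.card_pos
    omega
  refine ⟨T ∪ A, univ \ (T ∪ A), disjoint_sdiff, fun v => by simpa using em (v ∈ T ∪ A),
    hlarge.le, by omega, hcut.trans ?_⟩
  have hmin : (T ∪ A).card ≤ 2 * min (T ∪ A).card (univ \ (T ∪ A)).card := by omega
  calc ψ * ((T ∪ A).card : ℝ)
      ≤ ψ * (2 * (min (T ∪ A).card (univ \ (T ∪ A)).card : ℕ)) :=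
        mul_le_mul_of_nonneg_left (by exact_mod_cast hmin) hψ
    _ = _ := by ring

/-- the combinatorial content of the base-case theorem of the
recursion. -/
theorem baseCase_exists (c₁ : ℝ) (hc₁ : 0 < c₁) :
    ∃ c₂ c₃ : ℝ, 0 < c₂ ∧ 0 < c₃ ∧
      ∀ (V : Type) [Fintype V] [DecidableEq V] (G' : SimpleGraph V),
        3 ≤ Fintype.card V →
        (∀ v : V, (deg G' v : ℝ) ≤ c₁ * Real.log (Fintype.card V)) →
        (∃ S : Finset V, 2 * (Fintype.card V : ℝ) / 3 ≤ (S.card : ℝ) ∧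
            expanderGe G' S (c₂ / Real.log (Fintype.card V) ^ 5)) ∨
          (∃ X Y : Finset V, Disjoint X Y ∧ X ∪ Y = Finset.univ ∧
            c₃ * (Fintype.card V : ℝ) / Real.log (Fintype.card V) ^ 5 ≤ (X.card : ℝ) ∧
            c₃ * (Fintype.card V : ℝ) / Real.log (Fintype.card V) ^ 5 ≤ (Y.card : ℝ) ∧
            (interEdges G' X Y : ℝ) ≤ (1 / 100) * ((min X.card Y.card : ℕ) : ℝ)) := by
  refine ⟨1 / 200, 1 / 3, by norm_num, by norm_num, ?_⟩
  intro V _ _ G' hn _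
  have hlog : 1 ≤ Real.log (Fintype.card V) ^ 5 := by
    refine one_le_pow₀ ?_
    rw [Real.le_log_iff_exp_le (by positivity)]
    have : (3 : ℝ) ≤ Fintype.card V := by exact_mod_cast hn
    linarith [Real.exp_one_lt_d9]
  set L := Real.log (Fintype.card V) ^ 5
  have hψ : 1 / 200 / L ≤ 1 / 200 := div_le_self (by norm_num) hlog
  have hbal : 1 / 3 * (Fintype.card V : ℝ) / L ≤ 1 / 3 * (Fintype.card V : ℝ) :=
    div_le_self (by positivity) hlog
  rcases exists_expanderGe_or_balanced_cut G' (ψ := 1 / 200 / L) (by positivity) with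
    ⟨S, hS, hexp⟩ | ⟨X, Y, hXY, hcover, hX, hY, hcut⟩
  · refine Or.inl ⟨S, ?_, hexp⟩
    have : 2 * (Fintype.card V : ℝ) ≤ 3 * S.card := by exact_mod_cast hS
    linarith
  · have hX' : (Fintype.card V : ℝ) ≤ 3 * X.card := by exact_mod_cast hX
    have hY' : (Fintype.card V : ℝ) ≤ 3 * Y.card := by exact_mod_cast hY
    refine Or.inr ⟨X, Y, hXY, ?_, by linarith, by linarith, hcut.trans ?_⟩
    · ext v
      simpa using hcover v
    · exact mul_le_mul_of_nonneg_right (by linarith) (Nat.cast_nonneg _)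
end

section
/- Let h > 1 and let G₁,…,G_h be graphs on pairwise disjoint vertex sets V₁,…,V_h with N ≤ |V_i| ≤ γ·N for all i, where N ≥ 1 is an integer and γ ≥ 1 is real, and suppose each G_i is a ψ-expander for some 0 < ψ ≤ 1. Let H be a graph on vertex set {v₁,…,v_h} that is a ψ'-expander and has maximum vertex degree Δ. Let G be an N-composition of H with G₁,…,G_h, i.e., V(G) = V₁ ∪ … ∪ V_h and E(G) is the union of ⋃_i E(G_i) together with, for each edge e = (v_i,v_j) ∈ E(H), a matching M(e) of cardinality N between vertices of V_i and vertices of V_j. Then G is a (ψ·ψ'/(16·Δ·γ²))-expander. -/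
open Finset
open scoped Classical

variable {V : Type*}

/-- The maximum vertex degree. -/
noncomputable def maxDeg [Fintype V] (G : SimpleGraph V) : ℕ :=
  Finset.univ.sup fun v => deg G v

/-- Summing a function of the first endpoint over the edges from `A` to `B`. -/
lemma sum_fst_edges_le {ι : Type*} [Fintype ι] (H : SimpleGraph ι) (A B : Finset ι)
    (f : ι → ℕ) :
    ∑ p ∈ (A ×ˢ B).filter (fun p => H.Adj p.1 p.2), f p.1 ≤ maxDeg H * ∑ i ∈ A, f i := by
  rw [sum_filter, sum_product, mul_sum]
  refine sum_le_sum fun i _ => ?_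
  dsimp only
  rw [← sum_filter, sum_const, smul_eq_mul]
  refine Nat.mul_le_mul_right _ (le_trans (card_le_card ?_) (le_sup (f := deg H) (mem_univ i)))
  exact filter_subset_filter _ (subset_univ _)

/-- Summing a function of the second endpoint over the edges from `A` to `B`. -/
lemma sum_snd_edges_le {ι : Type*} [Fintype ι] (H : SimpleGraph ι) (A B : Finset ι)
    (f : ι → ℕ) :
    ∑ p ∈ (A ×ˢ B).filter (fun p => H.Adj p.1 p.2), f p.2 ≤ maxDeg H * ∑ i ∈ B, f i := by
  rw [sum_filter, sum_product_right, mul_sum]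
  refine sum_le_sum fun i _ => ?_
  dsimp only
  rw [← sum_filter, sum_const, smul_eq_mul]
  refine Nat.mul_le_mul_right _ (le_trans (card_le_card ?_) (le_sup (f := deg H) (mem_univ i)))
  intro j hj
  simpa using (mem_filter.1 hj).2.symm

/-- An expansion bound on a graph with at least two vertices is at most its maximum degree. -/
lemma expansion_le_maxDeg {ι : Type*} [Fintype ι] (H : SimpleGraph ι) (ψ : ℝ)
    (hh : 1 < Fintype.card ι) (hH : expanderGe H univ ψ) : ψ ≤ maxDeg H := by
  obtain ⟨i, j, hij⟩ := Fintype.exists_pair_of_one_lt_card hh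
  have hne : (univ \ {i} : Finset ι).Nonempty := ⟨j, by simpa using hij.symm⟩
  have h := hH {i} (subset_univ _) (singleton_nonempty i) hne
  rw [card_singleton, min_eq_left hne.card_pos, Nat.cast_one, mul_one] at h
  have h' := sum_fst_edges_le H {i} (univ \ {i}) (fun _ => 1)
  rw [← card_eq_sum_ones, sum_singleton, mul_one] at h'
  exact h.trans (by exact_mod_cast h')

/-- The cut edges inside disjoint parts add up to at most the whole cut. -/
lemma sum_interEdges_parts_le {ι : Type*} [Fintype ι] [Fintype V] (G : SimpleGraph V)
    (P : ι → Finset V) (K : ι → SimpleGraph V)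
    (hdisj : ∀ i j, i ≠ j → Disjoint (P i) (P j))
    (hK : ∀ i, K i ≤ G) (S : Finset V) :
    ∑ i, interEdges (K i) (P i ∩ S) (P i \ S) ≤ interEdges G S (univ \ S) := by
  unfold interEdges
  rw [← card_biUnion]
  · refine card_le_card fun p hp => ?_
    obtain ⟨i, -, hp⟩ := mem_biUnion.1 hp
    simp only [mem_filter, mem_product, mem_inter, mem_sdiff, mem_univ, true_and] at hp ⊢
    exact ⟨⟨hp.1.1.2, hp.1.2.2⟩, hK i hp.2⟩
  · intro i _ j _ hij
    refine disjoint_left.2 ?_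
    intro p hp hq
    simp only [mem_filter, mem_product, mem_inter] at hp hq
    exact disjoint_left.1 (hdisj i j hij) hp.1.1.1 hq.1.1.1

/-- A set of edges from `A` to `B` forming a matching has few edges that do not go
from `S` to its complement. -/
lemma card_matching_le (A B S : Finset V) (M : Finset (V × V))
    (hends : ∀ p ∈ M, p.1 ∈ A ∧ p.2 ∈ B)
    (hmatch : ∀ p ∈ M, ∀ q ∈ M, p ≠ q → p.1 ≠ q.1 ∧ p.2 ≠ q.2) :
    M.card ≤ (M.filter fun p => p.1 ∈ S ∧ p.2 ∉ S).card + (A \ S).card + (B ∩ S).card := by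
  have h1 : (M.filter fun p => p.1 ∉ S).card ≤ (A \ S).card := by
    refine card_le_card_of_injOn Prod.fst (fun p hp => ?_) fun p hp q hq hpq => ?_
    · have := mem_filter.1 hp
      exact mem_sdiff.2 ⟨(hends p this.1).1, this.2⟩
    · by_contra hne
      exact (hmatch p (mem_filter.1 hp).1 q (mem_filter.1 hq).1 hne).1 hpq
  have h2 : (M.filter fun p => p.2 ∈ S).card ≤ (B ∩ S).card := by
    refine card_le_card_of_injOn Prod.snd (fun p hp => ?_) fun p hp q hq hpq => ?_
    · have := mem_filter.1 hp
      exact mem_inter.2 ⟨(hends p this.1).2, this.2⟩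
    · by_contra hne
      exact (hmatch p (mem_filter.1 hp).1 q (mem_filter.1 hq).1 hne).2 hpq
  have h3 : M ⊆ (M.filter fun p => p.1 ∈ S ∧ p.2 ∉ S) ∪ (M.filter fun p => p.1 ∉ S) ∪
      (M.filter fun p => p.2 ∈ S) := by
    intro p hp
    simp only [mem_union, mem_filter, hp, true_and]
    tauto
  have := card_le_card h3
  have := card_union_le ((M.filter fun p => p.1 ∈ S ∧ p.2 ∉ S) ∪ (M.filter fun p => p.1 ∉ S))
    (M.filter fun p => p.2 ∈ S)
  have := card_union_le (M.filter fun p => p.1 ∈ S ∧ p.2 ∉ S) (M.filter fun p => p.1 ∉ S)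
  omega

/-- The cut edges in the bipartite pieces between disjoint parts add up to at most the
whole cut. -/
lemma sum_card_cut_pieces_le {ι : Type*} [Fintype V] (G : SimpleGraph V)
    (P : ι → Finset V) (M : ι → ι → Finset (V × V)) (E : Finset (ι × ι))
    (hdisj : ∀ i j, i ≠ j → Disjoint (P i) (P j))
    (hends : ∀ e ∈ E, ∀ p ∈ M e.1 e.2, p.1 ∈ P e.1 ∧ p.2 ∈ P e.2)
    (hadj : ∀ e ∈ E, ∀ p ∈ M e.1 e.2, G.Adj p.1 p.2) (S : Finset V) :
    ∑ e ∈ E, ((M e.1 e.2).filter fun p => p.1 ∈ S ∧ p.2 ∉ S).card ≤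
      interEdges G S (univ \ S) := by
  unfold interEdges
  rw [← card_biUnion]
  · refine card_le_card fun p hp => ?_
    obtain ⟨e, he, hp⟩ := mem_biUnion.1 hp
    have hp := mem_filter.1 hp
    simp only [mem_filter, mem_product, mem_sdiff, mem_univ, true_and]
    exact ⟨hp.2, hadj e he p hp.1⟩
  · intro e he f hf hef
    refine disjoint_left.2 ?_
    intro p hp hq
    have hp := hends e he p (mem_filter.1 hp).1
    have hq := hends f hf p (mem_filter.1 hq).1
    refine hef (Prod.ext ?_ ?_)
    · by_contra hne
      exact disjoint_left.1 (hdisj _ _ hne) hp.1 hq.1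
    · by_contra hne
      exact disjoint_left.1 (hdisj _ _ hne) hp.2 hq.2

/-- If each part outside `A` of a cover contains at most `f i` elements of `X`, then
the size of `X` is controlled by `f` and the number and sizes of the parts in `A`. -/
lemma card_le_sum_add_of_cover {ι : Type*} [Fintype ι] (P : ι → Finset V)
    (hcover : ∀ v, ∃ i, v ∈ P i) (X : Finset V) (A : Finset ι) (f : ι → ℕ) (c : ℝ)
    (hA : ∀ i ∈ A, ((P i).card : ℝ) ≤ c) (hf : ∀ i ∉ A, (P i ∩ X).card ≤ f i) :
    (X.card : ℝ) ≤ (∑ i, f i : ℕ) + c * A.card := by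
  have h1 : X ⊆ univ.biUnion fun i => P i ∩ X := by
    intro v hv
    obtain ⟨i, hi⟩ := hcover v
    exact mem_biUnion.2 ⟨i, mem_univ i, mem_inter.2 ⟨hi, hv⟩⟩
  have h2 : X.card ≤ ∑ i, (P i ∩ X).card := (card_le_card h1).trans card_biUnion_le
  have h3 : ∀ i, ((P i ∩ X).card : ℝ) ≤ f i + if i ∈ A then c else 0 := by
    intro i
    split_ifs with hi
    · have : ((P i ∩ X).card : ℝ) ≤ (P i).card := by
        exact_mod_cast card_le_card inter_subset_left
      linarith [hA i hi, Nat.cast_nonneg (α := ℝ) (f i)]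
    · have : ((P i ∩ X).card : ℝ) ≤ f i := by exact_mod_cast hf i hi
      linarith
  calc (X.card : ℝ) ≤ ∑ i, ((P i ∩ X).card : ℝ) := by exact_mod_cast h2
    _ ≤ ∑ i, ((f i : ℝ) + if i ∈ A then c else 0) := sum_le_sum fun i _ => h3 i
    _ = (∑ i, f i : ℕ) + c * A.card := by
      rw [sum_add_distrib, sum_ite_mem, univ_inter, sum_const, nsmul_eq_mul, Nat.cast_sum]
      ring

/-- The arithmetic combining the bounds on a cut of size `c`. -/
lemma composition_cut_arith {N γ ψ ψ' Δ D e a m c : ℝ} (hN : 0 ≤ N) (hγ : 1 ≤ γ)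
    (hψ0 : 0 < ψ) (hψ1 : ψ ≤ 1) (hψ' : 0 < ψ') (hΔ : 1 ≤ Δ) (hψΔ : ψ' ≤ Δ) (hc : 0 ≤ c)
    (hD : ψ * D ≤ c) (he : N * e ≤ c + Δ * D) (ha : ψ' * a ≤ e) (hm : m ≤ D + γ * N * a) :
    ψ * ψ' / (16 * Δ * γ ^ 2) * m ≤ c := by
  have h1 : ψ * (N * e) ≤ 2 * Δ * c := by
    have h := mul_le_mul_of_nonneg_left he hψ0.le
    have h' := mul_le_mul_of_nonneg_left hD (zero_le_one.trans hΔ)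
    nlinarith
  have h2 : ψ * ψ' * (N * a) ≤ 2 * Δ * c := by
    have h := mul_le_mul_of_nonneg_left ha (mul_nonneg hψ0.le hN)
    nlinarith
  have h3 : ψ * ψ' * D ≤ Δ * c := by
    have h := mul_le_mul_of_nonneg_left hD hψ'.le
    have h' := mul_le_mul_of_nonneg_right hψΔ hc
    nlinarith
  have h4 : ψ * ψ' * m ≤ Δ * c + γ * (2 * Δ * c) := by
    have h := mul_le_mul_of_nonneg_left hm (mul_pos hψ0 hψ').le
    have h' := mul_le_mul_of_nonneg_left h2 (zero_le_one.trans hγ)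
    nlinarith
  have hΔc : 0 ≤ Δ * c := by positivity
  have h5 : Δ * c ≤ γ ^ 2 * (Δ * c) := le_mul_of_one_le_left hΔc (by nlinarith)
  have h6 : γ * (Δ * c) ≤ γ ^ 2 * (Δ * c) :=
    mul_le_mul_of_nonneg_right (by nlinarith) hΔc
  rw [div_mul_eq_mul_div, div_le_iff₀ (by positivity)]
  nlinarith

/-- composing expanders yields an expander.  The graphs `Gᵢ` live on
the pairwise disjoint parts `P i` of the vertex set of `G`, the graph `H` lives on
the index set `ι` (whose cardinality is `h`), and for each edge `(i,j)` of `H` the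
set `M i j` is a matching of cardinality `N` between `P i` and `P j`; the graph `G`
is the `N`-composition of `H` with the `Gᵢ`'s. -/
theorem expander_composition
    {ι : Type*} [Fintype ι] [DecidableEq ι] [Fintype V] [DecidableEq V]
    (H : SimpleGraph ι) (P : ι → Finset V) (Ginner : ι → SimpleGraph V)
    (M : ι → ι → Finset (V × V)) (G : SimpleGraph V)
    (N : ℕ) (γ ψ ψ' : ℝ) (Δ : ℕ)
    (hh : 1 < Fintype.card ι)
    (hN : 1 ≤ N) (hγ : 1 ≤ γ) (hψ0 : 0 < ψ) (hψ1 : ψ ≤ 1)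
    (hdisj : ∀ i j, i ≠ j → Disjoint (P i) (P j))
    (hcover : Finset.univ.biUnion P = Finset.univ)
    (hsizelo : ∀ i, N ≤ (P i).card)
    (hsizehi : ∀ i, ((P i).card : ℝ) ≤ γ * N)
    (hinner_supp : ∀ i u v, (Ginner i).Adj u v → u ∈ P i ∧ v ∈ P i)
    (hinner_exp : ∀ i, expanderGe (Ginner i) (P i) ψ)
    (hH_exp : expanderGe H Finset.univ ψ')
    (hΔ : maxDeg H = Δ)
    (hM_symm : ∀ i j u v, (u, v) ∈ M i j ↔ (v, u) ∈ M j i)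
    (hM_card : ∀ i j, H.Adj i j → (M i j).card = N)
    (hM_ends : ∀ i j, H.Adj i j → ∀ p ∈ M i j, p.1 ∈ P i ∧ p.2 ∈ P j)
    (hM_match : ∀ i j, H.Adj i j → ∀ p ∈ M i j, ∀ q ∈ M i j, p ≠ q →
      p.1 ≠ q.1 ∧ p.2 ≠ q.2)
    (hG : ∀ u v, G.Adj u v ↔
      ((∃ i, (Ginner i).Adj u v) ∨
        ∃ i j, H.Adj i j ∧ ((u, v) ∈ M i j ∨ (v, u) ∈ M i j))) :
    expanderGe G Finset.univ (ψ * ψ' / (16 * (Δ : ℝ) * γ ^ 2)) := by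
  rename_i _ instι _ instV
  obtain rfl : instι = fun a b => Classical.propDecidable (a = b) := Subsingleton.elim _ _
  obtain rfl : instV = fun a b => Classical.propDecidable (a = b) := Subsingleton.elim _ _
  by_cases hpos : ψ' ≤ 0 ∨ Δ = 0
  · intro S _ _ _
    refine le_trans (mul_nonpos_of_nonpos_of_nonneg ?_ (Nat.cast_nonneg _)) (Nat.cast_nonneg _)
    rcases hpos with h | h
    · exact div_nonpos_of_nonpos_of_nonneg (mul_nonpos_of_nonneg_of_nonpos hψ0.le h)
        (by positivity)
    · simp [h]
  push Not at hpos
  obtain ⟨hψ', hΔ0⟩ := hpos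
  intro S _ _ _
  have hcov : ∀ v, ∃ i, v ∈ P i := fun v => by
    simpa using hcover.ge (mem_univ v)
  let f : ι → ℕ := fun i => min (P i ∩ S).card (P i \ S).card
  let A : Finset ι := univ.filter fun i => (P i \ S).card ≤ (P i ∩ S).card
  have hfA : ∀ i ∈ A, f i = (P i \ S).card := fun i hi => min_eq_right (mem_filter.1 hi).2
  have hfB : ∀ i ∉ A, f i = (P i ∩ S).card := fun i hi =>
    min_eq_left (le_of_not_ge fun h => hi (mem_filter.2 ⟨mem_univ i, h⟩))
  let E := (A ×ˢ (univ \ A)).filter fun p => H.Adj p.1 p.2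
  have hE : ∀ e ∈ E, H.Adj e.1 e.2 := fun e he => (mem_filter.1 he).2
  have hinner : ψ * ((∑ i, f i : ℕ) : ℝ) ≤ interEdges G S (univ \ S) := by
    have hK := sum_interEdges_parts_le G P Ginner hdisj
      (fun i u v h => (hG u v).2 (Or.inl ⟨i, h⟩)) S
    refine le_trans ?_ (Nat.cast_le.2 hK)
    push_cast
    rw [mul_sum]
    refine sum_le_sum fun i _ => ?_
    have hdiff : P i \ (P i ∩ S) = P i \ S := sdiff_inter_self_left _ _
    by_cases hS : (P i ∩ S).Nonempty ∧ (P i \ S).Nonempty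
    · have h := hinner_exp i (P i ∩ S) inter_subset_left hS.1
      rw [hdiff] at h
      exact h hS.2
    · have hf : f i = 0 := by
        rw [not_and_or, not_nonempty_iff_eq_empty, not_nonempty_iff_eq_empty] at hS
        rcases hS with h | h <;> simp [f, h]
      rw [hf]
      simp
  have hcross : N * E.card ≤ interEdges G S (univ \ S) + Δ * ∑ i, f i := by
    have hpieces := sum_card_cut_pieces_le G P M E hdisj (fun e he => hM_ends _ _ (hE e he))
      (fun e he p hp => (hG _ _).2 (Or.inr ⟨e.1, e.2, hE e he, Or.inl hp⟩)) S
    have hedge : ∀ e ∈ E, N ≤ ((M e.1 e.2).filter fun p => p.1 ∈ S ∧ p.2 ∉ S).card +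
        f e.1 + f e.2 := by
      intro e he
      have hAB := mem_product.1 (mem_filter.1 he).1
      rw [← hM_card _ _ (hE e he), hfA _ hAB.1, hfB _ (mem_sdiff.1 hAB.2).2]
      exact card_matching_le _ _ S _ (hM_ends _ _ (hE e he)) (hM_match _ _ (hE e he))
    have hsum := sum_le_sum hedge
    rw [sum_const, smul_eq_mul, sum_add_distrib, sum_add_distrib] at hsum
    have h1 := sum_fst_edges_le H A (univ \ A) f
    have h2 := sum_snd_edges_le H A (univ \ A) f
    have h3 := sum_sdiff (f := f) (subset_univ A)
    rw [hΔ] at h1 h2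
    rw [← h3, mul_comm N, mul_add]
    linarith
  have hHcut : ψ' * ((min A.card (univ \ A).card : ℕ) : ℝ) ≤ E.card := by
    by_cases hA : A.Nonempty ∧ (univ \ A).Nonempty
    · exact hH_exp A (subset_univ _) hA.1 hA.2
    · rw [not_and_or, not_nonempty_iff_eq_empty, not_nonempty_iff_eq_empty] at hA
      have h0 : min A.card (univ \ A).card = 0 := by
        rcases hA with h | h
        · rw [h, card_empty, Nat.zero_min]
        · rw [h, card_empty, Nat.min_zero]
      rw [h0]
      simp
  have hS := card_le_sum_add_of_cover P hcov S A f (γ * N) (fun i _ => hsizehi i)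
    fun i hi => (hfB i hi).ge
  have hT := card_le_sum_add_of_cover P hcov (univ \ S) (univ \ A) f (γ * N)
    (fun i _ => hsizehi i) fun i hi => by
      rw [hfA i (by simpa using hi)]
      exact card_le_card fun v hv => by simpa using hv
  have hψΔ : ψ' ≤ Δ := hΔ ▸ expansion_le_maxDeg H ψ' hh hH_exp
  refine composition_cut_arith (N := N) (D := (∑ i, f i : ℕ)) (e := E.card)
    (a := (min A.card (univ \ A).card : ℕ)) (Nat.cast_nonneg N) hγ hψ0 hψ1 hψ'
    (by exact_mod_cast Nat.one_le_iff_ne_zero.2 hΔ0) hψΔ (Nat.cast_nonneg _) hinner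
    (by exact_mod_cast hcross) hHcut ?_
  rcases le_total A.card (univ \ A).card with h | h
  · rw [min_eq_left h]
    exact le_trans (Nat.cast_le.2 (min_le_left _ _)) hS
  · rw [min_eq_right h]
    exact le_trans (Nat.cast_le.2 (min_le_right _ _)) hT
end

section
/- Let G and H be graphs with V(H) = V(G), and suppose H is a ψ-expander for some 0 < ψ < 1. Suppose there is an embedding of H into G with congestion at most cong, for some cong ≥ 1, i.e., a family {P(e) : e ∈ E(H)} of paths in G such that for each edge e ∈ E(H) the path P(e) connects the two endpoints of e in G, and every edge of G lies on at most cong of the paths. Then G is a (ψ/cong)-expander. -/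
open Finset
open scoped Classical

variable {V : Type*}

/-- A walk that starts in `S` and ends outside `S`, or the other way round, uses an edge of the
cut `(S, univ \ S)`. -/
theorem exists_cut_edge_mem_walk_edges [Fintype V] (G : SimpleGraph V) (S : Finset V) {u v : V}
    (p : G.Walk u v) (h : (u ∈ S ∧ v ∉ S) ∨ (v ∈ S ∧ u ∉ S)) :
    ∃ a b, a ∈ S ∧ b ∉ S ∧ G.Adj a b ∧ s(a, b) ∈ p.edges := by
  rcases h with ⟨hu, hv⟩ | ⟨hv, hu⟩
  · obtain ⟨d, hd, ha, hb⟩ := p.exists_boundary_dart (S : Set V) (by simpa) (by simpa)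
    exact ⟨d.fst, d.snd, by simpa using ha, by simpa using hb, d.adj,
      List.mem_map_of_mem hd⟩
  · obtain ⟨d, hd, ha, hb⟩ := p.reverse.exists_boundary_dart (S : Set V) (by simpa) (by simpa)
    refine ⟨d.fst, d.snd, by simpa using ha, by simpa using hb, d.adj, ?_⟩
    have : s(d.fst, d.snd) ∈ p.reverse.edges := List.mem_map_of_mem hd
    simpa using this

/-- if a `ψ`-expander `H` embeds into `G` (each edge of `H` is routed
along a path of `G` between its endpoints, reversing with orientation, so that
every edge of `G` lies on at most `cong` of the paths — counted over ordered
pairs, each unordered edge of `H` contributes two orientations with the same edge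
set, whence the bound `2 * cong`), then `G` is a `ψ/cong`-expander. -/
theorem embedding_expander_gives_expander
    [Fintype V] [DecidableEq V]
    (G H : SimpleGraph V) (ψ : ℝ) (cong : ℕ)
    (hψ0 : 0 < ψ) (hψ1 : ψ < 1) (hcong : 1 ≤ cong)
    (hH : expanderGe H Finset.univ ψ)
    (P : ∀ ⦃u v : V⦄, H.Adj u v → G.Walk u v)
    (hpath : ∀ u v (h : H.Adj u v), (P h).IsPath)
    (hsymm : ∀ u v (h : H.Adj u v), P h.symm = (P h).reverse)
    (hcongestion : ∀ a b, G.Adj a b →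
      (((Finset.univ.filter fun p : V × V =>
          ∃ h : H.Adj p.1 p.2, s(a, b) ∈ (P h).edges).card : ℕ) : ℝ) ≤ 2 * (cong : ℝ)) :
    expanderGe G Finset.univ (ψ / (cong : ℝ)) := by
  obtain rfl : ‹DecidableEq V› = fun a b => Classical.propDecidable (a = b) :=
    Subsingleton.elim _ _
  intro S hS hne hne'
  have hc : (0 : ℝ) < cong := by exact_mod_cast hcong
  set T := univ \ S with hT
  have hmemT : ∀ x, x ∈ T ↔ x ∉ S := by simp [hT]
  set D := (S ×ˢ T).filter fun p => H.Adj p.1 p.2 with hD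
  set F := (S ×ˢ T).filter fun p => G.Adj p.1 p.2 with hF
  set fiber : V × V → Finset (V × V) := fun q => univ.filter fun p : V × V =>
    ∃ h : H.Adj p.1 p.2, s(q.1, q.2) ∈ (P h).edges with hfiber
  have hdisj : Disjoint D (D.image Prod.swap) := by
    rw [Finset.disjoint_left]
    rintro ⟨u, v⟩ h1 h2
    simp only [hD, mem_filter, mem_product, mem_image, Prod.exists, Prod.swap_prod_mk,
      Prod.mk.injEq, hmemT] at h1 h2
    grind
  have hsub : D ∪ D.image Prod.swap ⊆ F.biUnion fiber := by
    rintro ⟨u, v⟩ h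
    have huv : H.Adj u v ∧ ((u ∈ S ∧ v ∉ S) ∨ (v ∈ S ∧ u ∉ S)) := by
      simp only [hD, mem_union, mem_filter, mem_product, mem_image, Prod.exists,
        Prod.swap_prod_mk, Prod.mk.injEq, hmemT] at h
      rcases h with h | ⟨a, b, h, rfl, rfl⟩
      · exact ⟨h.2, Or.inl h.1⟩
      · exact ⟨h.2.symm, Or.inr h.1⟩
    obtain ⟨a, b, ha, hb, hab, hmem⟩ := exists_cut_edge_mem_walk_edges G S (P huv.1) huv.2
    simp only [mem_biUnion]
    exact ⟨(a, b), by simp [hF, hmemT, ha, hb, hab], by simpa [hfiber] using ⟨huv.1, hmem⟩⟩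
  have hcard : 2 * D.card ≤ F.card * (2 * cong) := by
    calc 2 * D.card = (D ∪ D.image Prod.swap).card := by
          rw [card_union_of_disjoint hdisj, card_image_of_injective _ Prod.swap_injective, two_mul]
      _ ≤ (F.biUnion fiber).card := card_le_card hsub
      _ ≤ F.card * (2 * cong) := by
          refine card_biUnion_le_card_mul _ _ _ fun q hq => ?_
          have hfib := hcongestion q.1 q.2 (mem_filter.mp hq).2
          exact_mod_cast hfib
  have hDF : (D.card : ℝ) ≤ F.card * cong := by
    have : D.card ≤ F.card * cong := by linarith
    exact_mod_cast this
  have hexp : ψ * ((min S.card T.card : ℕ) : ℝ) ≤ D.card := hH S hS hne hne'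
  change ψ / cong * ((min S.card T.card : ℕ) : ℝ) ≤ F.card
  rw [div_mul_eq_mul_div, div_le_iff₀ hc]
  exact hexp.trans hDF
end

section
/- Let G be a graph on n vertices, and let H be a graph with V(H) = V(G) that is a ψ-expander for some 0 < ψ < 1. Let F be a set of k additional edges on V(G) (fake edges), let G+F denote the graph obtained by adding the edges of F to G, and let Δ_G be the maximum vertex degree of G+F. Suppose there is an embedding of H into G+F with congestion at most cong for some cong ≥ 1, and suppose k ≤ ψ·n/(32·Δ_G·cong). Then there exists a subgraph G' of G (V(G') ⊆ V(G), E(G') ⊆ E(G)) that is a (ψ/(6·Δ_G·cong))-expander, such that, writing A = V(G') and B = V(G)∖A, we have |A| ≥ n − 4·k·cong/ψ and |E_G(A,B)| ≤ 4·k. -/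
open Finset
open scoped Classical

variable {V : Type*}

theorem interEdges_congr {G K : SimpleGraph V} {A B : Finset V}
    (h : ∀ a ∈ A, ∀ b ∈ B, (G.Adj a b ↔ K.Adj a b)) : interEdges G A B = interEdges K A B := by
  unfold interEdges
  refine congrArg Finset.card (Finset.filter_congr fun p hp => ?_)
  obtain ⟨ha, hb⟩ := Finset.mem_product.mp hp
  exact h _ ha _ hb

theorem interEdges_union_left_le (G : SimpleGraph V) (A B C : Finset V) :
    interEdges G (A ∪ B) C ≤ interEdges G A C + interEdges G B C := by
  unfold interEdges
  rw [Finset.union_product, Finset.filter_union]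
  exact Finset.card_union_le _ _

theorem interEdges_mono_right (G : SimpleGraph V) (A : Finset V) {B C : Finset V} (h : B ⊆ C) :
    interEdges G A B ≤ interEdges G A C :=
  Finset.card_le_card (Finset.filter_subset_filter _ (Finset.product_subset_product_right h))

theorem interEdges_le_add_card {G K : SimpleGraph V} {F : Finset (Sym2 V)}
    (h : ∀ u v, K.Adj u v → G.Adj u v ∨ s(u, v) ∈ F) {A B : Finset V} (hAB : Disjoint A B) :
    interEdges K A B ≤ interEdges G A B + F.card := by
  have hinj : ((A ×ˢ B).filter fun p => s(p.1, p.2) ∈ F).card ≤ F.card := by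
    refine Finset.card_le_card_of_injOn (fun p => s(p.1, p.2)) (fun p hp => ?_) ?_
    · exact (Finset.mem_filter.mp hp).2
    · rintro ⟨a, b⟩ hp ⟨c, d⟩ hq heq
      simp only [Finset.coe_filter, Finset.mem_product, Set.mem_ofPred_eq] at hp hq
      rcases Sym2.eq_iff.mp heq with ⟨h₁, h₂⟩ | ⟨h₁, -⟩
      · exact Prod.ext h₁ h₂
      · have h₁ : a = d := h₁
        subst h₁
        exact absurd hq.1.2 (Finset.disjoint_left.mp hAB hp.1.1)
  refine le_trans ?_ (Nat.add_le_add_left hinj _)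
  unfold interEdges
  rw [← Finset.card_union_add_card_inter, ← Finset.filter_or]
  exact le_add_right (Finset.card_le_card (Finset.monotone_filter_right _ fun p _ => h p.1 p.2))

/-- A routing of `H` in `K` in which every edge of `K` is used by at most `c` ordered pairs
distorts cut sizes by a factor of at most `c`. -/
theorem interEdges_le_mul_of_routing [Fintype V] {H K : SimpleGraph V}
    (P : ∀ ⦃u v : V⦄, H.Adj u v → K.Walk u v) {c : ℕ}
    (hc : ∀ a b, K.Adj a b →
      (Finset.univ.filter fun p : V × V =>
        ∃ h : H.Adj p.1 p.2, s(a, b) ∈ (P h).edges).card ≤ c) (S : Finset V) :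
    interEdges H S (Finset.univ \ S) ≤ c * interEdges K S (Finset.univ \ S) := by
  let cut := (S ×ˢ (Finset.univ \ S)).filter fun q => K.Adj q.1 q.2
  let used (q : V × V) : Finset (V × V) := Finset.univ.filter fun p =>
    ∃ h : H.Adj p.1 p.2, s(q.1, q.2) ∈ (P h).edges
  have hused : (cut.biUnion used).card ≤ cut.card * c :=
    Finset.card_biUnion_le_card_mul _ _ _ fun q hq => hc _ _ (Finset.mem_filter.mp hq).2
  rw [mul_comm]
  refine le_trans (Finset.card_le_card ?_) hused
  rintro ⟨u, v⟩ hp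
  simp only [Finset.mem_filter, Finset.mem_product, Finset.mem_sdiff, Finset.mem_univ,
    true_and] at hp
  obtain ⟨⟨hu, hv⟩, h⟩ := hp
  obtain ⟨d, hd, h₁, h₂⟩ := (P h).exists_boundary_dart (S : Set V) hu hv
  simp only [cut, used, Finset.mem_biUnion, Finset.mem_filter, Finset.mem_product, Finset.mem_sdiff,
    Finset.mem_univ, true_and]
  exact ⟨d.toProd, ⟨⟨h₁, h₂⟩, d.adj⟩, h, List.mem_map.mpr ⟨d, hd, rfl⟩⟩

/-- Expander pruning: a graph whose cuts satisfy an expansion bound up to an additive error `k`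
becomes an expander after removing a small vertex set with a small edge boundary. -/
theorem exists_expanderGe_sdiff [Fintype V] (G : SimpleGraph V) {α φ k : ℝ}
    (hα : 0 < α) (hφα : 3 * φ ≤ α) (hk : 16 * k ≤ α * Fintype.card V)
    (hcut : ∀ S : Finset V, α * ((min S.card (Finset.univ \ S).card : ℕ) : ℝ) ≤
      interEdges G S (Finset.univ \ S) + k) :
    ∃ B : Finset V, expanderGe G (Finset.univ \ B) φ ∧ 2 * α * B.card ≤ 3 * k ∧
      (interEdges G B (Finset.univ \ B) : ℝ) ≤ φ * B.card := by
  let sparse : Finset (Finset V) := Finset.univ.filter fun B =>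
    2 * B.card ≤ Fintype.card V ∧ (interEdges G B (Finset.univ \ B) : ℝ) ≤ φ * B.card
  obtain ⟨B, hB, hmax⟩ := sparse.exists_max_image Finset.card
    ⟨∅, Finset.mem_filter.mpr ⟨Finset.mem_univ _, by simp, by simp [interEdges]⟩⟩
  simp only [sparse, Finset.mem_filter, Finset.mem_univ, true_and] at hB hmax
  obtain ⟨hBcard, hBe⟩ := hB
  have hBA : B.card + (Finset.univ \ B).card = Fintype.card V := by
    rw [Finset.card_sdiff_of_subset (Finset.subset_univ _), Finset.card_univ]
    have := B.card_le_univ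
    omega
  have hBsmall : 2 * α * B.card ≤ 3 * k := by
    have h := hcut B
    rw [min_eq_left (by omega)] at h
    nlinarith [mul_le_mul_of_nonneg_right hφα (Nat.cast_nonneg (α := ℝ) B.card)]
  refine ⟨B, ?_, hBsmall, hBe⟩
  have key : ∀ S ⊆ Finset.univ \ B, S.Nonempty → S.card ≤ ((Finset.univ \ B) \ S).card →
      φ * S.card ≤ interEdges G S ((Finset.univ \ B) \ S) := by
    intro S hS hne hle
    by_contra! hlt
    have hdisj : Disjoint B S := Finset.disjoint_left.mpr fun x hx hxS =>
      (Finset.mem_sdiff.mp (hS hxS)).2 hx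
    have hcard : (B ∪ S).card = B.card + S.card := Finset.card_union_of_disjoint hdisj
    have hcompl : Finset.univ \ (B ∪ S) = (Finset.univ \ B) \ S := by
      rw [Finset.sdiff_sdiff_left']
      ext; simp
    have hrest := Finset.card_sdiff_add_card_eq_card hS
    have hSpos := hne.card_pos
    have he : (interEdges G (B ∪ S) (Finset.univ \ (B ∪ S)) : ℝ) ≤ φ * (B ∪ S).card := by
      have h₁ := interEdges_union_left_le G B S (Finset.univ \ (B ∪ S))
      have h₂ := interEdges_mono_right G B
        (Finset.sdiff_subset_sdiff (Finset.Subset.refl (Finset.univ : Finset V))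
          (Finset.subset_union_left (s₁ := B) (s₂ := S)))
      rw [hcompl] at h₁ h₂ ⊢
      rw [hcard]
      have h₃ : (interEdges G (B ∪ S) ((Finset.univ \ B) \ S) : ℝ) ≤
          interEdges G B (Finset.univ \ B) + interEdges G S ((Finset.univ \ B) \ S) := by
        exact_mod_cast h₁.trans (Nat.add_le_add_right h₂ _)
      push_cast
      linarith
    by_cases hhalf : 2 * (B ∪ S).card ≤ Fintype.card V
    · have := hmax _ ⟨hhalf, he⟩
      omega
    · have h := hcut (B ∪ S)
      rw [min_eq_right (by rw [hcompl]; omega)] at h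
      have hn : (0 : ℝ) < Fintype.card V := by
        have : 0 < Fintype.card V := by omega
        exact_mod_cast this
      have hlow : (Fintype.card V : ℝ) ≤ B.card + 2 * (Finset.univ \ (B ∪ S)).card := by
        rw [hcompl]
        have : Fintype.card V ≤ B.card + 2 * ((Finset.univ \ B) \ S).card := by omega
        exact_mod_cast this
      have hsum : ((B ∪ S).card : ℝ) + (Finset.univ \ (B ∪ S)).card = Fintype.card V := by
        rw [hcompl]
        have : (B ∪ S).card + ((Finset.univ \ B) \ S).card = Fintype.card V := by omega
        exact_mod_cast this
      have h₁ := mul_le_mul_of_nonneg_right hφα (Nat.cast_nonneg (α := ℝ) (B ∪ S).card)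
      have h₂ := mul_le_mul_of_nonneg_left hlow hα.le
      have h₃ := congrArg (α * ·) hsum
      have h₄ := mul_pos hα hn
      simp only [mul_add] at h₂ h₃
      linarith
  intro S hS hne hne'
  rcases le_total S.card ((Finset.univ \ B) \ S).card with hle | hle
  · rw [min_eq_left hle]
    exact key S hS hne hle
  · rw [min_eq_right hle, interEdges_comm]
    have hss : (Finset.univ \ B) \ ((Finset.univ \ B) \ S) = S := Finset.sdiff_sdiff_eq_self hS
    have := key _ Finset.sdiff_subset hne' (by rwa [hss])
    rwa [hss] at this

/-- expander pruning with fake edges.  `GF` is the graph `G + F`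
obtained by adding a set `F` of `k` fake edges to `G`; if the `ψ`-expander `H`
embeds into `GF` with congestion `cong` (the count over ordered pairs is twice
the count over unordered edges of `H`, since reversing an orientation keeps the
same edge set), and `k ≤ ψ n / (32 Δ_G cong)` with `Δ_G` the maximum degree of
`GF`, then some subgraph `G'` of `G` on a vertex set `A` of size at least
`n − 4 k cong / ψ` with `|E_G(A, V∖A)| ≤ 4k` is a `ψ/(6 Δ_G cong)`-expander. -/
theorem extract_expander
    [Fintype V] [DecidableEq V]
    (G H GF : SimpleGraph V) (F : Finset (Sym2 V)) (k : ℕ) (ψ : ℝ) (cong : ℕ)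
    (hψ0 : 0 < ψ) (hψ1 : ψ < 1) (hcong : 1 ≤ cong)
    (hF_loopless : ∀ e ∈ F, ¬ e.IsDiag)
    (hk : F.card = k)
    (hGF : ∀ u v, GF.Adj u v ↔ (G.Adj u v ∨ s(u, v) ∈ F))
    (hH : expanderGe H Finset.univ ψ)
    (P : ∀ ⦃u v : V⦄, H.Adj u v → GF.Walk u v)
    (hpath : ∀ u v (h : H.Adj u v), (P h).IsPath)
    (hsymm : ∀ u v (h : H.Adj u v), P h.symm = (P h).reverse)
    (hcongestion : ∀ a b, GF.Adj a b →
      (((Finset.univ.filter fun p : V × V =>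
          ∃ h : H.Adj p.1 p.2, s(a, b) ∈ (P h).edges).card : ℕ) : ℝ) ≤ 2 * (cong : ℝ))
    (hk_small : (k : ℝ) ≤ ψ * (Fintype.card V : ℝ) / (32 * (maxDeg GF : ℝ) * (cong : ℝ))) :
    ∃ (A : Finset V) (G' : SimpleGraph V),
      G' ≤ G ∧ (∀ u v, G'.Adj u v → u ∈ A ∧ v ∈ A) ∧
      expanderGe G' A (ψ / (6 * (maxDeg GF : ℝ) * (cong : ℝ))) ∧
      (Fintype.card V : ℝ) - 4 * (k : ℝ) * (cong : ℝ) / ψ ≤ (A.card : ℝ) ∧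
      (interEdges G A Aᶜ : ℝ) ≤ 4 * (k : ℝ) := by
  obtain rfl : ‹DecidableEq V› = fun a b => Classical.propDecidable (a = b) :=
    Subsingleton.elim _ _
  rcases Nat.eq_zero_or_pos (maxDeg GF) with hΔ | hΔ
  · have hk0 : (k : ℝ) = 0 := le_antisymm (by simpa [hΔ] using hk_small) (Nat.cast_nonneg k)
    refine ⟨Finset.univ, G, le_rfl, by simp, ?_, by simp [hk0], by simp [interEdges]⟩
    intro S _ _ _
    simp [hΔ]
  have hΔ' : (1 : ℝ) ≤ maxDeg GF := by exact_mod_cast hΔ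
  have hc : (1 : ℝ) ≤ cong := by exact_mod_cast hcong
  have hc0 : (0 : ℝ) < cong := by linarith
  have hΔ0 : (0 : ℝ) < maxDeg GF := by linarith
  have hα : 0 < ψ / (2 * cong) := by positivity
  have hφα : 3 * (ψ / (6 * (maxDeg GF : ℝ) * cong)) ≤ ψ / (2 * cong) := by
    rw [show 3 * (ψ / (6 * (maxDeg GF : ℝ) * cong)) = ψ / (2 * cong) / maxDeg GF by
      field_simp; norm_num]
    exact div_le_self hα.le hΔ'
  have hk' : 16 * (k : ℝ) ≤ ψ / (2 * cong) * Fintype.card V := by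
    have h : 16 * (ψ * (Fintype.card V : ℝ) / (32 * (maxDeg GF : ℝ) * cong)) =
        ψ / (2 * cong) * Fintype.card V / maxDeg GF := by
      field_simp; ring
    have h' := div_le_self (mul_nonneg hα.le (Nat.cast_nonneg (α := ℝ) (Fintype.card V))) hΔ'
    linarith
  have hcut : ∀ S : Finset V,
      ψ / (2 * cong) * ((min S.card (Finset.univ \ S).card : ℕ) : ℝ) ≤
        interEdges G S (Finset.univ \ S) + (k : ℝ) := by
    intro S
    have hrout : (interEdges H S (Finset.univ \ S) : ℝ) ≤
        2 * cong * interEdges GF S (Finset.univ \ S) := by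
      have := interEdges_le_mul_of_routing P (c := 2 * cong)
        (fun a b hab => by exact_mod_cast hcongestion a b hab) S
      exact_mod_cast this
    have hfake : (interEdges GF S (Finset.univ \ S) : ℝ) ≤
        interEdges G S (Finset.univ \ S) + (k : ℝ) := by
      rw [← hk]
      exact_mod_cast interEdges_le_add_card (fun u v => (hGF u v).mp) Finset.disjoint_sdiff
    have hexp : ψ * ((min S.card (Finset.univ \ S).card : ℕ) : ℝ) ≤
        interEdges H S (Finset.univ \ S) := by
      rcases S.eq_empty_or_nonempty with rfl | hS
      · simp
      rcases (Finset.univ \ S).eq_empty_or_nonempty with hS' | hS'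
      · simp [hS']
      · exact hH S (Finset.subset_univ _) hS hS'
    refine le_trans ?_ hfake
    rw [div_mul_eq_mul_div, div_le_iff₀ (by positivity)]
    linarith
  obtain ⟨B, hexp, hcard, hedge⟩ :=
    exists_expanderGe_sdiff G hα hφα hk' hcut
  have hcompl : (Finset.univ \ B)ᶜ = B := by ext; simp
  have hsum : (B.card : ℝ) + (Finset.univ \ B).card = Fintype.card V := by
    have := Finset.card_sdiff_add_card_eq_card (Finset.subset_univ B)
    rw [Finset.card_univ] at this
    exact_mod_cast (add_comm _ _).trans this
  have hB : ψ * B.card ≤ 3 * k * cong := by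
    have h : 2 * (ψ / (2 * cong)) * B.card = ψ * B.card / cong := by field_simp
    rw [h, div_le_iff₀ hc0] at hcard
    exact hcard
  refine ⟨Finset.univ \ B,
    { Adj := fun u v => G.Adj u v ∧ u ∈ Finset.univ \ B ∧ v ∈ Finset.univ \ B
      symm := ⟨fun u v h => ⟨h.1.symm, h.2.2, h.2.1⟩⟩
      loopless := ⟨fun u h => G.loopless.irrefl u h.1⟩ },
    fun u v h => h.1, fun u v h => h.2, ?_, ?_, ?_⟩
  · intro S hS hne hne'
    refine (hexp S hS hne hne').trans_eq (congrArg Nat.cast (interEdges_congr ?_))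
    exact fun a ha b hb => ⟨fun h => ⟨h, hS ha, Finset.sdiff_subset hb⟩, fun h => h.1⟩
  · have h : (B.card : ℝ) ≤ 4 * k * cong / ψ := by
      rw [le_div_iff₀ hψ0]
      have : (0 : ℝ) ≤ k * cong := by positivity
      linarith
    linarith
  · rw [hcompl, interEdges_comm]
    have h₁ := mul_le_mul_of_nonneg_right hφα (Nat.cast_nonneg (α := ℝ) B.card)
    have : (0 : ℝ) ≤ k := Nat.cast_nonneg k
    linarith
end

section
/- There is a universal constant c such that the following holds for every even integer n ≥ 2 and every set V with |V| = n. Suppose M₁,…,M_T are perfect matchings on V arising from a play of the cut-matching game, meaning that for every i ∈ {1,…,T}: there is a partition (A_i,B_i) of V with n/4 ≤ |A_i| ≤ |B_i| and Σ_{j<i} |{ {u,v} ∈ M_j : u ∈ A_i, v ∈ B_i }| ≤ n/100; there is a partition (A_i',B_i') of V with |A_i'| = |B_i'| and A_i ⊆ A_i'; and M_i is a perfect matching on V in which every pair has one element in A_i' and the other in B_i'. Then T ≤ c·log n. -/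
open Finset
open scoped Classical

open Real in
/-- Gibbs' inequality for a two-point distribution compared with weights `3/4, 1/4`. -/
theorem negMulLog_avg_sub_ge {a b : ℝ} (ha : 0 ≤ a) (hb : 0 ≤ b) :
    a / 3 - b ≤ 2 * negMulLog ((a + b) / 2) - negMulLog a - negMulLog b := by
  have l2 : log 2 ≤ 1 := by linarith [log_le_sub_one_of_pos (show (0 : ℝ) < 2 by norm_num)]
  have l2' : 1 / 3 ≤ log 2 := by
    linarith [one_sub_inv_le_log_of_pos (show (0 : ℝ) < 2 by norm_num)]
  have l3 : 1 / 3 ≤ log 3 - log 2 := by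
    rw [← log_div (by norm_num) (by norm_num)]
    linarith [one_sub_inv_le_log_of_pos (show (0 : ℝ) < 3 / 2 by norm_num)]
  have l4 : log 4 = 2 * log 2 := by
    rw [show (4 : ℝ) = 2 ^ 2 by norm_num, log_pow]; norm_num
  rcases ha.eq_or_lt with rfl | ha
  · rcases hb.eq_or_lt with rfl | hb
    · simp
    · simp only [negMulLog, zero_add, log_div hb.ne' two_ne_zero]
      nlinarith
  rcases hb.eq_or_lt with rfl | hb
  · simp only [negMulLog, add_zero, log_div ha.ne' two_ne_zero]
    nlinarith
  have hs : 0 < a + b := by positivity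
  have h1 := one_sub_inv_le_log_of_pos (show 0 < a / (3 / 4 * (a + b)) by positivity)
  have h2 := one_sub_inv_le_log_of_pos (show 0 < b / (1 / 4 * (a + b)) by positivity)
  rw [log_div ha.ne' (by positivity), log_mul (by norm_num) hs.ne',
    log_div (by norm_num) (by norm_num), l4, inv_div] at h1
  rw [log_div hb.ne' (by positivity), log_mul (by norm_num) hs.ne',
    log_div (by norm_num) (by norm_num), l4, inv_div, log_one] at h2
  have h1' := mul_le_mul_of_nonneg_left h1 ha.le
  have h2' := mul_le_mul_of_nonneg_left h2 hb.le
  have e1 : a * (1 - 3 / 4 * (a + b) / a) = a - 3 / 4 * (a + b) := by field_simp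
  have e2 : b * (1 - 1 / 4 * (a + b) / b) = b - 1 / 4 * (a + b) := by field_simp
  rw [e1] at h1'
  rw [e2] at h2'
  simp only [negMulLog, log_div hs.ne' two_ne_zero]
  nlinarith

open Real in
theorem negMulLog_avg_sub_nonneg {a b : ℝ} (ha : 0 ≤ a) (hb : 0 ≤ b) :
    0 ≤ 2 * negMulLog ((a + b) / 2) - negMulLog a - negMulLog b := by
  have h := concaveOn_negMulLog.2 (Set.mem_Ici.2 ha) (Set.mem_Ici.2 hb)
    (show (0 : ℝ) ≤ 1 / 2 by norm_num) (show (0 : ℝ) ≤ 1 / 2 by norm_num) (by norm_num)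
  simp only [smul_eq_mul] at h
  rw [show (a + b) / 2 = 1 / 2 * a + 1 / 2 * b by ring]
  linarith

open Real in
theorem sum_negMulLog_le_log_card {V : Type*} [Fintype V] [Nonempty V] {p : V → ℝ}
    (hp : ∀ v, 0 ≤ p v) (hsum : ∑ v, p v = 1) :
    ∑ v, negMulLog (p v) ≤ log (Fintype.card V) := by
  have hn : (0 : ℝ) < Fintype.card V := by exact_mod_cast Fintype.card_pos
  have key (v : V) : negMulLog (p v) ≤
      p v * log (Fintype.card V) + ((Fintype.card V : ℝ)⁻¹ - p v) := by
    rcases (hp v).eq_or_lt with h | h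
    · simp [← h]
    have h1 := one_sub_inv_le_log_of_pos (mul_pos hn h)
    rw [log_mul hn.ne' h.ne'] at h1
    have h2 := mul_le_mul_of_nonneg_left h1 h.le
    have e : p v * (1 - (Fintype.card V * p v)⁻¹) = p v - (Fintype.card V : ℝ)⁻¹ := by
      field_simp
    rw [e] at h2
    simp only [negMulLog]
    linarith
  refine (Finset.sum_le_sum fun v _ => key v).trans ?_
  rw [Finset.sum_add_distrib, Finset.sum_sub_distrib, ← Finset.sum_mul, hsum]
  simp [hn.ne']

/-- `lazyWalk g t u v` is the probability that the walk started at `u`, which at step `j` stays put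
or moves along the involution `g j` with probability `1/2` each, is at `v` after `t` steps. -/
noncomputable def lazyWalk {V : Type*} (g : ℕ → V → V) : ℕ → V → V → ℝ
  | 0 => fun u v => if u = v then 1 else 0
  | t + 1 => fun u v => (lazyWalk g t u v + lazyWalk g t u (g t v)) / 2

/-- The total entropy of the lazy walk, over all starting points. -/
noncomputable def lazyWalkEntropy {V : Type*} [Fintype V] (g : ℕ → V → V) (t : ℕ) : ℝ :=
  ∑ u, ∑ v, Real.negMulLog (lazyWalk g t u v)

section lazyWalk

variable {V : Type*} {g : ℕ → V → V}

theorem lazyWalk_nonneg (t : ℕ) (u v : V) : 0 ≤ lazyWalk g t u v := by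
  induction t generalizing v with
  | zero => simp only [lazyWalk]; split_ifs <;> norm_num
  | succ t ih => simp only [lazyWalk]; linarith [ih v, ih (g t v)]

variable [Fintype V]

theorem sum_lazyWalk_left (t : ℕ) (v : V) : ∑ u, lazyWalk g t u v = 1 := by
  induction t generalizing v with
  | zero => simp [lazyWalk]
  | succ t ih =>
    simp only [lazyWalk]
    rw [← Finset.sum_div, Finset.sum_add_distrib, ih, ih]
    norm_num

theorem sum_comp_involutive {σ : V → V} (hσ : Function.Involutive σ) (F : V → ℝ) :
    ∑ v, F (σ v) = ∑ v, F v :=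
  Equiv.sum_comp hσ.toPerm F

theorem sum_lazyWalk_right (hg : ∀ j, Function.Involutive (g j)) (t : ℕ) (u : V) :
    ∑ v, lazyWalk g t u v = 1 := by
  induction t with
  | zero => simp [lazyWalk]
  | succ t ih =>
    simp only [lazyWalk]
    rw [← Finset.sum_div, Finset.sum_add_distrib, sum_comp_involutive (hg t) (lazyWalk g t u), ih]
    norm_num

theorem lazyWalkEntropy_zero : lazyWalkEntropy g 0 = 0 := by
  refine Finset.sum_eq_zero fun u _ => Finset.sum_eq_zero fun v _ => ?_
  simp only [lazyWalk]
  split_ifs <;> simp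

theorem lazyWalkEntropy_le [Nonempty V] (hg : ∀ j, Function.Involutive (g j)) (t : ℕ) :
    lazyWalkEntropy g t ≤ Fintype.card V * Real.log (Fintype.card V) := by
  refine (Finset.sum_le_sum fun u _ =>
    sum_negMulLog_le_log_card (lazyWalk_nonneg t u) (sum_lazyWalk_right hg t u)).trans ?_
  simp

/-- The probability flow across a cut is at most the number of crossing pairs so far. -/
theorem sum_lazyWalk_cut_le [DecidableEq V] (hg : ∀ j, Function.Involutive (g j)) {A B : Finset V}
    (hdisj : Disjoint A B) (hAB : A ∪ B = Finset.univ) (t : ℕ) :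
    ∑ u ∈ A, ∑ v ∈ B, lazyWalk g t u v ≤
      ((∑ j ∈ Finset.range t, #{u ∈ A | g j u ∈ B} : ℕ) : ℝ) := by
  induction t with
  | zero =>
    rw [Finset.range_zero, Finset.sum_empty, Nat.cast_zero]
    exact (Finset.sum_eq_zero fun u hu => Finset.sum_eq_zero fun v hv =>
      if_neg (Finset.disjoint_iff_ne.1 hdisj u hu v hv)).le
  | succ t ih =>
    have hinj : Function.Injective (g t) := (hg t).injective
    have hsub : B.image (g t) ⊆ B ∪ {u ∈ A | g t u ∈ B} := by
      intro w hw
      obtain ⟨v, hv, rfl⟩ := Finset.mem_image.1 hw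
      have : g t v ∈ A ∪ B := hAB ▸ Finset.mem_univ _
      rcases Finset.mem_union.1 this with h | h
      · exact Finset.mem_union_right _ (Finset.mem_filter.2 ⟨h, by rwa [hg t v]⟩)
      · exact Finset.mem_union_left _ h
    have hmove (u : V) : ∑ v ∈ B, lazyWalk g t u (g t v) ≤
        ∑ v ∈ B, lazyWalk g t u v + ∑ v ∈ A with g t v ∈ B, lazyWalk g t u v := by
      rw [← Finset.sum_image (f := lazyWalk g t u) hinj.injOn, ← Finset.sum_union_inter]
      exact (Finset.sum_le_sum_of_subset_of_nonneg hsub fun v _ _ => lazyWalk_nonneg t u v).trans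
        (le_add_of_nonneg_right (Finset.sum_nonneg fun v _ => lazyWalk_nonneg t u v))
    have hcross : ∑ u ∈ A, ∑ v ∈ A with g t v ∈ B, lazyWalk g t u v ≤
        (#{u ∈ A | g t u ∈ B} : ℝ) := by
      rw [Finset.sum_comm, Finset.card_eq_sum_ones, Nat.cast_sum, Nat.cast_one]
      refine Finset.sum_le_sum fun v _ => ?_
      rw [← sum_lazyWalk_left (g := g) t v]
      exact Finset.sum_le_sum_of_subset_of_nonneg (Finset.subset_univ _)
        fun u _ _ => lazyWalk_nonneg t u v
    have hstep : ∑ u ∈ A, ∑ v ∈ B, lazyWalk g (t + 1) u v =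
        (∑ u ∈ A, ∑ v ∈ B, lazyWalk g t u v +
          ∑ u ∈ A, ∑ v ∈ B, lazyWalk g t u (g t v)) / 2 := by
      simp only [lazyWalk, ← Finset.sum_div, Finset.sum_add_distrib]
    have hmoves := Finset.sum_le_sum fun u (_ : u ∈ A) => hmove u
    rw [Finset.sum_add_distrib] at hmoves
    rw [hstep, Finset.sum_range_succ, Nat.cast_add]
    have : (0 : ℝ) ≤ #{u ∈ A | g t u ∈ B} := Nat.cast_nonneg _
    linarith

/-- A matching step sending `A` across the cut `(A, B)` raises the entropy of the walk. -/
theorem lazyWalkEntropy_succ_ge [DecidableEq V] (hg : ∀ j, Function.Involutive (g j)) {A B : Finset V}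
    (hdisj : Disjoint A B) (hAB : A ∪ B = Finset.univ) (t : ℕ) (hcross : ∀ v ∈ A, g t v ∈ B) :
    lazyWalkEntropy g t + (#A / 3 - 4 / 3 * ∑ u ∈ A, ∑ v ∈ B, lazyWalk g t u v) / 2 ≤
      lazyWalkEntropy g (t + 1) := by
  let gain (u v : V) : ℝ := 2 * Real.negMulLog ((lazyWalk g t u v + lazyWalk g t u (g t v)) / 2) -
    Real.negMulLog (lazyWalk g t u v) - Real.negMulLog (lazyWalk g t u (g t v))
  have hgain (u v : V) : 0 ≤ gain u v :=
    negMulLog_avg_sub_nonneg (lazyWalk_nonneg t u v) (lazyWalk_nonneg t u _)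
  have hsucc : lazyWalkEntropy g (t + 1) = lazyWalkEntropy g t + (∑ u, ∑ v, gain u v) / 2 := by
    simp only [lazyWalkEntropy]
    rw [Finset.sum_div, ← Finset.sum_add_distrib]
    refine Finset.sum_congr rfl fun u _ => ?_
    simp only [gain, lazyWalk]
    rw [Finset.sum_sub_distrib, Finset.sum_sub_distrib, ← Finset.mul_sum,
      sum_comp_involutive (hg t) fun v => Real.negMulLog (lazyWalk g t u v)]
    ring
  have hrow (u : V) : 1 / 3 - 4 / 3 * ∑ v ∈ B, lazyWalk g t u v ≤ ∑ v, gain u v := by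
    have hA : ∑ v ∈ A, lazyWalk g t u v + ∑ v ∈ B, lazyWalk g t u v = 1 := by
      rw [← Finset.sum_union hdisj, hAB, sum_lazyWalk_right hg]
    have hB : ∑ v ∈ A, lazyWalk g t u (g t v) ≤ ∑ v ∈ B, lazyWalk g t u v := by
      rw [← Finset.sum_image (f := lazyWalk g t u) (hg t).injective.injOn]
      exact Finset.sum_le_sum_of_subset_of_nonneg (Finset.image_subset_iff.2 hcross)
        fun v _ _ => lazyWalk_nonneg t u v
    have h1 : ∑ v ∈ A, (lazyWalk g t u v / 3 - lazyWalk g t u (g t v)) ≤ ∑ v, gain u v :=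
      (Finset.sum_le_sum fun v _ =>
        negMulLog_avg_sub_ge (lazyWalk_nonneg t u v) (lazyWalk_nonneg t u _)).trans
        (Finset.sum_le_sum_of_subset_of_nonneg (Finset.subset_univ A) fun v _ _ => hgain u v)
    rw [Finset.sum_sub_distrib, ← Finset.sum_div] at h1
    linarith
  have hsum : ∑ u ∈ A, (1 / 3 - 4 / 3 * ∑ v ∈ B, lazyWalk g t u v) ≤ ∑ u, ∑ v, gain u v :=
    (Finset.sum_le_sum fun u _ => hrow u).trans
      (Finset.sum_le_sum_of_subset_of_nonneg (Finset.subset_univ A)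
        fun u _ _ => Finset.sum_nonneg fun v _ => hgain u v)
  rw [Finset.sum_sub_distrib, ← Finset.mul_sum, Finset.sum_const, nsmul_eq_mul] at hsum
  rw [hsucc]
  linarith

end lazyWalk

/-- the cut-matching game terminates after `O(log n)` rounds.
Perfect matchings on `V` are encoded as fixed-point-free involutions
`f i : V → V`; for a partition `(A,B)` of `V`, the number of pairs of the
matching `f j` crossing the partition is `|{u ∈ A : f j u ∈ B}|`. -/
theorem cut_matching_game_rounds :
    ∃ c : ℝ, 0 < c ∧
      ∀ (V : Type) [Fintype V] [DecidableEq V] (T : ℕ) (f : Fin T → V → V),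
        2 ≤ Fintype.card V → Even (Fintype.card V) →
        (∀ i, Function.Involutive (f i)) →
        (∀ i v, f i v ≠ v) →
        (∀ i : Fin T, ∃ A B : Finset V, Disjoint A B ∧ A ∪ B = Finset.univ ∧
          (Fintype.card V : ℝ) / 4 ≤ (A.card : ℝ) ∧ A.card ≤ B.card ∧
          ((∑ j ∈ Finset.univ.filter fun j => j < i,
              (A.filter fun u => f j u ∈ B).card : ℕ) : ℝ) ≤ (Fintype.card V : ℝ) / 100 ∧
          ∃ A' B' : Finset V, Disjoint A' B' ∧ A' ∪ B' = Finset.univ ∧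
            A'.card = B'.card ∧ A ⊆ A' ∧ ∀ v ∈ A', f i v ∈ B') →
        (T : ℝ) ≤ c * Real.log (Fintype.card V) := by
  refine ⟨30, by norm_num, ?_⟩
  intro V _ _ T f hcard _ hinv _ hgame
  have : Nonempty V := Fintype.card_pos_iff.1 (by omega)
  have hn : (0 : ℝ) < Fintype.card V := by exact_mod_cast Fintype.card_pos
  let g (j : ℕ) : V → V := if h : j < T then f ⟨j, h⟩ else id
  have hgf (j : Fin T) : g j = f j := dif_pos j.2
  have hg (j : ℕ) : Function.Involutive (g j) := by
    by_cases h : j < T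
    · exact hgf ⟨j, h⟩ ▸ hinv ⟨j, h⟩
    · simp only [g, dif_neg h]
      exact fun _ => rfl
  have hgrowth (t : ℕ) (ht : t ≤ T) :
      (t : ℝ) * (Fintype.card V / 30) ≤ lazyWalkEntropy g t := by
    induction t with
    | zero => simp [lazyWalkEntropy_zero]
    | succ t ih =>
      obtain ⟨A, B, hdisj, hAB, hA, -, hsparse, A', B', hdisj', -, -, hAA', hmatch⟩ :=
        hgame ⟨t, ht⟩
      have hcross : ∀ v ∈ A, g t v ∈ B := by
        intro v hv
        have hB' : g t v ∈ B' := by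
          rw [hgf ⟨t, ht⟩]
          exact hmatch v (hAA' hv)
        have hmem : g t v ∈ A ∪ B := by rw [hAB]; exact Finset.mem_univ _
        exact (Finset.mem_union.1 hmem).resolve_left
          fun h => Finset.disjoint_left.1 hdisj' (hAA' h) hB'
      have hcount : (∑ j ∈ Finset.univ.filter fun j : Fin T => j < ⟨t, ht⟩,
          (A.filter fun u => f j u ∈ B).card) =
          ∑ j ∈ Finset.range t, #{u ∈ A | g j u ∈ B} := by
        rw [← Nat.Iio_eq_range, ← Fin.map_valEmbedding_Iio ⟨t, ht⟩, Finset.sum_map]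
        refine Finset.sum_congr (by ext; simp) fun j _ => ?_
        simp only [Fin.valEmbedding_apply, hgf]
      have hcut : ∑ u ∈ A, ∑ v ∈ B, lazyWalk g t u v ≤ Fintype.card V / 100 :=
        (sum_lazyWalk_cut_le hg hdisj hAB t).trans (hcount ▸ hsparse)
      have hstep := lazyWalkEntropy_succ_ge hg hdisj hAB t hcross
      have := ih (by omega)
      push_cast
      linarith
  have h := (hgrowth T le_rfl).trans (lazyWalkEntropy_le hg T)
  have : (T : ℝ) / 30 ≤ Real.log (Fintype.card V) := by
    refine le_of_mul_le_mul_left ?_ hn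
    linarith
  linarith
end

section
/- There is a universal constant c > 0 such that the following holds. Let V be a finite set of even size n ≥ 2, let M₁,…,M_{i−1} be perfect matchings on V, and let (A,B) be a partition of V with n/4 ≤ |A| ≤ |B| and Σ_{j<i} |{ {u,v} ∈ M_j : u ∈ A, v ∈ B }| ≤ n/100. Let (A',B') be a partition of V with |A'| = |B'| and A ⊆ A', and let M_i be a perfect matching on V in which every pair has one element in A' and one in B'. Then Φ_i ≥ Φ_{i−1} + c·n, where Φ_j is the entropy potential associated with M₁,…,M_i. -/
open Finset
open scoped Classical

variable {V : Type*}

/-- The distribution of the lazy random walk along the matchings `σ 1, σ 2, …`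
(each given as an involution of `V`): `walkProb σ j v u` is the probability
`p_j(v,u)` that the walk started at `v` is at `u` after `j` steps. -/
noncomputable def walkProb (σ : ℕ → V → V) : ℕ → V → V → ℝ
  | 0, v, u => if u = v then 1 else 0
  | j + 1, v, u => (walkProb σ j v u + walkProb σ j v (σ (j + 1) u)) / 2

/-- The entropy potential `Φ_j = Σ_v Σ_u p_j(v,u)·log(1/p_j(v,u))` (note that in
Lean `Real.log (1/0) = 0`, so the convention `0·log(1/0) = 0` holds
automatically). -/
noncomputable def entPotential [Fintype V] (σ : ℕ → V → V) (j : ℕ) : ℝ :=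
  ∑ v : V, ∑ u : V, walkProb σ j v u * Real.log (1 / walkProb σ j v u)

/-- The mass at `u` after `j` steps of the walks started at the vertices of `A`. -/
noncomputable def walkMass (σ : ℕ → V → V) (A : Finset V) (j : ℕ) (u : V) : ℝ :=
  ∑ v ∈ A, walkProb σ j v u

theorem walkProb_nonneg (σ : ℕ → V → V) (j : ℕ) (v u : V) : 0 ≤ walkProb σ j v u := by
  induction j generalizing u with
  | zero => simp only [walkProb]; split_ifs <;> norm_num
  | succ j ih =>
    have h₁ := ih u
    have h₂ := ih (σ (j + 1) u)
    simp only [walkProb]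
    positivity

theorem walkMass_zero (σ : ℕ → V → V) (A : Finset V) (u : V) :
    walkMass σ A 0 u = if u ∈ A then 1 else 0 := by
  simp [walkMass, walkProb]

theorem walkMass_succ (σ : ℕ → V → V) (A : Finset V) (j : ℕ) (u : V) :
    walkMass σ A (j + 1) u = (walkMass σ A j u + walkMass σ A j (σ (j + 1) u)) / 2 := by
  simp only [walkMass, walkProb, ← Finset.sum_add_distrib, Finset.sum_div]

theorem walkMass_nonneg (σ : ℕ → V → V) (A : Finset V) (j : ℕ) (u : V) :
    0 ≤ walkMass σ A j u :=
  Finset.sum_nonneg fun v _ => walkProb_nonneg σ j v u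

theorem walkMass_le_one (σ : ℕ → V → V) (A : Finset V) (j : ℕ) (u : V) :
    walkMass σ A j u ≤ 1 := by
  induction j generalizing u with
  | zero => rw [walkMass_zero]; split_ifs <;> norm_num
  | succ j ih =>
    rw [walkMass_succ]
    linarith [ih u, ih (σ (j + 1) u)]

theorem sum_comp_involutive_s9 [Fintype V] {s : V → V} (hs : Function.Involutive s) (f : V → ℝ) :
    ∑ u, f (s u) = ∑ u, f u :=
  Equiv.sum_comp hs.toPerm f

theorem sum_walkMass [Fintype V] (σ : ℕ → V → V) (A : Finset V) (j : ℕ)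
    (hσ : ∀ k, 1 ≤ k → k ≤ j → Function.Involutive (σ k)) :
    ∑ u, walkMass σ A j u = A.card := by
  induction j with
  | zero => simp [walkMass_zero]
  | succ j ih =>
    have h := ih fun k h₁ h₂ => hσ k h₁ (h₂.trans j.le_succ)
    simp only [walkMass_succ]
    rw [← Finset.sum_div, Finset.sum_add_distrib,
      sum_comp_involutive_s9 (hσ (j + 1) (by omega) le_rfl), h]
    ring

/-- The mass that leaks from `A` to `B` is at most half the number of crossing edges. -/
theorem sum_walkMass_le [Fintype V] [DecidableEq V] (σ : ℕ → V → V) (A B : Finset V)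
    (hd : Disjoint A B) (hu : A ∪ B = Finset.univ) (j : ℕ)
    (hσ : ∀ k, 1 ≤ k → k ≤ j → Function.Involutive (σ k)) :
    ∑ u ∈ B, walkMass σ A j u ≤
      ((∑ k ∈ Finset.Icc 1 j, (A.filter fun u => σ k u ∈ B).card : ℕ) : ℝ) / 2 := by
  induction j with
  | zero =>
    refine (Finset.sum_eq_zero fun u hu => ?_).trans_le (by positivity)
    rw [walkMass_zero, if_neg fun h => Finset.disjoint_left.mp hd h hu]
  | succ j ih =>
    have h := ih fun k h₁ h₂ => hσ k h₁ (h₂.trans j.le_succ)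
    have hinv := hσ (j + 1) (by omega) le_rfl
    have key : ∑ u ∈ B, walkMass σ A j (σ (j + 1) u) ≤
        ∑ u ∈ B, walkMass σ A j u + ((A.filter fun u => σ (j + 1) u ∈ B).card : ℝ) := by
      have e : ∑ u ∈ B, walkMass σ A j (σ (j + 1) u) =
          ∑ w, if σ (j + 1) w ∈ B then walkMass σ A j w else 0 := by
        rw [← sum_comp_involutive_s9 hinv]
        simp [hinv _, Finset.sum_ite_mem]
      have e₁ : ∑ u ∈ B, walkMass σ A j u = ∑ w, if w ∈ B then walkMass σ A j w else 0 := by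
        simp [Finset.sum_ite_mem]
      have e₂ : ((A.filter fun u => σ (j + 1) u ∈ B).card : ℝ) =
          ∑ w, if w ∈ A ∧ σ (j + 1) w ∈ B then 1 else 0 := by
        rw [Finset.sum_boole]
        congr 2
        ext w
        simp
      rw [e, e₁, e₂, ← Finset.sum_add_distrib]
      refine Finset.sum_le_sum fun w _ => ?_
      have h₀ := walkMass_nonneg σ A j w
      have h₁ := walkMass_le_one σ A j w
      have hw : w ∈ A ∨ w ∈ B := by rw [← Finset.mem_union, hu]; exact Finset.mem_univ w
      by_cases hA : w ∈ A <;> by_cases hB : w ∈ B <;> by_cases hs : σ (j + 1) w ∈ B <;>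
        simp only [hA, hB, hs, and_self, and_true, and_false, if_true, if_false] <;>
        first | linarith | exact (hw.elim hA hB).elim
    rw [Finset.sum_Icc_succ_top (by omega)]
    simp only [walkMass_succ]
    rw [← Finset.sum_div, Finset.sum_add_distrib]
    push_cast at h ⊢
    linarith

theorem mul_log_add_sub_le {x z : ℝ} (hx : 0 ≤ x) (hz : 0 < z) :
    x * Real.log z + x - z ≤ x * Real.log x := by
  rcases hx.eq_or_lt with rfl | hx
  · simp [hz.le]
  · have h := Real.log_le_sub_one_of_pos (div_pos hz hx)
    rw [Real.log_div hz.ne' hx.ne'] at h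
    have h' := mul_le_mul_of_nonneg_left h hx.le
    have e : x * (z / x - 1) = z - x := by field_simp
    linarith

/-- Gibbs' inequality for the two-point distribution proportional to `(a, b)`. -/
theorem mul_log_add_mul_log_le {a b s t : ℝ} (ha : 0 ≤ a) (hb : 0 ≤ b) (hs : 0 < s) (ht : 0 < t)
    (hst : s + t = 2) :
    a * Real.log s + b * Real.log t ≤
      a * Real.log a + b * Real.log b - (a + b) * Real.log ((a + b) / 2) := by
  rcases (add_nonneg ha hb).eq_or_lt with h | h
  · obtain rfl : a = 0 := by linarith
    obtain rfl : b = 0 := by linarith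
    simp
  · have hm : 0 < (a + b) / 2 := by linarith
    have h₁ := mul_log_add_sub_le ha (mul_pos hm hs)
    have h₂ := mul_log_add_sub_le hb (mul_pos hm ht)
    rw [Real.log_mul hm.ne' hs.ne'] at h₁
    rw [Real.log_mul hm.ne' ht.ne'] at h₂
    have e : (a + b) / 2 * s + (a + b) / 2 * t = a + b := by rw [← mul_add, hst]; ring
    linarith

/-- The entropy gained by replacing both `a` and `b` by their average. -/
noncomputable def entropyGain (a b : ℝ) : ℝ :=
  a * Real.log a + b * Real.log b - (a + b) * Real.log ((a + b) / 2)

theorem entropyGain_nonneg {a b : ℝ} (ha : 0 ≤ a) (hb : 0 ≤ b) : 0 ≤ entropyGain a b := by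
  simpa [entropyGain] using mul_log_add_mul_log_le ha hb one_pos one_pos (by norm_num)

theorem sub_le_entropyGain {a b : ℝ} (ha : 0 ≤ a) (hb : 0 ≤ b) : a / 3 - b ≤ entropyGain a b := by
  have h := mul_log_add_mul_log_le ha hb (s := 3 / 2) (t := 1 / 2)
    (by norm_num) (by norm_num) (by norm_num)
  have h₁ := Real.one_sub_inv_le_log_of_pos (show (0 : ℝ) < 3 / 2 by norm_num)
  have h₂ := Real.one_sub_inv_le_log_of_pos (show (0 : ℝ) < 1 / 2 by norm_num)
  have h₃ := mul_le_mul_of_nonneg_left h₁ ha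
  have h₄ := mul_le_mul_of_nonneg_left h₂ hb
  norm_num at h₃ h₄ h
  unfold entropyGain
  linarith

theorem entPotential_succ_sub [Fintype V] (σ : ℕ → V → V) (j : ℕ)
    (hσ : Function.Involutive (σ (j + 1))) :
    entPotential σ (j + 1) - entPotential σ j =
      (∑ v, ∑ u, entropyGain (walkProb σ j v u) (walkProb σ j v (σ (j + 1) u))) / 2 := by
  simp only [entPotential, ← Finset.sum_sub_distrib, Finset.sum_div]
  refine Finset.sum_congr rfl fun v _ => ?_
  have e := sum_comp_involutive_s9 hσ fun u => walkProb σ j v u * Real.log (walkProb σ j v u)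
  simp only [walkProb, entropyGain, one_div, Real.log_inv, mul_neg, ← Finset.sum_div,
    Finset.sum_sub_distrib, Finset.sum_neg_distrib, Finset.sum_add_distrib, e, div_mul_eq_mul_div]
  ring

/-- in each round of the cut-matching game, the entropy potential
increases by at least `c·n`. -/
theorem potential_increase :
    ∃ c : ℝ, 0 < c ∧
      ∀ (V : Type) [Fintype V] [DecidableEq V] (i : ℕ) (σ : ℕ → V → V)
        (A B A' B' : Finset V),
        2 ≤ Fintype.card V → Even (Fintype.card V) → 1 ≤ i →
        (∀ j, 1 ≤ j → j ≤ i → Function.Involutive (σ j) ∧ ∀ v, σ j v ≠ v) →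
        Disjoint A B → A ∪ B = Finset.univ →
        (Fintype.card V : ℝ) / 4 ≤ (A.card : ℝ) → A.card ≤ B.card →
        ((∑ j ∈ Finset.Icc 1 (i - 1), (A.filter fun u => σ j u ∈ B).card : ℕ) : ℝ) ≤
          (Fintype.card V : ℝ) / 100 →
        Disjoint A' B' → A' ∪ B' = Finset.univ → A'.card = B'.card → A ⊆ A' →
        (∀ v ∈ A', σ i v ∈ B') →
        entPotential σ (i - 1) + c * (Fintype.card V : ℝ) ≤ entPotential σ i := by
  refine ⟨1 / 30, by norm_num, ?_⟩
  intro V _ _ i σ A B A' B' _ _ hi hσ hd hu hA _ hcross hd' _ _ hAA' hσA'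
  obtain ⟨j, rfl⟩ : ∃ j, i = j + 1 := ⟨i - 1, by omega⟩
  simp only [Nat.add_sub_cancel] at hcross ⊢
  have hinv : ∀ k, 1 ≤ k → k ≤ j → Function.Involutive (σ k) :=
    fun k h₁ h₂ => (hσ k h₁ (h₂.trans j.le_succ)).1
  have hinv' := (hσ (j + 1) hi le_rfl).1
  have hAB : ∀ u ∈ A, σ (j + 1) u ∈ B := by
    intro u hu'
    have h₁ : σ (j + 1) u ∉ A := fun h =>
      Finset.disjoint_left.mp hd' (hAA' h) (hσA' u (hAA' hu'))
    have h₂ : σ (j + 1) u ∈ A ∪ B := by rw [hu]; exact Finset.mem_univ _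
    exact (Finset.mem_union.mp h₂).resolve_left h₁
  have hleak := sum_walkMass_le σ A B hd hu j hinv
  have htotal := sum_walkMass σ A j hinv
  rw [← hu, Finset.sum_union hd] at htotal
  have hmatch : ∑ u ∈ A, walkMass σ A j (σ (j + 1) u) ≤ ∑ u ∈ B, walkMass σ A j u := by
    rw [← Finset.sum_image (f := walkMass σ A j) fun x _ y _ h => hinv'.injective h]
    exact Finset.sum_le_sum_of_subset_of_nonneg (Finset.image_subset_iff.mpr hAB)
      fun u _ _ => walkMass_nonneg σ A j u
  have hp := walkProb_nonneg σ j
  have hgain : ∑ v ∈ A, ∑ u ∈ A, (walkProb σ j v u / 3 - walkProb σ j v (σ (j + 1) u)) ≤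
      ∑ v, ∑ u, entropyGain (walkProb σ j v u) (walkProb σ j v (σ (j + 1) u)) := by
    have hnn := fun v u => entropyGain_nonneg (hp v u) (hp v (σ (j + 1) u))
    calc
      _ ≤ ∑ v ∈ A, ∑ u ∈ A, entropyGain (walkProb σ j v u) (walkProb σ j v (σ (j + 1) u)) :=
        Finset.sum_le_sum fun v _ => Finset.sum_le_sum fun u _ => sub_le_entropyGain (hp _ _) (hp _ _)
      _ ≤ ∑ v ∈ A, ∑ u, entropyGain (walkProb σ j v u) (walkProb σ j v (σ (j + 1) u)) :=
        Finset.sum_le_sum fun v _ => Finset.sum_le_univ_sum_of_nonneg (hnn v)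
      _ ≤ _ := Finset.sum_le_univ_sum_of_nonneg fun v => Finset.sum_nonneg fun u _ => hnn v u
  have hswap : ∑ v ∈ A, ∑ u ∈ A, (walkProb σ j v u / 3 - walkProb σ j v (σ (j + 1) u)) =
      (∑ u ∈ A, walkMass σ A j u) / 3 - ∑ u ∈ A, walkMass σ A j (σ (j + 1) u) := by
    rw [Finset.sum_comm]
    simp only [walkMass, Finset.sum_sub_distrib, Finset.sum_div]
  have hdiff := entPotential_succ_sub σ j hinv'
  have hn : (0 : ℝ) ≤ Fintype.card V := Nat.cast_nonneg _
  linarith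
end

section
/- There is a constant c > 0 such that for all real numbers p and q with 0 < q and 2q ≤ p, the inequality p·log(2p/(p+q)) + q·log(2q/(p+q)) ≥ c·p holds, where log denotes the natural logarithm. -/
/-- The tangent-line lower bound for the logarithm at `a`, in reciprocal coordinates. -/
theorem Real.log_add_one_sub_div_le_log {a x : ℝ} (ha : 0 < a) (hx : 0 < x) :
    Real.log a + (1 - a / x) ≤ Real.log x := by
  have h := Real.one_sub_inv_le_log_of_pos (div_pos hx ha)
  rw [Real.log_div hx.ne' ha.ne', inv_div] at h
  linarith

/-- The Gibbs inequality on two points. -/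
theorem mul_log_add_mul_log_le_s10 {a b p q : ℝ} (ha : 0 < a) (hb : 0 < b) (hab : a + b = 2)
    (hp : 0 < p) (hq : 0 < q) :
    p * Real.log a + q * Real.log b ≤
      p * Real.log (2 * p / (p + q)) + q * Real.log (2 * q / (p + q)) := by
  have h₁ := mul_le_mul_of_nonneg_left
    (Real.log_add_one_sub_div_le_log ha (show 0 < 2 * p / (p + q) by positivity)) hp.le
  have h₂ := mul_le_mul_of_nonneg_left
    (Real.log_add_one_sub_div_le_log hb (show 0 < 2 * q / (p + q) by positivity)) hq.le
  have h₃ : p * (1 - a / (2 * p / (p + q))) + q * (1 - b / (2 * q / (p + q))) = 0 := by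
    obtain rfl : b = 2 - a := by linarith
    field_simp
    ring
  linarith

/-- the key entropy inequality — there is a constant `c > 0` such
that for all reals `p`, `q` with `0 < q` and `2q ≤ p`,
`p·log(2p/(p+q)) + q·log(2q/(p+q)) ≥ c·p`, with the natural logarithm. -/
theorem entropy_gain_inequality :
    ∃ c : ℝ, 0 < c ∧
      ∀ p q : ℝ, 0 < q → 2 * q ≤ p →
        c * p ≤ p * Real.log (2 * p / (p + q)) + q * Real.log (2 * q / (p + q)) := by
  have hlog : 2 * Real.log (4 / 3) + Real.log (2 / 3) = Real.log (32 / 27) := by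
    rw [two_mul, ← Real.log_mul (by norm_num) (by norm_num),
      ← Real.log_mul (by norm_num) (by norm_num)]
    norm_num
  have hpos : 0 < Real.log (32 / 27) := Real.log_pos (by norm_num)
  have hneg : Real.log (2 / 3) < 0 := Real.log_neg (by norm_num) (by norm_num)
  refine ⟨Real.log (32 / 27) / 2, half_pos hpos, fun p q hq hpq => ?_⟩
  have hp : 0 < p := by linarith
  have h := mul_log_add_mul_log_le_s10 (a := 4 / 3) (b := 2 / 3)
    (by norm_num) (by norm_num) (by norm_num) hp hq
  rw [← hlog]
  nlinarith [mul_nonneg (sub_nonneg.mpr hpq) (neg_nonneg.mpr hneg.le)]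
end

section
/- Let 0 < ψ₀ ≤ 1 and let G be a graph whose vertex set is partitioned into clusters U₁,…,U_n such that: (a) for every j, the induced subgraph G[U_j] is a ψ₀-expander, and (b) every vertex of G is incident to at most one edge whose endpoints lie in different clusters. Let (A,B) be a partition of V(G) with |E_G(A,B)| ≤ ψ·min(|A|,|B|), where 0 < ψ ≤ ψ₀/2. Then there exists a partition (A',B') of V(G) such that every cluster U_j is entirely contained in A' or entirely contained in B', |A'| ≥ |A|/2, |B'| ≥ |B|/2, and |E_G(A',B')| ≤ (1 + 1/ψ₀)·|E_G(A,B)|. -/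
open Finset
open scoped Classical

variable {V : Type*}

/-- An expander has at least `ψ` times the smaller side many edges across any bipartition,
including the trivial ones. -/
theorem expanderGe.mul_min_card_le {G : SimpleGraph V} {U S T : Finset V} {ψ : ℝ}
    (h : expanderGe G U ψ) (hST : Disjoint S T) (hU : ∀ v, v ∈ U ↔ v ∈ S ∨ v ∈ T) :
    ψ * ((min S.card T.card : ℕ) : ℝ) ≤ (interEdges G S T : ℝ) := by
  have hT : U \ S = T := by
    ext v
    have : v ∈ S → v ∉ T := fun h => Finset.disjoint_left.mp hST h
    simp only [Finset.mem_sdiff, hU]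
    tauto
  rcases S.eq_empty_or_nonempty with rfl | hS
  · simp
  rcases T.eq_empty_or_nonempty with rfl | hT'
  · simp
  have := h S (fun v hv => (hU v).2 (Or.inl hv)) hS (hT ▸ hT')
  rwa [hT] at this

/-- The edges of a cut inside the fibers of a map are among the edges of the cut. -/
theorem sum_interEdges_fiber_le {ι : Type*} [Fintype ι] (G : SimpleGraph V) (c : V → ι)
    (A B : Finset V) :
    ∑ i, interEdges G (A.filter (c · = i)) (B.filter (c · = i)) ≤ interEdges G A B := by
  unfold interEdges
  rw [Finset.card_eq_sum_card_fiberwise (f := fun p : V × V => c p.1) (t := Finset.univ)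
    (fun _ _ => Finset.mem_coe.2 (Finset.mem_univ _))]
  refine Finset.sum_le_sum fun i _ => Finset.card_le_card fun p hp => ?_
  simp only [Finset.mem_filter, Finset.mem_product] at hp ⊢
  tauto

/-- If `S` contains the vertices on which the cuts `(A, B)` and `(A', B')` differ, and every
vertex has at most one incident edge in `(A', B')`, then the second cut has at most `|S|` more
edges than the first. -/
theorem interEdges_le_add_card_s11 {G : SimpleGraph V} {A B A' B' S : Finset V}
    (hA : ∀ v ∈ A', v ∉ S → v ∈ A) (hB : ∀ v ∈ B', v ∉ S → v ∈ B) (hdisj : Disjoint A' B')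
    (hleft : ∀ u ∈ A', ∀ v ∈ B', ∀ w ∈ B', G.Adj u v → G.Adj u w → v = w)
    (hright : ∀ u ∈ B', ∀ v ∈ A', ∀ w ∈ A', G.Adj u v → G.Adj u w → v = w) :
    interEdges G A' B' ≤ interEdges G A B + S.card := by
  unfold interEdges
  rw [← Finset.card_filter_add_card_filter_not (s := (A' ×ˢ B').filter fun p => G.Adj p.1 p.2)
    (fun p => p.1 ∉ S ∧ p.2 ∉ S)]
  refine add_le_add (Finset.card_le_card fun p hp => ?_) ?_
  · simp only [Finset.mem_filter, Finset.mem_product] at hp ⊢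
    exact ⟨⟨hA _ hp.1.1.1 hp.2.1, hB _ hp.1.1.2 hp.2.2⟩, hp.1.2⟩
  · refine Finset.card_le_card_of_injOn (fun p => if p.1 ∈ S then p.1 else p.2) ?_ ?_
    · intro p hp
      simp only [Finset.coe_filter, Finset.mem_filter, Set.mem_ofPred_eq] at hp
      simp only [Finset.mem_coe]
      split_ifs with h
      · exact h
      · tauto
    · rintro ⟨u, v⟩ hp ⟨x, y⟩ hq hpq
      simp only [Finset.coe_filter, Finset.mem_filter, Finset.mem_product,
        Set.mem_ofPred_eq] at hp hq
      obtain ⟨⟨⟨hu, hv⟩, huv⟩, -⟩ := hp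
      obtain ⟨⟨⟨hx, hy⟩, hxy⟩, -⟩ := hq
      dsimp only at hpq
      split_ifs at hpq
      · subst hpq
        rw [hleft u hu v hv y hy huv hxy]
      · exact absurd hy (hpq ▸ Finset.disjoint_left.mp hdisj hu)
      · exact absurd hv (hpq ▸ Finset.disjoint_left.mp hdisj hx)
      · subst hpq
        rw [hright v hv u hu x hx huv.symm hxy.symm]

/-- making a sparse cut canonical with respect to a clustering
into expanders.  The clusters `U i` partition `V(G)`, each `G[U i]` is a
`ψ₀`-expander, and each vertex is incident to at most one inter-cluster edge.
Any cut `(A,B)` of sparsity at most `ψ ≤ ψ₀/2` can be converted into a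
cluster-respecting cut `(A',B')` that loses at most half of each side and whose
number of cut edges grows by at most the factor `1 + 1/ψ₀`. -/
theorem make_canonical
    {ι : Type*} [Fintype V] [DecidableEq V] [Fintype ι]
    (G : SimpleGraph V) (U : ι → Finset V) (ψ₀ ψ : ℝ) (A B : Finset V)
    (hψ₀0 : 0 < ψ₀) (hψ₀1 : ψ₀ ≤ 1)
    (hdisj : ∀ i j, i ≠ j → Disjoint (U i) (U j))
    (hcover : Finset.univ.biUnion U = Finset.univ)
    (hexp : ∀ i, expanderGe G (U i) ψ₀)
    (hinc : ∀ v : V, (Finset.univ.filter fun u =>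
        G.Adj v u ∧ ¬ ∃ i, v ∈ U i ∧ u ∈ U i).card ≤ 1)
    (hAB : Disjoint A B) (hABu : A ∪ B = Finset.univ)
    (hψ0 : 0 < ψ) (hψ : ψ ≤ ψ₀ / 2)
    (hcut : (interEdges G A B : ℝ) ≤ ψ * ((min A.card B.card : ℕ) : ℝ)) :
    ∃ A' B' : Finset V, Disjoint A' B' ∧ A' ∪ B' = Finset.univ ∧
      (∀ i, U i ⊆ A' ∨ U i ⊆ B') ∧
      (A.card : ℝ) / 2 ≤ (A'.card : ℝ) ∧ (B.card : ℝ) / 2 ≤ (B'.card : ℝ) ∧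
      (interEdges G A' B' : ℝ) ≤ (1 + 1 / ψ₀) * (interEdges G A B : ℝ) := by
  have hc : ∀ v, ∃ i, v ∈ U i := fun v => by
    simpa using (Finset.ext_iff.mp hcover v).2 (Finset.mem_univ v)
  choose c hc using hc
  have hmem : ∀ v i, v ∈ U i ↔ c v = i := fun v i => by
    refine ⟨fun h => ?_, fun h => h ▸ hc v⟩
    by_contra hne
    exact Finset.disjoint_left.mp (hdisj _ _ hne) (hc v) h
  have hor : ∀ v, v ∈ A ∨ v ∈ B := fun v => by
    simpa using (Finset.ext_iff.mp hABu v).2 (Finset.mem_univ v)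
  have huniq : ∀ u v w, G.Adj u v → G.Adj u w → c u ≠ c v → c u ≠ c w → v = w := by
    intro u v w huv huw hv hw
    refine Finset.card_le_one.mp (hinc u) v ?_ w ?_ <;>
      simp [hmem, huv, huw, Ne.symm hv, Ne.symm hw]
  let P : ι → Prop := fun i => (B.filter (c · = i)).card ≤ (A.filter (c · = i)).card
  let A' : Finset V := Finset.univ.filter fun v => P (c v)
  let B' : Finset V := Finset.univ.filter fun v => ¬ P (c v)
  let S : Finset V := Finset.univ.filter fun v => v ∈ A ∧ ¬ P (c v) ∨ v ∈ B ∧ P (c v)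
  have hA' : ∀ v, v ∈ A' ↔ P (c v) := fun v => by simp [A']
  have hB' : ∀ v, v ∈ B' ↔ ¬ P (c v) := fun v => by simp [B']
  have hS : ∀ v, v ∈ S ↔ v ∈ A ∧ ¬ P (c v) ∨ v ∈ B ∧ P (c v) := fun v => by simp [S]
  have hdisj' : Disjoint A' B' := Finset.disjoint_left.mpr fun v h h' =>
    (hB' v).1 h' ((hA' v).1 h)
  have hScluster : ∀ i, ψ₀ * ((S.filter (c · = i)).card : ℝ) ≤
      (interEdges G (A.filter (c · = i)) (B.filter (c · = i)) : ℝ) := by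
    intro i
    refine le_trans ?_ ((hexp i).mul_min_card_le (S := A.filter (c · = i))
      (T := B.filter (c · = i)) (Finset.disjoint_filter_filter hAB) fun v => ?_)
    · gcongr
      by_cases hP : P i
      · refine le_min (le_trans (Finset.card_le_card ?_) hP) (Finset.card_le_card ?_) <;>
        · intro v hv
          simp only [Finset.mem_filter, hS] at hv ⊢
          obtain ⟨h, rfl⟩ := hv
          tauto
      · refine le_min (Finset.card_le_card ?_)
          (le_trans (Finset.card_le_card ?_) (not_le.mp hP).le) <;>
        · intro v hv
          simp only [Finset.mem_filter, hS] at hv ⊢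
          obtain ⟨h, rfl⟩ := hv
          tauto
    · have := hor v
      simp only [hmem, Finset.mem_filter]
      tauto
  have hScut : ψ₀ * (S.card : ℝ) ≤ (interEdges G A B : ℝ) := by
    rw [Finset.card_eq_sum_card_fiberwise (f := c) (t := Finset.univ)
      (fun _ _ => Finset.mem_coe.2 (Finset.mem_univ _)), Nat.cast_sum, Finset.mul_sum]
    refine (Finset.sum_le_sum fun i _ => hScluster i).trans ?_
    exact_mod_cast sum_interEdges_fiber_le G c A B
  have hShalf : (S.card : ℝ) ≤ ((min A.card B.card : ℕ) : ℝ) / 2 := by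
    refine le_of_mul_le_mul_left ?_ hψ₀0
    have := mul_le_mul_of_nonneg_right hψ (Nat.cast_nonneg (α := ℝ) (min A.card B.card))
    linarith
  have hminA : ((min A.card B.card : ℕ) : ℝ) ≤ A.card := by exact_mod_cast min_le_left _ _
  have hminB : ((min A.card B.card : ℕ) : ℝ) ≤ B.card := by exact_mod_cast min_le_right _ _
  have hAcard : (A.card : ℝ) ≤ A'.card + S.card := by
    exact_mod_cast (Finset.card_le_card fun v hv => by
      simp only [Finset.mem_union, hA', hS]
      tauto).trans (Finset.card_union_le A' S)
  have hBcard : (B.card : ℝ) ≤ B'.card + S.card := by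
    exact_mod_cast (Finset.card_le_card fun v hv => by
      simp only [Finset.mem_union, hB', hS]
      tauto).trans (Finset.card_union_le B' S)
  refine ⟨A', B', hdisj', ?_, fun i => ?_, by linarith, by linarith, ?_⟩
  · ext v
    simp only [Finset.mem_union, hA', hB', Finset.mem_univ, iff_true]
    exact em _
  · by_cases hP : P i
    · exact Or.inl fun v hv => (hA' v).2 ((hmem v i).1 hv ▸ hP)
    · exact Or.inr fun v hv => (hB' v).2 ((hmem v i).1 hv ▸ hP)
  · have hne : ∀ u ∈ A', ∀ v ∈ B', c u ≠ c v := fun u hu v hv h =>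
      (hB' v).1 hv (h ▸ (hA' u).1 hu)
    have hle : interEdges G A' B' ≤ interEdges G A B + S.card := by
      refine interEdges_le_add_card_s11 (fun v hv hvS => ?_) (fun v hv hvS => ?_) hdisj'
        (fun u hu v hv w hw huv huw => huniq u v w huv huw (hne u hu v hv) (hne u hu w hw))
        (fun u hu v hv w hw huv huw =>
          huniq u v w huv huw (hne v hv u hu).symm (hne w hw u hu).symm)
      · rw [hA'] at hv
        rw [hS] at hvS
        have := hor v
        tauto
      · rw [hB'] at hv
        rw [hS] at hvS
        have := hor v
        tauto
    have hSdiv : (S.card : ℝ) ≤ (interEdges G A B : ℝ) / ψ₀ := by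
      rw [le_div_iff₀ hψ₀0]
      linarith
    calc (interEdges G A' B' : ℝ) ≤ interEdges G A B + S.card := by exact_mod_cast hle
      _ ≤ interEdges G A B + interEdges G A B / ψ₀ := by gcongr
      _ = (1 + 1 / ψ₀) * interEdges G A B := by ring
end

section
/- Let G be a graph on n ≥ 2 vertices with maximum vertex degree Δ ≥ 1, let A₁,B₁,…,A_k,B_k be pairwise disjoint subsets of V(G) with |A_i| ≤ |B_i| for all i, let z ≥ 0 be an integer, and let ℓ be a real number with ℓ ≥ 32·Δ·log n, where log is the natural logarithm. Then at least one of the following holds: (1) for each i there is a matching M_i ⊆ A_i × B_i (a set of pairs (a,b) with a ∈ A_i, b ∈ B_i, no vertex appearing in more than one pair) with Σ_{i=1}^k |M_i| ≥ Σ_{i=1}^k |A_i| − z, together with, for every pair (a,b) ∈ ⋃_i M_i, a path P(a,b) in G from a to b, such that every edge of G lies on at most ℓ² of these paths; or (2) there is a partition (X,Y) of V(G) with |X| ≥ z/2, |Y| ≥ z/2 and |E_G(X,Y)| ≤ (72·Δ·log n/ℓ)·min(|X|,|Y|). -/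
open Finset
open scoped Classical

variable {V : Type*}

/-- The ball of radius `j` around `a`, grown in `H` by adding vertices of `U` only. -/
noncomputable def growBall (H : SimpleGraph V) (U : Finset V) (a : V) : ℕ → Finset V
  | 0 => {a}
  | j + 1 => growBall H U a j ∪ U.filter fun u => ∃ v ∈ growBall H U a j, H.Adj v u

lemma growBall_subset {H : SimpleGraph V} {U : Finset V} {a : V} (ha : a ∈ U) (j : ℕ) :
    growBall H U a j ⊆ U := by
  induction j with
  | zero => simpa [growBall] using ha
  | succ j ih => exact union_subset ih (filter_subset _ _)

lemma growBall_mono (H : SimpleGraph V) (U : Finset V) (a : V) : Monotone (growBall H U a) :=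
  monotone_nat_of_le_succ fun _ => subset_union_left

lemma mem_growBall_self (H : SimpleGraph V) (U : Finset V) (a : V) (j : ℕ) :
    a ∈ growBall H U a j :=
  growBall_mono H U a (Nat.zero_le j) (mem_singleton_self a)

lemma exists_walk_of_mem_growBall {H : SimpleGraph V} {U : Finset V} {a : V} {j : ℕ} {x : V}
    (hx : x ∈ growBall H U a j) : ∃ w : H.Walk a x, w.length ≤ j := by
  induction j generalizing x with
  | zero =>
    obtain rfl : x = a := by simpa [growBall] using hx
    exact ⟨.nil, le_rfl⟩
  | succ j ih =>
    rcases mem_union.1 hx with hx | hx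
    · obtain ⟨w, hw⟩ := ih hx
      exact ⟨w, by omega⟩
    · obtain ⟨v, hv, hvx⟩ := (mem_filter.1 hx).2
      obtain ⟨w, hw⟩ := ih hv
      exact ⟨w.concat hvx, by rw [SimpleGraph.Walk.length_concat]; omega⟩

lemma disjoint_growBall {H : SimpleGraph V} {U : Finset V} {a b : V} {R : ℕ}
    (hab : ∀ w : H.Walk a b, 2 * R < w.length) :
    Disjoint (growBall H U a R) (growBall H U b R) := by
  refine disjoint_left.2 fun x hxa hxb => ?_
  obtain ⟨w, hw⟩ := exists_walk_of_mem_growBall hxa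
  obtain ⟨w', hw'⟩ := exists_walk_of_mem_growBall hxb
  have := hab (w.append w'.reverse)
  rw [SimpleGraph.Walk.length_append, SimpleGraph.Walk.length_reverse] at this
  omega

lemma interEdges_growBall_le [Fintype V] {H : SimpleGraph V} {Δ : ℕ} (hΔ : ∀ v, deg H v ≤ Δ)
    (U : Finset V) (a : V) (j : ℕ) :
    interEdges H (growBall H U a j) (U \ growBall H U a j) ≤
      Δ * (growBall H U a (j + 1) \ growBall H U a j).card := by
  refine card_le_mul_card_image_of_maps_to (f := Prod.snd) ?_ Δ ?_
  · rintro ⟨x, y⟩ h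
    simp only [mem_filter, mem_product, mem_sdiff] at h
    exact mem_sdiff.2 ⟨mem_union_right _ (mem_filter.2 ⟨h.1.2.1, x, h.1.1, h.2⟩), h.1.2.2⟩
  · intro y _
    refine le_trans (card_le_card_of_injOn Prod.fst ?_ ?_) (hΔ y)
    · rintro ⟨u, v⟩ h
      simp only [coe_filter, mem_filter, Set.mem_ofPred_eq] at h
      obtain ⟨⟨-, h⟩, rfl⟩ := h
      simpa using h.symm
    · rintro ⟨u, v⟩ h ⟨u', v'⟩ h' huu
      simp only [coe_filter, Set.mem_ofPred_eq] at h h' huu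
      rw [Prod.mk.injEq, huu, h.2, h'.2]
      exact ⟨rfl, rfl⟩

/-- Ball growing: a ball which is too small for exponential growth has, at some radius,
a sparse boundary. -/
lemma exists_sparse_growBall [Fintype V] {H : SimpleGraph V} {Δ : ℕ}
    (hΔ : ∀ v, deg H v ≤ Δ) (hΔ1 : 1 ≤ Δ) (U : Finset V) (a : V) {R : ℕ} {φ : ℝ} (hφ : 0 ≤ φ)
    (hR : ((growBall H U a R).card : ℝ) < (1 + φ / Δ) ^ R) :
    ∃ j ≤ R, (interEdges H (growBall H U a j) (U \ growBall H U a j) : ℝ) ≤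
      φ * (growBall H U a j).card := by
  by_contra! hcon
  have hΔ0 : (0 : ℝ) < Δ := by exact_mod_cast hΔ1
  have key : ∀ j ≤ R, (1 + φ / Δ) ^ j ≤ ((growBall H U a j).card : ℝ) := by
    intro j
    induction j with
    | zero => intro _; simp [growBall]
    | succ j ih =>
      intro hj
      have h1 := ih (by omega)
      have h2 := hcon j (by omega)
      have h3 : (interEdges H (growBall H U a j) (U \ growBall H U a j) : ℝ) ≤
          Δ * ((growBall H U a (j + 1) \ growBall H U a j).card : ℝ) := by
        exact_mod_cast interEdges_growBall_le hΔ U a j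
      have h4 : ((growBall H U a (j + 1) \ growBall H U a j).card : ℝ) +
          (growBall H U a j).card = (growBall H U a (j + 1)).card := by
        exact_mod_cast card_sdiff_add_card_eq_card (growBall_mono H U a (Nat.le_succ j))
      have h5 : φ / Δ * (growBall H U a j).card ≤
          ((growBall H U a (j + 1) \ growBall H U a j).card : ℝ) := by
        rw [div_mul_eq_mul_div, div_le_iff₀ hΔ0]
        linarith
      calc (1 + φ / Δ) ^ (j + 1) = (1 + φ / Δ) ^ j * (1 + φ / Δ) := pow_succ _ _
        _ ≤ (growBall H U a j).card * (1 + φ / Δ) := by gcongr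
        _ ≤ _ := by linarith
  exact absurd (key R le_rfl) (not_le.2 hR)

lemma exists_sparse_subset [Fintype V] {H : SimpleGraph V} {Δ : ℕ}
    (hΔ : ∀ v, deg H v ≤ Δ) (hΔ1 : 1 ≤ Δ) {U : Finset V} {a b : V} (ha : a ∈ U) (hb : b ∈ U)
    {R : ℕ} {φ : ℝ} (hφ : 0 ≤ φ) (hR : (Fintype.card V : ℝ) < (1 + φ / Δ) ^ R)
    (hab : ∀ w : H.Walk a b, 2 * R < w.length) :
    ∃ S ⊆ U, S.Nonempty ∧ 2 * S.card ≤ U.card ∧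
      (interEdges H S (U \ S) : ℝ) ≤ φ * S.card := by
  have key : ∀ c ∈ U, 2 * (growBall H U c R).card ≤ U.card →
      ∃ S ⊆ U, S.Nonempty ∧ 2 * S.card ≤ U.card ∧
        (interEdges H S (U \ S) : ℝ) ≤ φ * S.card := by
    intro c hc hcard
    obtain ⟨j, hj, h⟩ := exists_sparse_growBall hΔ hΔ1 U c hφ
      (lt_of_le_of_lt (by exact_mod_cast card_le_univ _) hR)
    exact ⟨_, growBall_subset hc j, ⟨c, mem_growBall_self H U c j⟩,
      (Nat.mul_le_mul_left 2 (card_le_card (growBall_mono H U c hj))).trans hcard, h⟩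
  have hsum : (growBall H U a R).card + (growBall H U b R).card ≤ U.card := by
    rw [← card_union_of_disjoint (disjoint_growBall hab)]
    exact card_le_card (union_subset (growBall_subset ha R) (growBall_subset hb R))
  rcases le_total (growBall H U a R).card (growBall H U b R).card with h | h
  · exact key a ha (by omega)
  · exact key b hb (by omega)

lemma interEdges_union_compl_le [Fintype V] (H : SimpleGraph V) (X S : Finset V) :
    interEdges H (X ∪ S) (X ∪ S)ᶜ ≤ interEdges H X Xᶜ + interEdges H S (Xᶜ \ S) := by
  unfold interEdges
  refine (card_le_card ?_).trans (card_union_le _ _)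
  rintro ⟨x, y⟩
  simp only [mem_filter, mem_product, mem_union, mem_compl, mem_sdiff]
  tauto

/-- If removing fewer than `r / 2` vertices never destroys all pairs of far apart vertices,
then there is a sparse cut with both sides of size at least `r / 2`. -/
lemma exists_balanced_cut [Fintype V] {H : SimpleGraph V} {Δ : ℕ}
    (hΔ : ∀ v, deg H v ≤ Δ) (hΔ1 : 1 ≤ Δ) {R r : ℕ} (hr : 0 < r)
    (hrn : 2 * r ≤ Fintype.card V) {φ : ℝ} (hφ : 0 ≤ φ)
    (hR : (Fintype.card V : ℝ) < (1 + φ / Δ) ^ R)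
    (hfar : ∀ X : Finset V, X.card < r →
      ∃ a ∉ X, ∃ b ∉ X, ∀ w : H.Walk a b, 2 * R < w.length) :
    ∃ X : Finset V, r ≤ 2 * X.card ∧ r ≤ 2 * Xᶜ.card ∧ 3 * X.card ≤ 5 * Xᶜ.card ∧
      (interEdges H X Xᶜ : ℝ) ≤ φ * X.card := by
  let F : Finset (Finset V) := univ.filter fun X =>
    2 * X.card < r ∧ (interEdges H X Xᶜ : ℝ) ≤ φ * X.card
  have hF : F.Nonempty := ⟨∅, mem_filter.2 ⟨mem_univ _, by simp [interEdges, hr]⟩⟩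
  obtain ⟨X, hXF, hmax⟩ := exists_max_image F card hF
  obtain ⟨hXr, hX⟩ := (mem_filter.1 hXF).2
  obtain ⟨a, ha, b, hb, hab⟩ := hfar X (by omega)
  obtain ⟨S, hSU, hSne, hScard, hS⟩ := exists_sparse_subset hΔ hΔ1
    (mem_compl.2 ha) (mem_compl.2 hb) hφ hR hab
  have hdisj : Disjoint X S := disjoint_left.2 fun x hx hxS => mem_compl.1 (hSU hxS) hx
  have hcard : (X ∪ S).card = X.card + S.card := card_union_of_disjoint hdisj
  have hcut : (interEdges H (X ∪ S) (X ∪ S)ᶜ : ℝ) ≤ φ * (X ∪ S).card := by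
    have : (interEdges H (X ∪ S) (X ∪ S)ᶜ : ℝ) ≤
        interEdges H X Xᶜ + interEdges H S (Xᶜ \ S) := by
      exact_mod_cast interEdges_union_compl_le H X S
    rw [hcard]
    push_cast
    linarith
  have hSpos := hSne.card_pos
  have hlarge : r ≤ 2 * (X ∪ S).card := by
    by_contra! hlt
    have := hmax (X ∪ S) (mem_filter.2 ⟨mem_univ _, hlt, hcut⟩)
    omega
  have hXc := card_add_card_compl X
  have hXSc := card_add_card_compl (X ∪ S)
  exact ⟨X ∪ S, hlarge, by omega, by omega, hcut⟩

/-- A path of `G` with a label in `ι`. -/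
structure Route (G : SimpleGraph V) (ι : Type*) where
  /-- The label. -/
  idx : ι
  /-- The first vertex of the path. -/
  src : V
  /-- The last vertex of the path. -/
  tgt : V
  /-- The path. -/
  walk : G.Walk src tgt
  isPath : walk.IsPath

/-- The routes of `S` match vertices of `A i` to vertices of `B i`, where `i` is their label. -/
def IsRouting {G : SimpleGraph V} {ι : Type*} (A B : ι → Finset V)
    (S : Finset (Route G ι)) : Prop :=
  (∀ t ∈ S, t.src ∈ A t.idx ∧ t.tgt ∈ B t.idx) ∧
    ∀ t ∈ S, ∀ t' ∈ S, t ≠ t' → t.src ≠ t'.src ∧ t.tgt ≠ t'.tgt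

/-- The number of routes of `S` through the edge `e`. -/
noncomputable def congestion {G : SimpleGraph V} {ι : Type*} (S : Finset (Route G ι))
    (e : Sym2 V) : ℕ :=
  (S.filter fun t => e ∈ t.walk.edges).card

lemma IsRouting.card_le [Fintype V] {G : SimpleGraph V} {ι : Type*} {A B : ι → Finset V}
    {S : Finset (Route G ι)} (hS : IsRouting A B S) : S.card ≤ Fintype.card V := by
  rw [← card_univ]
  refine card_le_card_of_injOn Route.src (fun _ _ => mem_univ _) fun t ht t' ht' h => ?_
  by_contra hne
  exact (hS.2 t ht t' ht' hne).1 h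

section Pairs

variable {G : SimpleGraph V} {ι : Type*} {A B : ι → Finset V}

lemma pairwise_disjoint_union
    (hdisj : ∀ x y : ι ⊕ ι, x ≠ y → Disjoint (Sum.elim A B x) (Sum.elim A B y))
    {i j : ι} (hij : i ≠ j) : Disjoint (A i ∪ B i) (A j ∪ B j) := by
  simp only [disjoint_union_left, disjoint_union_right]
  exact ⟨⟨hdisj (.inl i) (.inl j) (by simpa), hdisj (.inr i) (.inl j) (by simp)⟩,
    hdisj (.inl i) (.inr j) (by simp), hdisj (.inr i) (.inr j) (by simpa)⟩

lemma two_mul_sum_card_le [Fintype V] [Fintype ι]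
    (hdisj : ∀ x y : ι ⊕ ι, x ≠ y → Disjoint (Sum.elim A B x) (Sum.elim A B y))
    (hsize : ∀ i, (A i).card ≤ (B i).card) :
    2 * ∑ i, (A i).card ≤ Fintype.card V := by
  have h : ∑ x, (Sum.elim A B x).card ≤ Fintype.card V := by
    rw [← card_biUnion fun x _ y _ => hdisj x y]
    exact card_le_univ _
  have hle : ∑ i, (A i).card ≤ ∑ i, (B i).card := sum_le_sum fun i _ => hsize i
  rw [Fintype.sum_sum_type] at h
  simp only [Sum.elim_inl, Sum.elim_inr] at h
  omega

/-- Fewer vertices than there are unrouted ones cannot block all unrouted pairs. -/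
lemma IsRouting.exists_free_pair [Fintype ι]
    (hdisj : ∀ x y : ι ⊕ ι, x ≠ y → Disjoint (Sum.elim A B x) (Sum.elim A B y))
    (hsize : ∀ i, (A i).card ≤ (B i).card) {S : Finset (Route G ι)} (hS : IsRouting A B S)
    {X : Finset V} (hX : X.card + S.card < ∑ i, (A i).card) :
    ∃ i, ∃ a ∈ A i, ∃ b ∈ B i, a ∉ X ∧ b ∉ X ∧ (∀ t ∈ S, t.src ≠ a) ∧ ∀ t ∈ S, t.tgt ≠ b := by
  by_contra! hcon
  have key : ∀ i, (A i).card ≤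
      (X ∩ (A i ∪ B i)).card + (S.filter fun t => t.idx = i).card := by
    intro i
    by_cases hA : ∀ a ∈ A i, a ∉ X → ∃ t ∈ S, t.src = a
    · have hsub : A i ⊆ (X ∩ (A i ∪ B i)) ∪ (S.filter fun t => t.idx = i).image Route.src := by
        intro a ha
        by_cases haX : a ∈ X
        · simp [haX, ha]
        · obtain ⟨t, ht, rfl⟩ := hA a ha haX
          have : t.idx = i := by
            by_contra hne
            exact disjoint_left.1 (hdisj (.inl t.idx) (.inl i) (by simpa)) (hS.1 t ht).1 ha
          exact mem_union_right _ (mem_image_of_mem _ (mem_filter.2 ⟨ht, this⟩))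
      exact (card_le_card hsub).trans ((card_union_le _ _).trans (by gcongr; exact card_image_le))
    · push Not at hA
      obtain ⟨a, ha, haX, hfree⟩ := hA
      have hsub : B i ⊆ (X ∩ (A i ∪ B i)) ∪ (S.filter fun t => t.idx = i).image Route.tgt := by
        intro b hb
        by_cases hbX : b ∈ X
        · simp [hbX, hb]
        · obtain ⟨t, ht, rfl⟩ := hcon i a ha b hb haX hbX hfree
          have : t.idx = i := by
            by_contra hne
            exact disjoint_left.1 (hdisj (.inr t.idx) (.inr i) (by simpa)) (hS.1 t ht).2 hb
          exact mem_union_right _ (mem_image_of_mem _ (mem_filter.2 ⟨ht, this⟩))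
      exact (hsize i).trans <|
        (card_le_card hsub).trans ((card_union_le _ _).trans (by gcongr; exact card_image_le))
  have h1 : ∑ i, (X ∩ (A i ∪ B i)).card ≤ X.card := by
    rw [← card_biUnion fun i _ j _ hij =>
      (pairwise_disjoint_union hdisj hij).mono inter_subset_right inter_subset_right]
    exact card_le_card (biUnion_subset.2 fun i _ => inter_subset_left)
  have h2 : ∑ i, (S.filter fun t => t.idx = i).card = S.card :=
    (card_eq_sum_card_fiberwise (t := univ) fun _ _ => mem_coe.2 (mem_univ _)).symm
  have h3 := sum_le_sum fun i (_ : i ∈ univ) => key i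
  rw [sum_add_distrib] at h3
  omega

lemma IsRouting.insert {S : Finset (Route G ι)} (hS : IsRouting A B S) {t : Route G ι}
    (hsrc : t.src ∈ A t.idx) (htgt : t.tgt ∈ B t.idx) (hfs : ∀ t' ∈ S, t'.src ≠ t.src)
    (hft : ∀ t' ∈ S, t'.tgt ≠ t.tgt) : IsRouting A B (insert t S) := by
  refine ⟨fun u hu => ?_, fun u hu u' hu' hne => ?_⟩
  · rcases mem_insert.1 hu with rfl | hu
    exacts [⟨hsrc, htgt⟩, hS.1 u hu]
  · rcases mem_insert.1 hu with rfl | huS <;> rcases mem_insert.1 hu' with rfl | huS'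
    · exact absurd rfl hne
    · exact ⟨(hfs u' huS').symm, (hft u' huS').symm⟩
    · exact ⟨hfs u huS, hft u huS⟩
    · exact hS.2 u huS u' huS' hne

/-- The edges used by the routes of `D`. -/
noncomputable def usedEdges (D : Finset (Route G ι)) : Finset (Sym2 V) :=
  D.biUnion fun t => t.walk.edges.toFinset

lemma card_usedEdges_le {D : Finset (Route G ι)} {L : ℕ} (hD : ∀ t ∈ D, t.walk.length ≤ L) :
    (usedEdges D).card ≤ D.card * L :=
  card_biUnion_le_card_mul _ _ _ fun t ht =>
    (List.toFinset_card_le _).trans (t.walk.length_edges.trans_le (hD t ht))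

lemma congestion_union_le (S D : Finset (Route G ι)) (e : Sym2 V) :
    congestion (S ∪ D) e ≤ congestion S e + congestion D e := by
  unfold congestion
  rw [filter_union]
  exact card_union_le _ _

/-- `D` extends the routing `S` by edge-disjoint routes of length at most `L`. -/
def IsExtension (A B : ι → Finset V) (L : ℕ) (S D : Finset (Route G ι)) : Prop :=
  Disjoint S D ∧ IsRouting A B (S ∪ D) ∧ (∀ t ∈ D, t.walk.length ≤ L) ∧
    ∀ e, congestion D e ≤ 1

lemma IsExtension.exists_larger {L : ℕ} {S D : Finset (Route G ι)}
    (hD : IsExtension A B L S D) {i : ι} {a b : V} (ha : a ∈ A i) (hb : b ∈ B i)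
    (hfa : ∀ t ∈ S ∪ D, t.src ≠ a) (hfb : ∀ t ∈ S ∪ D, t.tgt ≠ b)
    (w : (G.deleteEdges (usedEdges D : Set (Sym2 V))).Walk a b) (hw : w.length ≤ L) :
    ∃ D', IsExtension A B L S D' ∧ D.card < D'.card := by
  have hle : G.deleteEdges (usedEdges D : Set (Sym2 V)) ≤ G := G.deleteEdges_le _
  let t : Route G ι := ⟨i, a, b, w.bypass.mapLe hle,
    w.bypass_isPath.mapLe hle⟩
  have htedges : t.walk.edges = w.bypass.edges := by simp [t]
  have htU : ∀ e ∈ t.walk.edges, e ∉ usedEdges D := by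
    intro e he
    rw [htedges] at he
    have := w.bypass.edges_subset_edgeSet he
    rw [SimpleGraph.edgeSet_deleteEdges] at this
    exact fun h => this.2 (mem_coe.2 h)
  have htmem : t ∉ S ∪ D := fun h => hfa t h rfl
  have htS : t ∉ S := fun h => htmem (mem_union_left _ h)
  have htD : t ∉ D := fun h => htmem (mem_union_right _ h)
  refine ⟨insert t D, ⟨?_, ?_, ?_, ?_⟩, by rw [card_insert_of_notMem htD]; omega⟩
  · exact disjoint_insert_right.2 ⟨htS, hD.1⟩
  · rw [union_insert]
    exact hD.2.1.insert ha hb hfa hfb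
  · intro u hu
    rcases mem_insert.1 hu with rfl | hu
    · have : t.walk.length = w.bypass.length := by simp [t]
      rw [this]
      exact w.length_bypass_le_length.trans hw
    · exact hD.2.2.1 u hu
  · intro e
    unfold congestion
    rw [filter_insert]
    split_ifs with he
    · have : (D.filter fun t => e ∈ t.walk.edges) = ∅ := by
        refine filter_eq_empty_iff.2 fun u hu hue => htU e he ?_
        exact mem_biUnion.2 ⟨u, hu, List.mem_toFinset.2 hue⟩
      simp [this]
    · exact hD.2.2.2 e

lemma exists_maximal_extension [Fintype V] {S : Finset (Route G ι)} (hS : IsRouting A B S)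
    (L : ℕ) : ∃ D, IsExtension A B L S D ∧
      ∀ D', IsExtension A B L S D' → D'.card ≤ D.card := by
  let N : Set ℕ := {m | ∃ D, IsExtension A B L S D ∧ D.card = m}
  have hne : N.Nonempty := ⟨0, ∅, ⟨disjoint_empty_right _, by simpa using hS, by simp,
    by simp [congestion]⟩, card_empty⟩
  have hbdd : BddAbove N := by
    refine ⟨Fintype.card V, ?_⟩
    rintro _ ⟨D, hD, rfl⟩
    exact (card_le_card subset_union_right).trans hD.2.1.card_le
  obtain ⟨D, hD, hcard⟩ := Nat.sSup_mem hne hbdd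
  exact ⟨D, hD, fun D' hD' => hcard ▸ le_csSup hbdd ⟨D', hD', rfl⟩⟩

end Pairs

lemma interEdges_le_deleteEdges_add (G : SimpleGraph V) (E : Finset (Sym2 V))
    {X Y : Finset V} (hXY : Disjoint X Y) :
    interEdges G X Y ≤ interEdges (G.deleteEdges (E : Set (Sym2 V))) X Y + E.card := by
  unfold interEdges
  rw [← card_filter_add_card_filter_not (p := fun p : V × V => s(p.1, p.2) ∉ E)
    (s := (X ×ˢ Y).filter fun p => G.Adj p.1 p.2)]
  refine add_le_add (card_le_card ?_) (card_le_card_of_injOn (fun p => s(p.1, p.2)) ?_ ?_)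
  · rintro ⟨x, y⟩
    simp only [mem_filter, SimpleGraph.deleteEdges_adj, mem_coe]
    tauto
  · rintro ⟨x, y⟩
    simp
  · rintro ⟨x, y⟩ h ⟨x', y'⟩ h' heq
    simp only [coe_filter, Set.mem_ofPred_eq, mem_filter, mem_product] at h h' heq
    rcases Sym2.eq_iff.1 heq with ⟨rfl, rfl⟩ | ⟨rfl, rfl⟩
    · rfl
    · exact absurd h'.1.1.2 (disjoint_left.1 hXY h.1.1.1)

lemma deg_le_of_le_of_maxDeg_eq [Fintype V] {G H : SimpleGraph V} (hH : H ≤ G) {Δ : ℕ}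
    (hΔ : maxDeg G = Δ) (v : V) : deg H v ≤ Δ := by
  rw [← hΔ]
  refine le_trans (card_le_card fun u => ?_) (le_sup (f := deg G) (mem_univ v))
  simpa using fun h => hH h

lemma lt_one_add_pow_of_log_lt {N x : ℝ} {R : ℕ} (hN : 0 < N) (hx : 0 ≤ x) (hx1 : x ≤ 1)
    (h : Real.log N < R * (x / 2)) : N < (1 + x) ^ R := by
  have hlog : x / 2 ≤ Real.log (1 + x) := by
    refine le_trans ?_ (Real.one_sub_inv_le_log_of_pos (by linarith))
    rw [← sub_nonneg]
    have : 1 - (1 + x)⁻¹ - x / 2 = x * (1 - x) / (2 * (1 + x)) := by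
      field_simp
      ring
    rw [this]
    exact div_nonneg (mul_nonneg hx (by linarith)) (by linarith)
  rw [← Real.log_lt_log_iff hN (by positivity), Real.log_pow]
  exact h.trans_le (by gcongr)

/-- One phase of edge-disjoint short routes: if only few new pairs can be routed, then there is
a sparse cut. -/
lemma IsRouting.exists_phase [Fintype V] {G : SimpleGraph V} {ι : Type*} [Fintype ι]
    {A B : ι → Finset V} {Δ : ℕ} (hΔ : maxDeg G = Δ) (hΔ1 : 1 ≤ Δ)
    (hdisj : ∀ x y : ι ⊕ ι, x ≠ y → Disjoint (Sum.elim A B x) (Sum.elim A B y))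
    (hsize : ∀ i, (A i).card ≤ (B i).card) {R : ℕ} {φ : ℝ} (hφ : 0 ≤ φ)
    (hR : (Fintype.card V : ℝ) < (1 + φ / Δ) ^ R) {S : Finset (Route G ι)}
    (hS : IsRouting A B S) {c : ℕ} (hc : ∀ e, congestion S e ≤ c) :
    ∃ S' : Finset (Route G ι), IsRouting A B S' ∧ (∀ e, congestion S' e ≤ c + 1) ∧
      ∀ r, 0 < r → r + S'.card = ∑ i, (A i).card →
        ∃ X : Finset V, r ≤ 2 * X.card ∧ r ≤ 2 * Xᶜ.card ∧ 3 * X.card ≤ 5 * Xᶜ.card ∧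
          (interEdges G X Xᶜ : ℝ) ≤ φ * X.card + ((S'.card : ℝ) - S.card) * (2 * R : ℕ) := by
  obtain ⟨D, hD, hmax⟩ := exists_maximal_extension hS (2 * R)
  refine ⟨S ∪ D, hD.2.1, fun e =>
    (congestion_union_le S D e).trans (add_le_add (hc e) (hD.2.2.2 e)), fun r hr hrS => ?_⟩
  have hrn : 2 * r ≤ Fintype.card V := by
    have := two_mul_sum_card_le hdisj hsize
    omega
  obtain ⟨X, h1, h2, h3, h4⟩ := exists_balanced_cut
    (H := G.deleteEdges (usedEdges D : Set (Sym2 V)))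
    (deg_le_of_le_of_maxDeg_eq (G.deleteEdges_le _) hΔ) hΔ1 hr hrn hφ hR fun X hX => by
      obtain ⟨i, a, ha, b, hb, haX, hbX, hfa, hfb⟩ :=
        hD.2.1.exists_free_pair (X := X) hdisj hsize (by omega)
      refine ⟨a, haX, b, hbX, fun w => ?_⟩
      by_contra! hw
      obtain ⟨D', hD', hlt⟩ := hD.exists_larger ha hb hfa hfb w hw
      exact absurd (hmax D' hD') (by omega)
  refine ⟨X, h1, h2, h3, ?_⟩
  have h5 : (interEdges G X Xᶜ : ℝ) ≤
      interEdges (G.deleteEdges (usedEdges D : Set (Sym2 V))) X Xᶜ + (usedEdges D).card := by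
    exact_mod_cast interEdges_le_deleteEdges_add G (usedEdges D) disjoint_compl_right
  have h6 : ((usedEdges D).card : ℝ) ≤ D.card * (2 * R : ℕ) := by
    exact_mod_cast card_usedEdges_le hD.2.2.1
  have h7 : ((S ∪ D).card : ℝ) - S.card = D.card := by
    rw [card_union_of_disjoint hD.1]
    push_cast
    ring
  rw [h7]
  linarith

/-- A routing unpacked into matchings with a path for each matched pair. -/
lemma IsRouting.exists_matchings {G : SimpleGraph V} {ι : Type*} [Fintype ι]
    {A B : ι → Finset V} {S : Finset (Route G ι)} (hS : IsRouting A B S) :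
    ∃ (M : ι → Finset (V × V)) (P : (i : ι) → (p : V × V) → p ∈ M i → G.Walk p.1 p.2),
      (∀ i, ∀ p ∈ M i, p.1 ∈ A i ∧ p.2 ∈ B i) ∧
      (∀ i, ∀ p ∈ M i, ∀ q ∈ M i, p ≠ q → p.1 ≠ q.1 ∧ p.2 ≠ q.2) ∧
      ∑ i, (M i).card = S.card ∧
      (∀ i p hp, (P i p hp).IsPath) ∧
      ∀ e, ∑ i, ((M i).attach.filter fun p => e ∈ (P i p.1 p.2).edges).card ≤
        congestion S e := by
  let M : ι → Finset (V × V) := fun i =>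
    (S.filter fun t => t.idx = i).image fun t => (t.src, t.tgt)
  have hM : ∀ i p, p ∈ M i → ∃ w : G.Walk p.1 p.2, w.IsPath ∧ ∃ t ∈ S, t.idx = i ∧
      t.src = p.1 ∧ t.tgt = p.2 ∧ t.walk.edges = w.edges := by
    intro i p hp
    obtain ⟨t, ht, rfl⟩ := mem_image.1 hp
    exact ⟨t.walk, t.isPath, t, (mem_filter.1 ht).1, (mem_filter.1 ht).2, rfl, rfl, rfl⟩
  choose P hP T hTS hTi hTs hTt hTe using hM
  have hsum : ∀ S' : Finset (Route G ι),
      ∑ i, (S'.filter fun t => t.idx = i).card = S'.card := fun S' =>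
    (card_eq_sum_card_fiberwise (t := univ) fun _ _ => mem_coe.2 (mem_univ _)).symm
  refine ⟨M, P, fun i p hp => ?_, fun i p hp q hq hne => ?_, ?_, hP, fun e => ?_⟩
  · rw [← hTs i p hp, ← hTt i p hp]
    simpa only [hTi i p hp] using hS.1 _ (hTS i p hp)
  · rw [← hTs i p hp, ← hTt i p hp, ← hTs i q hq, ← hTt i q hq]
    refine hS.2 _ (hTS i p hp) _ (hTS i q hq) fun h => hne (Prod.ext ?_ ?_)
    · rw [← hTs i p hp, ← hTs i q hq, h]
    · rw [← hTt i p hp, ← hTt i q hq, h]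
  · rw [← hsum S]
    refine sum_congr rfl fun i _ => card_image_of_injOn fun t ht t' ht' h => ?_
    by_contra hne
    exact (hS.2 t (mem_filter.1 ht).1 t' (mem_filter.1 ht').1 hne).1 (Prod.ext_iff.1 h).1
  · unfold congestion
    rw [← hsum]
    refine sum_le_sum fun i _ =>
      card_le_card_of_injOn (fun p => T i p.1 p.2) (fun p hp => ?_) fun p _ q _ h => ?_
    · have he := (mem_filter.1 hp).2
      rw [← hTe] at he
      exact mem_coe.2 (mem_filter.2 ⟨mem_filter.2 ⟨hTS _ _ _, he⟩, hTi _ _ _⟩)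
    · replace h : T i p.1 p.2 = T i q.1 q.2 := h
      refine Subtype.ext (Prod.ext ?_ ?_)
      · rw [← hTs i p.1 p.2, ← hTs i q.1 q.2, h]
      · rw [← hTt i p.1 p.2, ← hTt i q.1 q.2, h]

/-- If `ℓ` is large and there is no balanced sparse cut, then `c` phases leave at most `z` pairs
unrouted, or reduce their number geometrically. -/
lemma exists_routing_of_no_cut [Fintype V] {G : SimpleGraph V} {ι : Type*} [Fintype ι]
    {A B : ι → Finset V} {Δ z : ℕ} {ℓ q : ℝ} (hΔ : maxDeg G = Δ) (hΔ1 : 1 ≤ Δ)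
    (hdisj : ∀ x y : ι ⊕ ι, x ≠ y → Disjoint (Sum.elim A B x) (Sum.elim A B y))
    (hsize : ∀ i, (A i).card ≤ (B i).card) (hℓ : 0 < ℓ) (hq : 0 ≤ q)
    (hR : (Fintype.card V : ℝ) < (1 + 12 * q / ℓ / Δ) ^ ⌊ℓ / 2⌋₊)
    (hcut : ∀ X Y : Finset V, IsCompl X Y → (z : ℝ) / 2 ≤ X.card → (z : ℝ) / 2 ≤ Y.card →
      72 * q / ℓ * (min X.card Y.card : ℕ) < (interEdges G X Y : ℝ)) (c : ℕ) :
    ∃ S : Finset (Route G ι), IsRouting A B S ∧ (∀ e, congestion S e ≤ c) ∧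
      ((∑ i, (A i).card : ℕ) - (S.card : ℝ) ≤ z ∨
        ((∑ i, (A i).card : ℕ) - (S.card : ℝ)) * (1 + 26 * q / ℓ ^ 2) ^ c ≤
          Fintype.card V) := by
  induction c with
  | zero =>
    refine ⟨∅, by simp [IsRouting], by simp [congestion], Or.inr ?_⟩
    have := two_mul_sum_card_le hdisj hsize
    simp only [card_empty, Nat.cast_zero, sub_zero, pow_zero, mul_one, Nat.cast_le]
    omega
  | succ c ih =>
    obtain ⟨S, hS, hc, hz | hpow⟩ := ih
    · exact ⟨S, hS, fun e => (hc e).trans c.le_succ, Or.inl hz⟩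
    obtain ⟨S', hS', hc', hX⟩ := hS.exists_phase hΔ hΔ1 hdisj hsize (by positivity) hR hc
    refine ⟨S', hS', hc', ?_⟩
    by_cases hz : (∑ i, (A i).card : ℕ) - (S'.card : ℝ) ≤ z
    · exact Or.inl hz
    right
    push Not at hz
    have hlt : z + S'.card < ∑ i, (A i).card := by
      have : (z + S'.card : ℝ) < (∑ i, (A i).card : ℕ) := by linarith
      exact_mod_cast this
    obtain ⟨r, hr⟩ := Nat.exists_eq_add_of_lt hlt
    obtain ⟨X, h1, h2, h3, h4⟩ := hX (z + r + 1) (by omega) (by omega)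
    have hrest : (((z + r + 1 : ℕ) : ℝ)) = (∑ i, (A i).card : ℕ) - (S'.card : ℝ) := by
      rw [hr]
      push_cast
      ring
    have h1' : ((z + r + 1 : ℕ) : ℝ) ≤ 2 * X.card := by exact_mod_cast h1
    have h2' : ((z + r + 1 : ℕ) : ℝ) ≤ 2 * Xᶜ.card := by exact_mod_cast h2
    have h5 := hcut X Xᶜ isCompl_compl (by rw [hrest] at h1'; linarith)
      (by rw [hrest] at h2'; linarith)
    set m : ℕ := min X.card Xᶜ.card with hm
    have h6 : ((z + r + 1 : ℕ) : ℝ) ≤ 2 * m := by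
      exact_mod_cast (by omega : z + r + 1 ≤ 2 * m)
    have h7 : (X.card : ℝ) ≤ 5 / 3 * m := by
      have : (3 * X.card : ℝ) ≤ 5 * m := by exact_mod_cast (by omega : 3 * X.card ≤ 5 * m)
      linarith
    have h8 : 12 * q / ℓ * X.card ≤ 12 * q / ℓ * (5 / 3 * m) := by gcongr
    have hstep : 52 * q / ℓ * m < ((S'.card : ℝ) - S.card) * (2 * ⌊ℓ / 2⌋₊ : ℕ) := by
      have : 52 * q / ℓ * m = 72 * q / ℓ * m - 12 * q / ℓ * (5 / 3 * m) := by ring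
      linarith
    have hd : 0 < (S'.card : ℝ) - S.card :=
      pos_of_mul_pos_left (lt_of_le_of_lt (by positivity) hstep) (by positivity)
    have hfloor : ((2 * ⌊ℓ / 2⌋₊ : ℕ) : ℝ) ≤ ℓ := by
      push_cast
      linarith [Nat.floor_le (show 0 ≤ ℓ / 2 by positivity)]
    have h9 : 26 * q / ℓ ^ 2 * ((z + r + 1 : ℕ) : ℝ) ≤ (S'.card : ℝ) - S.card := by
      calc 26 * q / ℓ ^ 2 * ((z + r + 1 : ℕ) : ℝ) ≤ 26 * q / ℓ ^ 2 * (2 * m) := by gcongr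
        _ = 52 * q / ℓ * m / ℓ := by field_simp; ring
        _ ≤ (S'.card : ℝ) - S.card := by
          rw [div_le_iff₀ hℓ]
          exact hstep.le.trans (by gcongr)
    rw [hrest] at h9
    refine le_trans ?_ hpow
    rw [pow_succ', ← mul_assoc]
    gcongr
    linarith

/-- the matching player — route or cut.  Either there is a partial
routing (matchings `M i ⊆ A i × B i` of total value at least `Σ|A i| − z`,
together with connecting paths of congestion at most `ℓ²`), or there is a
balanced sparse cut. -/
theorem route_or_cut
    [Fintype V] [DecidableEq V]
    (G : SimpleGraph V) (k : ℕ) (A B : Fin k → Finset V) (Δ z : ℕ) (ℓ : ℝ)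
    (hn : 2 ≤ Fintype.card V) (hΔ : maxDeg G = Δ) (hΔ1 : 1 ≤ Δ)
    (hdisj : ∀ x y : Fin k ⊕ Fin k, x ≠ y →
      Disjoint (Sum.elim A B x) (Sum.elim A B y))
    (hsize : ∀ i, (A i).card ≤ (B i).card)
    (hℓ : 32 * (Δ : ℝ) * Real.log (Fintype.card V) ≤ ℓ) :
    (∃ (M : Fin k → Finset (V × V))
        (P : (i : Fin k) → (p : V × V) → p ∈ M i → G.Walk p.1 p.2),
        (∀ i, ∀ p ∈ M i, p.1 ∈ A i ∧ p.2 ∈ B i) ∧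
        (∀ i, ∀ p ∈ M i, ∀ q ∈ M i, p ≠ q → p.1 ≠ q.1 ∧ p.2 ≠ q.2) ∧
        (∑ i, ((A i).card : ℝ)) - (z : ℝ) ≤ ∑ i, ((M i).card : ℝ) ∧
        (∀ i p hp, (P i p hp).IsPath) ∧
        (∀ a b, G.Adj a b →
          ((∑ i, ((M i).attach.filter fun p =>
              s(a, b) ∈ (P i p.1 p.2).edges).card : ℕ) : ℝ) ≤ ℓ ^ 2)) ∨
      (∃ X Y : Finset V, Disjoint X Y ∧ X ∪ Y = Finset.univ ∧
        (z : ℝ) / 2 ≤ (X.card : ℝ) ∧ (z : ℝ) / 2 ≤ (Y.card : ℝ) ∧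
        (interEdges G X Y : ℝ) ≤
          (72 * (Δ : ℝ) * Real.log (Fintype.card V) / ℓ) *
            ((min X.card Y.card : ℕ) : ℝ)) := by
  set N : ℝ := (Fintype.card V : ℝ) with hN
  have hN2 : (2 : ℝ) ≤ N := by rw [hN]; exact_mod_cast hn
  have hlog : 0.69 < Real.log N :=
    lt_of_lt_of_le (by linarith [Real.log_two_gt_d9]) (Real.log_le_log (by norm_num) hN2)
  have hΔ1' : (1 : ℝ) ≤ Δ := by exact_mod_cast hΔ1
  set q : ℝ := Δ * Real.log N with hq
  have hqlog : Real.log N ≤ q := le_mul_of_one_le_left (by linarith) hΔ1'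
  have hℓq : 32 * q ≤ ℓ := by rw [hq, ← mul_assoc]; exact hℓ
  have hℓ22 : 22 < ℓ := by linarith
  have hℓ0 : 0 < ℓ := by linarith
  refine or_iff_not_imp_right.2 fun hno => ?_
  have hcut : ∀ X Y : Finset V, IsCompl X Y → (z : ℝ) / 2 ≤ X.card → (z : ℝ) / 2 ≤ Y.card →
      72 * q / ℓ * (min X.card Y.card : ℕ) < (interEdges G X Y : ℝ) := by
    intro X Y hXY h1 h2
    by_contra! h
    refine hno ⟨X, Y, hXY.disjoint, hXY.sup_eq_top, h1, h2, ?_⟩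
    rwa [mul_assoc 72]
  have hx : 12 * q / ℓ / Δ = 12 * Real.log N / ℓ := by
    rw [hq]
    field_simp
  have hR : N < (1 + 12 * q / ℓ / Δ) ^ ⌊ℓ / 2⌋₊ := by
    rw [hx]
    refine lt_one_add_pow_of_log_lt (by linarith) (by positivity) ?_ ?_
    · rw [div_le_one hℓ0]
      linarith
    · have h1 := Nat.lt_floor_add_one (ℓ / 2)
      have h2 : ℓ / 6 < ⌊ℓ / 2⌋₊ := by linarith
      calc Real.log N = ℓ / 6 * (12 * Real.log N / ℓ / 2) := by field_simp; norm_num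
        _ < _ := by gcongr
  obtain ⟨S, hS, hcong, hrest⟩ := exists_routing_of_no_cut hΔ hΔ1 hdisj hsize hℓ0
    (by positivity) hR hcut ⌊ℓ ^ 2⌋₊
  have hpow : N < (1 + 26 * q / ℓ ^ 2) ^ ⌊ℓ ^ 2⌋₊ := by
    refine lt_one_add_pow_of_log_lt (by linarith) (by positivity) ?_ ?_
    · rw [div_le_one (by positivity)]
      nlinarith
    · have h1 := Nat.lt_floor_add_one (ℓ ^ 2)
      have h2 : ℓ ^ 2 / 13 < ⌊ℓ ^ 2⌋₊ := by nlinarith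
      calc Real.log N ≤ q := hqlog
        _ = ℓ ^ 2 / 13 * (26 * q / ℓ ^ 2 / 2) := by field_simp; ring
        _ < _ := by
          have : 0 < q := by linarith
          gcongr
  have hleft : (∑ i, (A i).card : ℕ) - (S.card : ℝ) ≤ z := by
    rcases hrest with h | h
    · exact h
    by_contra! hz
    have h1 : (1 : ℝ) ≤ (∑ i, (A i).card : ℕ) - (S.card : ℝ) := by
      have : (S.card : ℝ) < (∑ i, (A i).card : ℕ) := by
        linarith [(Nat.cast_nonneg z : (0 : ℝ) ≤ z)]
      have : (S.card + 1 : ℝ) ≤ (∑ i, (A i).card : ℕ) := by exact_mod_cast this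
      linarith
    nlinarith
  obtain ⟨M, P, hAB, hmatch, hcard, hpath, hP⟩ := hS.exists_matchings
  refine ⟨M, P, hAB, hmatch, ?_, hpath, fun a b _ => ?_⟩
  · have : ∑ i, ((M i).card : ℝ) = S.card := by exact_mod_cast hcard
    rw [this]
    push_cast at hleft
    linarith
  · refine le_trans ?_ (Nat.floor_le (sq_nonneg ℓ))
    refine Nat.cast_le.2 (le_trans (le_of_eq ?_) ((hP s(a, b)).trans (hcong _)))
    congr!
end

section
/- Let G be a graph on n ≥ 2 vertices with maximum vertex degree Δ ≥ 1, let A₁',B₁',…,A_k',B_k' be pairwise disjoint subsets of V(G) with |A_i'| ≤ |B_i'| for all i, and let ℓ be a real number with ℓ ≥ 32·Δ·log n, where log is the natural logarithm. Then at least one of the following holds: (1) for each i there is a matching M_i ⊆ A_i' × B_i' (a set of pairs with no repeated vertex) with Σ_{i=1}^k |M_i| ≥ (Σ_{i=1}^k |A_i'|)·(8·log n/ℓ²), together with, for every pair (a,b) ∈ ⋃_i M_i, a path P(a,b) in G from a to b, such that these paths are pairwise edge-disjoint; or (2) there is a partition (X,Y) of V(G) with |X| ≥ (Σ_{i=1}^k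 |A_i'|)/2, |Y| ≥ (Σ_{i=1}^k |A_i'|)/2 and |E_G(X,Y)| ≤ (72·Δ·log n/ℓ)·min(|X|,|Y|). -/
open Finset
open scoped Classical

variable {V : Type*}

namespace RouteOrCut

section Growth

variable [DecidableEq V]

/-- The vertices of `U \ C` having an `H`-neighbour in `C`. -/
noncomputable def frontier (H : SimpleGraph V) (U C : Finset V) : Finset V :=
  (U \ C).filter fun v => ∃ u ∈ C, H.Adj u v

lemma interEdges_le_card_frontier_mul [Fintype V] (H : SimpleGraph V) (U C : Finset V) (Δ : ℕ)
    (hdeg : ∀ v, deg H v ≤ Δ) :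
    interEdges H C (U \ C) ≤ (frontier H U C).card * Δ := by
  unfold interEdges
  rw [mul_comm]
  refine Finset.card_le_mul_card_image_of_maps_to (f := fun p : V × V => p.2) ?_ Δ ?_
  · intro p hp
    simp only [frontier, mem_filter, mem_product] at hp ⊢
    exact ⟨hp.1.2, p.1, hp.1.1, hp.2⟩
  · intro v _
    refine le_trans ?_ (hdeg v)
    unfold deg
    refine Finset.card_le_card_of_injOn Prod.fst ?_ ?_
    · intro p hp
      simp only [coe_filter, mem_filter, mem_product, Set.mem_ofPred_eq] at hp
      simp only [coe_filter, mem_univ, true_and, Set.mem_ofPred_eq]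
      exact hp.2 ▸ hp.1.2.symm
    · intro p hp q hq h
      simp only [coe_filter, mem_filter, Set.mem_ofPred_eq] at hp hq
      exact Prod.ext h (hp.2.trans hq.2.symm)

/-- The ball of radius `r` around `S` in the subgraph of `H` induced by `U`. -/
noncomputable def ball (H : SimpleGraph V) (U S : Finset V) : ℕ → Finset V
  | 0 => S
  | r + 1 => ball H U S r ∪ frontier H U (ball H U S r)

lemma card_ball_succ (H : SimpleGraph V) (U S : Finset V) (r : ℕ) :
    (ball H U S (r + 1)).card = (ball H U S r).card + (frontier H U (ball H U S r)).card := by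
  rw [ball, card_union_of_disjoint]
  rw [Finset.disjoint_left]
  intro v hv hv'
  simp only [frontier, mem_filter, mem_sdiff] at hv'
  exact hv'.1.2 hv

lemma subset_ball (H : SimpleGraph V) (U S : Finset V) (r : ℕ) : S ⊆ ball H U S r := by
  induction r with
  | zero => exact subset_rfl
  | succ r ih => exact ih.trans subset_union_left

lemma ball_subset (H : SimpleGraph V) {U S : Finset V} (hS : S ⊆ U) (r : ℕ) :
    ball H U S r ⊆ U := by
  induction r with
  | zero => exact hS
  | succ r ih =>
    exact union_subset ih ((filter_subset _ _).trans sdiff_subset)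

lemma exists_walk_of_mem_ball (H : SimpleGraph V) (U S : Finset V) (r : ℕ) :
    ∀ v ∈ ball H U S r, ∃ s ∈ S, ∃ w : H.Walk s v, w.length ≤ r := by
  induction r with
  | zero => exact fun v hv => ⟨v, hv, .nil, le_rfl⟩
  | succ r ih =>
    intro v hv
    rcases mem_union.1 hv with hv | hv
    · obtain ⟨s, hs, w, hw⟩ := ih v hv
      exact ⟨s, hs, w, by omega⟩
    · obtain ⟨-, u, hu, huv⟩ := mem_filter.1 hv
      obtain ⟨s, hs, w, hw⟩ := ih u hu
      exact ⟨s, hs, w.concat huv, by rw [SimpleGraph.Walk.length_concat]; omega⟩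

/-- Ball growing: some ball of radius at most `R` has a sparse boundary inside `U`. -/
lemma exists_ball_sparse [Fintype V] (H : SimpleGraph V) {U S : Finset V} {Δ R : ℕ} {x : ℝ}
    (hdeg : ∀ v, deg H v ≤ Δ) (hS : S.Nonempty) (hx : 0 ≤ x)
    (hR : (Fintype.card V : ℝ) < (1 + x) ^ R) :
    ∃ r ≤ R, (interEdges H (ball H U S r) (U \ ball H U S r) : ℝ)
      ≤ x * Δ * (ball H U S r).card := by
  by_contra! hcon
  have key : ∀ r ≤ R, (1 + x) ^ r ≤ ((ball H U S r).card : ℝ) := by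
    intro r
    induction r with
    | zero =>
      intro _
      have := hS.card_pos
      simpa [ball] using this
    | succ r ih =>
      intro hr
      have h1 := ih (by omega)
      have h2 := hcon r (by omega)
      have h3 : (interEdges H (ball H U S r) (U \ ball H U S r) : ℝ)
          ≤ (frontier H U (ball H U S r)).card * Δ := by
        exact_mod_cast interEdges_le_card_frontier_mul H U _ Δ hdeg
      have h4 : x * (ball H U S r).card ≤ (frontier H U (ball H U S r)).card := by
        by_contra! h
        have : (0 : ℝ) ≤ Δ := Nat.cast_nonneg _
        nlinarith [mul_le_mul_of_nonneg_right h.le this]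
      rw [card_ball_succ, pow_succ]
      push_cast
      nlinarith
  have h1 := key R le_rfl
  have h2 : ((ball H U S R).card : ℝ) ≤ Fintype.card V := by
    exact_mod_cast card_le_univ _
  linarith

end Growth

section Cut

variable [Fintype V] [DecidableEq V]

lemma interEdges_compl_union_le (H : SimpleGraph V) (Z C : Finset V) :
    interEdges H (Z ∪ C) (Z ∪ C)ᶜ ≤ interEdges H Z Zᶜ + interEdges H C (Zᶜ \ C) := by
  unfold interEdges
  refine le_trans (card_le_card ?_) (card_union_le _ _)
  intro p hp
  simp only [mem_filter, mem_product, mem_union, mem_compl, mem_sdiff] at hp ⊢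
  tauto

/-- If terminal sets `A i`, `B i` are far apart in `H`, then repeatedly removing sparse balls
gives a sparse cut which is either large or exhausts one of `A i`, `B i` for every `i`. -/
lemma exists_sparse_set {ι : Type*} (H : SimpleGraph V) {Δ R : ℕ} {x s : ℝ}
    (A B : ι → Finset V) (hdeg : ∀ v, deg H v ≤ Δ) (hx : 0 ≤ x) (hs : 0 ≤ s)
    (hR : (Fintype.card V : ℝ) < (1 + x) ^ R)
    (hfar : ∀ i, ∀ a ∈ A i, ∀ b ∈ B i, ∀ w : H.Walk a b, 2 * R < w.length) :
    ∃ Z : Finset V, (interEdges H Z Zᶜ : ℝ) ≤ x * Δ * Z.card ∧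
      2 * (Z.card : ℝ) ≤ Fintype.card V + s ∧
      (s ≤ Z.card ∨ ∀ i, A i ⊆ Z ∨ B i ⊆ Z) := by
  let good : Finset (Finset V) := univ.filter fun Z =>
    (interEdges H Z Zᶜ : ℝ) ≤ x * Δ * Z.card ∧ 2 * (Z.card : ℝ) ≤ Fintype.card V + s
  have hne : good.Nonempty := by
    refine ⟨∅, mem_filter.2 ⟨mem_univ _, ?_, ?_⟩⟩
    · simp [interEdges]
    · simp only [card_empty, Nat.cast_zero, mul_zero]
      positivity
  obtain ⟨Z, hZ, hmax⟩ := exists_max_image good card hne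
  obtain ⟨-, hZ1, hZ2⟩ := mem_filter.1 hZ
  refine ⟨Z, hZ1, hZ2, ?_⟩
  by_contra! hcon
  obtain ⟨hlt, i, hA, hB⟩ := hcon
  have extend : ∀ C : Finset V, C.Nonempty → C ⊆ Zᶜ →
      (interEdges H C (Zᶜ \ C) : ℝ) ≤ x * Δ * C.card → ¬ 2 * C.card ≤ Zᶜ.card := by
    intro C hC hCZ hsparse hcard
    have hd : Disjoint Z C := by
      rw [disjoint_comm]
      exact (subset_compl_iff_disjoint_right).1 hCZ
    have hcu : (Z ∪ C).card = Z.card + C.card := card_union_of_disjoint hd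
    have hmem : Z ∪ C ∈ good := by
      refine mem_filter.2 ⟨mem_univ _, ?_, ?_⟩
      · have h1 : (interEdges H (Z ∪ C) (Z ∪ C)ᶜ : ℝ)
            ≤ interEdges H Z Zᶜ + interEdges H C (Zᶜ \ C) := by
          exact_mod_cast interEdges_compl_union_le H Z C
        rw [hcu]
        push_cast
        linarith
      · have h1 : Z.card + Zᶜ.card = Fintype.card V := card_add_card_compl Z
        have h2 : (2 : ℝ) * (Z ∪ C).card ≤ Z.card + Fintype.card V := by
          rw [hcu]
          exact_mod_cast (by omega : 2 * (Z.card + C.card) ≤ Z.card + Fintype.card V)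
        linarith
    have := hmax _ hmem
    have := hC.card_pos
    omega
  have hA' : (A i \ Z).Nonempty := sdiff_nonempty.2 hA
  have hB' : (B i \ Z).Nonempty := sdiff_nonempty.2 hB
  have hsub : ∀ S : Finset V, S \ Z ⊆ Zᶜ := fun S v hv => mem_compl.2 (mem_sdiff.1 hv).2
  obtain ⟨r, hr, hrs⟩ := exists_ball_sparse H (U := Zᶜ) hdeg hA' hx hR
  obtain ⟨t, ht, hts⟩ := exists_ball_sparse H (U := Zᶜ) hdeg hB' hx hR
  have h1 := extend _ (hA'.mono (subset_ball H _ _ r)) (ball_subset H (hsub _) r) hrs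
  have h2 := extend _ (hB'.mono (subset_ball H _ _ t)) (ball_subset H (hsub _) t) hts
  have hdis : Disjoint (ball H Zᶜ (A i \ Z) r) (ball H Zᶜ (B i \ Z) t) := by
    rw [Finset.disjoint_left]
    intro v hv hv'
    obtain ⟨a, ha, w, hw⟩ := exists_walk_of_mem_ball H _ _ r v hv
    obtain ⟨b, hb, w', hw'⟩ := exists_walk_of_mem_ball H _ _ t v hv'
    have := hfar i a (mem_sdiff.1 ha).1 b (mem_sdiff.1 hb).1 (w.append w'.reverse)
    rw [SimpleGraph.Walk.length_append, SimpleGraph.Walk.length_reverse] at this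
    omega
  have h3 := card_le_card (union_subset (ball_subset H (hsub (A i)) r) (ball_subset H (hsub (B i)) t))
  rw [card_union_of_disjoint hdis] at h3
  omega

end Cut

section Routing

variable [DecidableEq V]

/-- `T` is a matching of pairs related by `Q`, and `F` assigns to the pairs of `T` pairwise
disjoint sets of at most `d` edges, each containing the edges of a path joining the pair. -/
structure IsRouting (G : SimpleGraph V) (Q : V → V → Prop) (d : ℕ) (T : Finset (V × V))
    (F : V × V → Finset (Sym2 V)) : Prop where
  rel : ∀ p ∈ T, Q p.1 p.2
  inj : ∀ p ∈ T, ∀ q ∈ T, p ≠ q → p.1 ≠ q.1 ∧ p.2 ≠ q.2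
  path : ∀ p ∈ T, ∃ w : G.Walk p.1 p.2, w.IsPath ∧ ∀ e ∈ w.edges, e ∈ F p
  card_le : ∀ p ∈ T, (F p).card ≤ d
  disj : ∀ p ∈ T, ∀ q ∈ T, p ≠ q → Disjoint (F p) (F q)

/-- Delete from `G` all edges used by a routing. -/
def residual (G : SimpleGraph V) (T : Finset (V × V)) (F : V × V → Finset (Sym2 V)) :
    SimpleGraph V :=
  G.deleteEdges (T.biUnion F : Finset (Sym2 V))

lemma IsRouting.insert {G : SimpleGraph V} {Q : V → V → Prop} {d : ℕ} {T : Finset (V × V)}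
    {F : V × V → Finset (Sym2 V)} (h : IsRouting G Q d T F) {a b : V} (hab : Q a b)
    (ha : a ∉ T.image Prod.fst) (hb : b ∉ T.image Prod.snd)
    (w : (residual G T F).Walk a b) (hw : w.length ≤ d) :
    ∃ F', IsRouting G Q d (Insert.insert (a, b) T) F' := by
  have ha' : ∀ p ∈ T, p.1 ≠ a := fun p hp e => ha (mem_image.2 ⟨p, hp, e⟩)
  have hb' : ∀ p ∈ T, p.2 ≠ b := fun p hp e => hb (mem_image.2 ⟨p, hp, e⟩)
  have hne : ∀ p ∈ T, p ≠ (a, b) := fun p hp e => ha' p hp (by rw [e])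
  have hle : residual G T F ≤ G := SimpleGraph.deleteEdges_le _
  have hnew : ∀ p ∈ T, Disjoint (F p) w.bypass.edges.toFinset := by
    intro p hp
    rw [Finset.disjoint_left]
    intro e he he'
    have h1 := w.bypass.edges_subset_edgeSet (List.mem_toFinset.1 he')
    rw [residual, SimpleGraph.edgeSet_deleteEdges] at h1
    exact h1.2 (mem_coe.2 (mem_biUnion.2 ⟨p, hp, he⟩))
  refine ⟨Function.update F (a, b) w.bypass.edges.toFinset, ?_, ?_, ?_, ?_, ?_⟩
  · intro p hp
    rcases mem_insert.1 hp with rfl | hp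
    · exact hab
    · exact h.rel p hp
  · intro p hp q hq hpq
    rcases mem_insert.1 hp with rfl | hp <;> rcases mem_insert.1 hq with rfl | hq
    · exact absurd rfl hpq
    · exact ⟨(ha' q hq).symm, (hb' q hq).symm⟩
    · exact ⟨ha' p hp, hb' p hp⟩
    · exact h.inj p hp q hq hpq
  · intro p hp
    rcases mem_insert.1 hp with rfl | hp
    · refine ⟨w.bypass.mapLe hle, ?_, ?_⟩
      · exact (SimpleGraph.Walk.isPath_mapLe hle).2 w.bypass_isPath
      · intro e he
        rw [SimpleGraph.Walk.edges_mapLe_eq_edges] at he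
        simpa using he
    · rw [Function.update_of_ne (hne p hp)]
      exact h.path p hp
  · intro p hp
    rcases mem_insert.1 hp with rfl | hp
    · rw [Function.update_self]
      refine (List.toFinset_card_le _).trans ?_
      rw [SimpleGraph.Walk.length_edges]
      exact w.length_bypass_le_length.trans hw
    · rw [Function.update_of_ne (hne p hp)]
      exact h.card_le p hp
  · intro p hp q hq hpq
    rcases mem_insert.1 hp with rfl | hp <;> rcases mem_insert.1 hq with rfl | hq
    · exact absurd rfl hpq
    · rw [Function.update_self, Function.update_of_ne (hne q hq)]
      exact (hnew q hq).symm
    · rw [Function.update_self, Function.update_of_ne (hne p hp)]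
      exact hnew p hp
    · rw [Function.update_of_ne (hne p hp), Function.update_of_ne (hne q hq)]
      exact h.disj p hp q hq hpq

lemma exists_maximal_routing [Fintype V] (G : SimpleGraph V) (Q : V → V → Prop) (d : ℕ) :
    ∃ T F, IsRouting G Q d T F ∧ ∀ a b, Q a b → a ∉ T.image Prod.fst → b ∉ T.image Prod.snd →
      ∀ w : (residual G T F).Walk a b, d < w.length := by
  let good : Finset (Finset (V × V)) := univ.filter fun T => ∃ F, IsRouting G Q d T F
  have hne : good.Nonempty :=
    ⟨∅, mem_filter.2 ⟨mem_univ _, fun _ => ∅, by constructor <;> simp⟩⟩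
  obtain ⟨T, hT, hmax⟩ := exists_max_image good card hne
  obtain ⟨-, F, hF⟩ := mem_filter.1 hT
  refine ⟨T, F, hF, fun a b hab ha hb w => ?_⟩
  by_contra! hw
  have h1 := hmax _ (mem_filter.2 ⟨mem_univ _, hF.insert hab ha hb w hw⟩)
  rw [card_insert_of_notMem fun h => ha (mem_image.2 ⟨_, h, rfl⟩)] at h1
  omega

lemma interEdges_le_residual_add [Fintype V] {G : SimpleGraph V} {Q : V → V → Prop} {d : ℕ}
    {T : Finset (V × V)} {F : V × V → Finset (Sym2 V)} (h : IsRouting G Q d T F)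
    (Z : Finset V) :
    interEdges G Z Zᶜ ≤ interEdges (residual G T F) Z Zᶜ + T.card * d := by
  have h1 : (T.biUnion F).card ≤ T.card * d := card_biUnion_le_card_mul T F d h.card_le
  have h2 : ((Z ×ˢ Zᶜ).filter fun p => s(p.1, p.2) ∈ T.biUnion F).card ≤ (T.biUnion F).card := by
    refine card_le_card_of_injOn (fun p => s(p.1, p.2)) ?_ ?_
    · intro p hp
      exact (mem_filter.1 (mem_coe.1 hp)).2
    · intro p hp q hq hpq
      simp only [coe_filter, mem_product, mem_compl, Set.mem_ofPred_eq] at hp hq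
      rcases Sym2.eq_iff.1 hpq with ⟨e1, e2⟩ | ⟨e1, e2⟩
      · exact Prod.ext e1 e2
      · exact absurd (e1 ▸ hp.1.1) hq.1.2
  have h3 : interEdges G Z Zᶜ ≤ interEdges (residual G T F) Z Zᶜ +
      ((Z ×ˢ Zᶜ).filter fun p => s(p.1, p.2) ∈ T.biUnion F).card := by
    unfold interEdges
    refine le_trans (card_le_card ?_) (card_union_le _ _)
    intro p hp
    rw [mem_filter] at hp
    rw [mem_union, mem_filter, mem_filter, residual, SimpleGraph.deleteEdges_adj]
    by_cases h : s(p.1, p.2) ∈ T.biUnion F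
    · exact Or.inr ⟨hp.1, h⟩
    · exact Or.inl ⟨hp.1, hp.2, h⟩
  omega

lemma deg_residual_le [Fintype V] (G : SimpleGraph V) (T : Finset (V × V))
    (F : V × V → Finset (Sym2 V)) (v : V) : deg (residual G T F) v ≤ maxDeg G := by
  refine le_trans (card_le_card ?_) (le_sup (f := fun v => deg G v) (mem_univ v))
  intro u hu
  rw [mem_filter] at hu ⊢
  exact ⟨hu.1, (SimpleGraph.deleteEdges_le _ : residual G T F ≤ G) hu.2⟩

end Routing

lemma exp_half_le_one_add {x : ℝ} (h0 : 0 ≤ x) (h1 : x ≤ 1) : Real.exp (x / 2) ≤ 1 + x := by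
  have h2 := Real.add_one_le_exp (-(x / 2))
  have h3 : Real.exp (x / 2) * Real.exp (-(x / 2)) = 1 := by
    rw [← Real.exp_add]; simp
  have h4 := Real.exp_pos (x / 2)
  nlinarith [mul_le_mul_of_nonneg_left h2 h4.le]

lemma lt_one_add_pow {n ℓ : ℝ} (hn : 2 ≤ n) (hℓ : 32 * Real.log n ≤ ℓ) :
    n < (1 + 32 * Real.log n / ℓ) ^ ⌊ℓ / 2⌋₊ := by
  have hL : 0.6931471803 < Real.log n :=
    Real.log_two_gt_d9.trans_le (Real.log_le_log (by norm_num) hn)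
  have hpos : 0 < ℓ := by linarith
  have h1 := exp_half_le_one_add (x := 32 * Real.log n / ℓ) (by positivity)
    ((div_le_one hpos).2 hℓ)
  have h2 := pow_le_pow_left₀ (Real.exp_pos _).le h1 ⌊ℓ / 2⌋₊
  refine lt_of_lt_of_le ?_ h2
  rw [← Real.exp_nat_mul]
  have h3 : ℓ / 2 < ⌊ℓ / 2⌋₊ + 1 := Nat.lt_floor_add_one _
  conv_lhs => rw [← Real.exp_log (by linarith : 0 < n)]
  rw [Real.exp_lt_exp]
  have h4 : (⌊ℓ / 2⌋₊ : ℝ) * (32 * Real.log n / ℓ / 2)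
      = Real.log n * (16 * ⌊ℓ / 2⌋₊ / ℓ) := by ring
  rw [h4]
  have h5 : 1 < 16 * (⌊ℓ / 2⌋₊ : ℝ) / ℓ := by
    rw [lt_div_iff₀ hpos]; linarith
  nlinarith

section Terminals

variable [DecidableEq V] {k : ℕ} {A B : Fin k → Finset V}

/-- The number of demand pairs is at most the size of any set which, together with the matched
terminals, covers one side of every demand. -/
lemma sum_card_le_of_cover
    (hdisj : ∀ x y : Fin k ⊕ Fin k, x ≠ y →
      Disjoint (Sum.elim A B x) (Sum.elim A B y))
    (hsize : ∀ i, (A i).card ≤ (B i).card) (W : Finset V)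
    (hcov : ∀ i, A i ⊆ W ∨ B i ⊆ W) : ∑ i, (A i).card ≤ W.card := by
  have : ∀ i, ∃ c : Fin k ⊕ Fin k, (c = Sum.inl i ∨ c = Sum.inr i) ∧ Sum.elim A B c ⊆ W := by
    intro i
    rcases hcov i with h | h
    · exact ⟨Sum.inl i, Or.inl rfl, h⟩
    · exact ⟨Sum.inr i, Or.inr rfl, h⟩
  choose c hc hcW using this
  calc ∑ i, (A i).card ≤ ∑ i, (Sum.elim A B (c i)).card := by
        refine sum_le_sum fun i _ => ?_
        rcases hc i with h | h <;> rw [h]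
        · exact le_rfl
        · exact hsize i
    _ = (univ.biUnion fun i => Sum.elim A B (c i)).card := by
        rw [card_biUnion]
        intro i _ j _ hij
        refine hdisj _ _ fun h => hij ?_
        rcases hc i with h1 | h1 <;> rcases hc j with h2 | h2 <;> rw [h1, h2] at h <;>
          simp at h <;> exact h
    _ ≤ W.card := card_le_card (biUnion_subset.2 fun i _ => hcW i)

lemma two_mul_sum_card_le [Fintype V]
    (hdisj : ∀ x y : Fin k ⊕ Fin k, x ≠ y →
      Disjoint (Sum.elim A B x) (Sum.elim A B y))
    (hsize : ∀ i, (A i).card ≤ (B i).card) :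
    2 * ∑ i, (A i).card ≤ Fintype.card V := by
  have h1 : (univ.biUnion (Sum.elim A B)).card = ∑ c, (Sum.elim A B c).card :=
    card_biUnion fun x _ y _ h => hdisj x y h
  rw [Fintype.sum_sum_type] at h1
  have h2 := card_le_univ (univ.biUnion (Sum.elim A B))
  have h3 : ∑ i, (A i).card ≤ ∑ i, (B i).card := sum_le_sum fun i _ => hsize i
  simp only [Sum.elim_inl, Sum.elim_inr] at h1
  omega

/-- A set of demand pairs splits into its restrictions to the individual demands. -/
lemma sum_card_filter_eq
    (hdisj : ∀ x y : Fin k ⊕ Fin k, x ≠ y →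
      Disjoint (Sum.elim A B x) (Sum.elim A B y))
    {T : Finset (V × V)} (hT : ∀ p ∈ T, ∃ i, p.1 ∈ A i ∧ p.2 ∈ B i) :
    ∑ i, (T.filter fun p => p.1 ∈ A i ∧ p.2 ∈ B i).card = T.card := by
  rw [← card_biUnion]
  · congr 1
    ext p
    simp only [mem_biUnion, mem_univ, true_and, mem_filter]
    exact ⟨fun ⟨_, h, _⟩ => h, fun h => (hT p h).imp fun _ hi => ⟨h, hi⟩⟩
  · intro i _ j _ hij
    rw [Function.onFun, Finset.disjoint_left]
    intro p hp hq
    rw [mem_filter] at hp hq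
    exact Finset.disjoint_left.1
      (hdisj (Sum.inl i) (Sum.inl j) fun h => hij (Sum.inl_injective h)) hp.2.1 hq.2.1

end Terminals

/-- The numerical estimate combining the edges of a sparse cut with the deleted edges. -/
lemma cut_size_le {S n z y m D L ℓ e : ℝ} (hS0 : 0 ≤ S) (hD : 1 ≤ D) (hL : 0 < L) (hℓ : 0 < ℓ)
    (hm : m < S * (8 * L / ℓ ^ 2)) (hn : z + y = n) (hS : 2 * S ≤ n)
    (hz : 2 * z ≤ n + S / 2) (hz' : S / 2 ≤ z)
    (he : e ≤ 32 * L / ℓ * D * z + m * ℓ) :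
    e ≤ 72 * D * L / ℓ * min z y := by
  have h1 : m * ℓ ≤ 8 * S * (L / ℓ) := by
    have := mul_le_mul_of_nonneg_right hm.le hℓ.le
    calc m * ℓ ≤ S * (8 * L / ℓ ^ 2) * ℓ := this
      _ = 8 * S * (L / ℓ) := by field_simp
  have hq : 0 < L / ℓ := div_pos hL hℓ
  have h2 : z ≤ 5 / 3 * min z y := by
    rcases min_choice z y with h | h <;> rw [h] <;> linarith
  have h3 : S ≤ 2 * min z y := by
    rcases min_choice z y with h | h <;> rw [h] <;> linarith
  have h0 : 0 ≤ min z y := by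
    rcases min_choice z y with h | h <;> rw [h] <;> linarith
  have h4 : 32 * L / ℓ * D * z ≤ 32 * (L / ℓ * D) * (5 / 3 * min z y) := by
    have := mul_le_mul_of_nonneg_left h2 (by positivity : 0 ≤ 32 * (L / ℓ * D))
    calc 32 * L / ℓ * D * z = 32 * (L / ℓ * D) * z := by ring
      _ ≤ _ := this
  have h5 : 8 * S * (L / ℓ) ≤ 16 * (L / ℓ * D) * min z y := by
    have h6 := mul_le_mul_of_nonneg_right h3 hq.le
    have h7 := mul_le_mul_of_nonneg_left hD (mul_nonneg hq.le h0)
    nlinarith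
  have h8 : 72 * D * L / ℓ * min z y = 72 * (L / ℓ * D) * min z y := by ring
  have h9 : 0 ≤ (L / ℓ * D) * min z y := by positivity
  rw [h8]
  nlinarith

end RouteOrCut

/-- a single iteration of the matching player.  Either there is a
partial routing of value at least `(Σ|A i|)·(8 log n/ℓ²)` whose paths are
pairwise edge-disjoint (congestion 1), or there is a balanced sparse cut. -/
theorem route_or_cut_single_iteration
    [Fintype V] [DecidableEq V]
    (G : SimpleGraph V) (k : ℕ) (A B : Fin k → Finset V) (Δ : ℕ) (ℓ : ℝ)
    (hn : 2 ≤ Fintype.card V) (hΔ : maxDeg G = Δ) (hΔ1 : 1 ≤ Δ)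
    (hdisj : ∀ x y : Fin k ⊕ Fin k, x ≠ y →
      Disjoint (Sum.elim A B x) (Sum.elim A B y))
    (hsize : ∀ i, (A i).card ≤ (B i).card)
    (hℓ : 32 * (Δ : ℝ) * Real.log (Fintype.card V) ≤ ℓ) :
    (∃ (M : Fin k → Finset (V × V))
        (P : (i : Fin k) → (p : V × V) → p ∈ M i → G.Walk p.1 p.2),
        (∀ i, ∀ p ∈ M i, p.1 ∈ A i ∧ p.2 ∈ B i) ∧
        (∀ i, ∀ p ∈ M i, ∀ q ∈ M i, p ≠ q → p.1 ≠ q.1 ∧ p.2 ≠ q.2) ∧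
        (∑ i, ((A i).card : ℝ)) * (8 * Real.log (Fintype.card V) / ℓ ^ 2) ≤
          ∑ i, ((M i).card : ℝ) ∧
        (∀ i p hp, (P i p hp).IsPath) ∧
        (∀ i j, ∀ p, ∀ hp : p ∈ M i, ∀ q, ∀ hq : q ∈ M j, (i ≠ j ∨ p ≠ q) →
          List.Disjoint (P i p hp).edges (P j q hq).edges)) ∨
      (∃ X Y : Finset V, Disjoint X Y ∧ X ∪ Y = Finset.univ ∧
        (∑ i, ((A i).card : ℝ)) / 2 ≤ (X.card : ℝ) ∧
        (∑ i, ((A i).card : ℝ)) / 2 ≤ (Y.card : ℝ) ∧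
        (interEdges G X Y : ℝ) ≤
          (72 * (Δ : ℝ) * Real.log (Fintype.card V) / ℓ) *
            ((min X.card Y.card : ℕ) : ℝ)) := by
  set L := Real.log (Fintype.card V) with hLdef
  have hn' : (2 : ℝ) ≤ Fintype.card V := by exact_mod_cast hn
  have hL : 0.6931471803 < L :=
    Real.log_two_gt_d9.trans_le (Real.log_le_log (by norm_num) hn')
  have hD : (1 : ℝ) ≤ Δ := by exact_mod_cast hΔ1
  have hℓ' : 32 * L ≤ ℓ := by nlinarith
  have hℓ0 : 0 < ℓ := by linarith
  obtain ⟨T, F, hT, hmax⟩ := RouteOrCut.exists_maximal_routing G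
    (fun a b => ∃ i, a ∈ A i ∧ b ∈ B i) ⌊ℓ⌋₊
  have hsum := RouteOrCut.sum_card_filter_eq hdisj hT.rel
  by_cases hbig : (∑ i, ((A i).card : ℝ)) * (8 * L / ℓ ^ 2) ≤ T.card
  · left
    choose w hw hwF using hT.path
    refine ⟨fun i => T.filter fun p => p.1 ∈ A i ∧ p.2 ∈ B i,
      fun i p hp => w p (mem_filter.1 hp).1, ?_, ?_, ?_, ?_, ?_⟩
    · exact fun i p hp => (mem_filter.1 hp).2
    · exact fun i p hp q hq => hT.inj p (mem_filter.1 hp).1 q (mem_filter.1 hq).1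
    · refine hbig.trans_eq ?_
      rw [← hsum]
      push_cast
      rfl
    · exact fun i p hp => hw p _
    · intro i j p hp q hq hne
      have hpq : p ≠ q := by
        rintro rfl
        refine hne.elim (fun hij => ?_) fun h => h rfl
        exact Finset.disjoint_left.1
          (hdisj (Sum.inl i) (Sum.inl j) fun h => hij (Sum.inl_injective h))
          (mem_filter.1 hp).2.1 (mem_filter.1 hq).2.1
      intro e he he'
      exact Finset.disjoint_left.1
        (hT.disj p (mem_filter.1 hp).1 q (mem_filter.1 hq).1 hpq)
        (hwF p _ e he) (hwF q _ e he')
  · right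
    push Not at hbig
    set S : ℝ := ∑ i, ((A i).card : ℝ) with hS
    have hS0 : 0 ≤ S := sum_nonneg fun i _ => Nat.cast_nonneg _
    have hSn : 2 * S ≤ Fintype.card V := by
      have := RouteOrCut.two_mul_sum_card_le hdisj hsize
      rw [hS]
      exact_mod_cast this
    have hm : 2 * (T.card : ℝ) ≤ S / 2 := by
      have h1 : 8 * L / ℓ ^ 2 ≤ 1 / 4 := by
        rw [div_le_iff₀ (by positivity)]
        nlinarith
      nlinarith
    have h2R : 2 * ⌊ℓ / 2⌋₊ ≤ ⌊ℓ⌋₊ := by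
      refine Nat.le_floor ?_
      have := Nat.floor_le (by positivity : 0 ≤ ℓ / 2)
      push_cast
      linarith
    have hdeg : ∀ v, deg (RouteOrCut.residual G T F) v ≤ Δ := by
      rw [← hΔ]
      exact RouteOrCut.deg_residual_le G T F
    have hx : 0 ≤ 32 * L / ℓ := div_nonneg (by linarith) hℓ0.le
    obtain ⟨Z, hZ1, hZ2, hZ3⟩ := RouteOrCut.exists_sparse_set (RouteOrCut.residual G T F)
      (Δ := Δ) (x := 32 * L / ℓ) (s := S / 2) (fun i => A i \ T.image Prod.fst) (fun i => B i \ T.image Prod.snd)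
      hdeg hx (by linarith) (RouteOrCut.lt_one_add_pow hn' hℓ')
      (fun i a ha b hb w => h2R.trans_lt (hmax a b
        ⟨i, (mem_sdiff.1 ha).1, (mem_sdiff.1 hb).1⟩ (mem_sdiff.1 ha).2 (mem_sdiff.1 hb).2 w))
    have hZS : S / 2 ≤ Z.card := by
      rcases hZ3 with h | h
      · exact h
      · have h1 := RouteOrCut.sum_card_le_of_cover hdisj hsize
          (Z ∪ (T.image Prod.fst ∪ T.image Prod.snd)) (fun i => (h i).imp
            (fun h v hv => by
              by_cases hv' : v ∈ T.image Prod.fst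
              · exact mem_union_right _ (mem_union_left _ hv')
              · exact mem_union_left _ (h (mem_sdiff.2 ⟨hv, hv'⟩)))
            (fun h v hv => by
              by_cases hv' : v ∈ T.image Prod.snd
              · exact mem_union_right _ (mem_union_right _ hv')
              · exact mem_union_left _ (h (mem_sdiff.2 ⟨hv, hv'⟩))))
        have h2 := card_union_le Z (T.image Prod.fst ∪ T.image Prod.snd)
        have h3 := card_union_le (T.image Prod.fst) (T.image Prod.snd)
        have h4 : (T.image Prod.fst).card ≤ T.card := card_image_le
        have h5 : (T.image Prod.snd).card ≤ T.card := card_image_le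
        have h6 : S ≤ Z.card + 2 * T.card := by
          rw [hS]
          exact_mod_cast (by omega : ∑ i, (A i).card ≤ Z.card + 2 * T.card)
        linarith
    have hcard : (Z.card : ℝ) + Zᶜ.card = Fintype.card V := by
      exact_mod_cast card_add_card_compl Z
    have hYS : S / 2 ≤ Zᶜ.card := by linarith
    refine ⟨Z, Zᶜ, disjoint_compl_right, union_compl Z, hZS, hYS, ?_⟩
    rw [Nat.cast_min]
    refine RouteOrCut.cut_size_le hS0 hD (by linarith) hℓ0 hbig hcard hSn hZ2 hZS ?_
    have h1 : (interEdges G Z Zᶜ : ℝ) ≤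
        interEdges (RouteOrCut.residual G T F) Z Zᶜ + T.card * ⌊ℓ⌋₊ := by
      exact_mod_cast RouteOrCut.interEdges_le_residual_add hT Z
    have h2 : (T.card : ℝ) * ⌊ℓ⌋₊ ≤ T.card * ℓ :=
      mul_le_mul_of_nonneg_left (Nat.floor_le hℓ0.le) (Nat.cast_nonneg _)
    linarith
end

section
/- Let H' be a graph on n' ≥ 2 vertices with maximum vertex degree at most Δ, where Δ ≥ 1, let ℓ > 1 be a real number, and let S and T be nonempty vertex sets of H' such that every path in H' connecting a vertex of S to a vertex of T has length greater than ℓ (in particular S and T are disjoint). Then there exists a set Z ⊆ V(H') such that |Z| ≤ n'/2, either S ⊆ Z or T ⊆ Z, and |E_{H'}(Z, V(H')∖Z)| < (8·Δ·log n'/ℓ)·|Z|, where log is the natural logarithm. -/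
open Finset
open scoped Classical

variable {V : Type*}

/-- The set of vertices reachable from `S` by a walk of length at most `i`. -/
noncomputable def closedBall [Fintype V] (G : SimpleGraph V) (S : Finset V) (i : ℕ) : Finset V :=
  Finset.univ.filter fun v => ∃ s ∈ S, ∃ p : G.Walk s v, p.length ≤ i

lemma mem_closedBall [Fintype V] {G : SimpleGraph V} {S : Finset V} {i : ℕ} {v : V} :
    v ∈ closedBall G S i ↔ ∃ s ∈ S, ∃ p : G.Walk s v, p.length ≤ i := by
  simp [closedBall]

lemma subset_closedBall [Fintype V] (G : SimpleGraph V) (S : Finset V) (i : ℕ) :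
    S ⊆ closedBall G S i :=
  fun s hs => mem_closedBall.2 ⟨s, hs, .nil, by simp⟩

lemma closedBall_mono [Fintype V] (G : SimpleGraph V) (S : Finset V) {i j : ℕ} (h : i ≤ j) :
    closedBall G S i ⊆ closedBall G S j := by
  intro v hv
  obtain ⟨s, hs, p, hp⟩ := mem_closedBall.1 hv
  exact mem_closedBall.2 ⟨s, hs, p, hp.trans h⟩

lemma mem_closedBall_succ_of_adj [Fintype V] {G : SimpleGraph V} {S : Finset V} {i : ℕ} {u v : V}
    (hu : u ∈ closedBall G S i) (h : G.Adj u v) : v ∈ closedBall G S (i + 1) := by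
  obtain ⟨s, hs, p, hp⟩ := mem_closedBall.1 hu
  exact mem_closedBall.2 ⟨s, hs, p.concat h, by simpa using hp⟩

lemma disjoint_closedBall [Fintype V] {G : SimpleGraph V} {S T : Finset V} {ℓ : ℝ} {i j : ℕ}
    (hfar : ∀ s ∈ S, ∀ t ∈ T, ∀ p : G.Walk s t, p.IsPath → ℓ < (p.length : ℝ))
    (hij : (i : ℝ) + j ≤ ℓ) : Disjoint (closedBall G S i) (closedBall G T j) := by
  rw [Finset.disjoint_left]
  intro v hS hT
  obtain ⟨s, hs, p, hp⟩ := mem_closedBall.1 hS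
  obtain ⟨t, ht, q, hq⟩ := mem_closedBall.1 hT
  have hlt := hfar s hs t ht (p.append q.reverse).bypass (SimpleGraph.Walk.bypass_isPath _)
  have hle := (p.append q.reverse).length_bypass_le_length
  rw [SimpleGraph.Walk.length_append, SimpleGraph.Walk.length_reverse] at hle
  have hle' : ((p.append q.reverse).bypass.length : ℝ) ≤ i + j := by
    exact_mod_cast hle.trans (add_le_add hp hq)
  linarith

lemma interEdges_le_mul_card_left [Fintype V] {G : SimpleGraph V} {Δ : ℕ}
    (hdeg : ∀ v, deg G v ≤ Δ) (A B : Finset V) : interEdges G A B ≤ Δ * A.card := by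
  refine card_le_mul_card_image_of_maps_to (f := Prod.fst)
    (fun p hp => (mem_product.1 (mem_filter.1 hp).1).1) Δ fun a _ => ?_
  refine le_trans (card_le_card_of_injOn Prod.snd ?_ ?_) (hdeg a)
  · rintro ⟨x, y⟩ h
    simp only [coe_filter, mem_filter, mem_product, Set.mem_ofPred_eq] at h
    obtain ⟨⟨-, hadj⟩, rfl⟩ := h
    simpa using hadj
  · rintro ⟨x, y⟩ h ⟨x', y'⟩ h' hy
    simp only [coe_filter, mem_filter, Set.mem_ofPred_eq] at h h'
    exact Prod.ext (h.2.trans h'.2.symm) hy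

lemma interEdges_le_mul_card_of_adj [Fintype V] {G : SimpleGraph V} {Δ : ℕ}
    (hdeg : ∀ v, deg G v ≤ Δ) {A B W : Finset V}
    (hW : ∀ a ∈ A, ∀ b ∈ B, G.Adj a b → b ∈ W) : interEdges G A B ≤ Δ * W.card := by
  refine le_trans (card_le_card_of_injOn Prod.swap ?_ Prod.swap_injective.injOn)
    (interEdges_le_mul_card_left hdeg W A)
  rintro ⟨a, b⟩ h
  simp only [coe_filter, mem_product, Set.mem_ofPred_eq] at h
  simpa using ⟨⟨hW a h.1.1 b h.1.2 h.2, h.1.1⟩, h.2.symm⟩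

/-- If every ball around `S` of radius less than `k` has edge expansion at least `Δ * a`, then the
balls grow by a factor of `1 + a` at each step. -/
lemma pow_le_card_closedBall [Fintype V] [DecidableEq V] {G : SimpleGraph V} {Δ : ℕ} {a : ℝ}
    {S : Finset V} (hΔ : 1 ≤ Δ) (ha : 0 ≤ a) (hdeg : ∀ v, deg G v ≤ Δ) (hS : S.Nonempty) {k : ℕ}
    (hexp : ∀ i < k, Δ * a * ((closedBall G S i).card : ℝ) ≤
      interEdges G (closedBall G S i) (closedBall G S i)ᶜ) :
    (1 + a) ^ k ≤ ((closedBall G S k).card : ℝ) := by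
  induction k with
  | zero =>
    have : 0 < (closedBall G S 0).card := card_pos.2 (hS.mono (subset_closedBall G S 0))
    simpa using Nat.succ_le_of_lt this
  | succ k ih =>
    have ih := ih fun i hi => hexp i (hi.trans k.lt_succ_self)
    have hcut : interEdges G (closedBall G S k) (closedBall G S k)ᶜ ≤
        Δ * (closedBall G S (k + 1) \ closedBall G S k).card :=
      interEdges_le_mul_card_of_adj hdeg fun u hu v hv h =>
        mem_sdiff.2 ⟨mem_closedBall_succ_of_adj hu h, mem_compl.1 hv⟩
    have hcut' : (interEdges G (closedBall G S k) (closedBall G S k)ᶜ : ℝ) ≤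
        Δ * ((closedBall G S (k + 1) \ closedBall G S k).card : ℝ) := by exact_mod_cast hcut
    have hcard : ((closedBall G S (k + 1) \ closedBall G S k).card : ℝ) +
        (closedBall G S k).card = (closedBall G S (k + 1)).card := by
      exact_mod_cast card_sdiff_add_card_eq_card (closedBall_mono G S k.le_succ)
    have hΔ' : (0 : ℝ) < Δ := by exact_mod_cast hΔ
    have hgrow : a * ((closedBall G S k).card : ℝ) ≤
        (closedBall G S (k + 1) \ closedBall G S k).card := by
      refine le_of_mul_le_mul_left ?_ hΔ'
      linarith [hexp k k.lt_succ_self]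
    calc (1 + a) ^ (k + 1) = (1 + a) ^ k * (1 + a) := pow_succ _ _
      _ ≤ (closedBall G S k).card * (1 + a) := by gcongr
      _ ≤ (closedBall G S (k + 1)).card := by linarith

/-- A set whose ball of radius `k` occupies at most half of the vertices is contained in a
set with a sparse cut. -/
lemma exists_sparse_cut_of_card_closedBall_le [Fintype V] [DecidableEq V] {G : SimpleGraph V}
    {Δ : ℕ} {ℓ : ℝ} {S : Finset V} {k : ℕ}
    (hn : 2 ≤ Fintype.card V) (hΔ : 1 ≤ Δ) (hdeg : ∀ v, deg G v ≤ Δ) (hℓ : 0 < ℓ)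
    (hS : S.Nonempty) (hk : ℓ / 2 ≤ k + 1)
    (hhalf : ((closedBall G S k).card : ℝ) ≤ (Fintype.card V : ℝ) / 2) :
    ∃ Z : Finset V, (Z.card : ℝ) ≤ (Fintype.card V : ℝ) / 2 ∧ S ⊆ Z ∧
      (interEdges G Z Zᶜ : ℝ) <
        (8 * (Δ : ℝ) * Real.log (Fintype.card V) / ℓ) * (Z.card : ℝ) := by
  by_contra! hcon
  set n := Fintype.card V
  have hlog : 0 < Real.log n := Real.log_pos (by exact_mod_cast hn)
  obtain ⟨a, ha⟩ : ∃ a, a = 8 * Real.log n / ℓ := ⟨_, rfl⟩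
  have ha0 : 0 < a := ha ▸ by positivity
  have hcoef : 8 * (Δ : ℝ) * Real.log n / ℓ = Δ * a := by rw [ha]; ring
  have hΔ' : (0 : ℝ) < Δ := by exact_mod_cast hΔ
  have hexp : ∀ i < k + 1, Δ * a * ((closedBall G S i).card : ℝ) ≤
      interEdges G (closedBall G S i) (closedBall G S i)ᶜ := by
    intro i hi
    rw [← hcoef]
    refine hcon _ (le_trans ?_ hhalf) (subset_closedBall G S i)
    exact_mod_cast card_le_card (closedBall_mono G S (Nat.le_of_lt_succ hi))
  have ha1 : a ≤ 1 := by
    have hpos : (0 : ℝ) < (closedBall G S 0).card := by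
      exact_mod_cast card_pos.2 (hS.mono (subset_closedBall G S 0))
    have hub : (interEdges G (closedBall G S 0) (closedBall G S 0)ᶜ : ℝ) ≤
        Δ * ((closedBall G S 0).card : ℝ) := by
      exact_mod_cast interEdges_le_mul_card_left hdeg _ _
    refine le_of_mul_le_mul_right ?_ (mul_pos hΔ' hpos)
    linarith [hexp 0 k.succ_pos]
  have hpow : (1 + a) ^ (k + 1) ≤ (n : ℝ) :=
    (pow_le_card_closedBall hΔ ha0.le hdeg hS hexp).trans (by exact_mod_cast card_le_univ _)
  have hlogpow := Real.log_le_log (by positivity) hpow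
  rw [Real.log_pow] at hlogpow
  have hloga : a / 2 ≤ Real.log (1 + a) := by
    refine le_trans ?_ (Real.one_sub_inv_le_log_of_pos (by positivity))
    have hinv : (1 + a) * (1 + a)⁻¹ = 1 := mul_inv_cancel₀ (by positivity)
    nlinarith [inv_pos.2 (show 0 < 1 + a by positivity)]
  have hmul : ℓ / 2 * (a / 2) ≤ Real.log n := by
    refine le_trans ?_ hlogpow
    push_cast
    gcongr
  have haℓ : a * ℓ = 8 * Real.log n := by rw [ha]; field_simp
  linarith

/-- ball growing.  If every path of `H'` from `S` to `T` has
length greater than `ℓ`, then there is a set `Z` of at most half the vertices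
containing `S` or `T` whose cut has fewer than `(8 Δ log n'/ℓ)·|Z|` edges. -/
theorem ball_growing
    [Fintype V] [DecidableEq V]
    (H' : SimpleGraph V) (Δ : ℕ) (ℓ : ℝ) (S T : Finset V)
    (hn : 2 ≤ Fintype.card V) (hΔ1 : 1 ≤ Δ)
    (hdeg : ∀ v, deg H' v ≤ Δ)
    (hℓ : 1 < ℓ)
    (hS : S.Nonempty) (hT : T.Nonempty)
    (hfar : ∀ s ∈ S, ∀ t ∈ T, ∀ p : H'.Walk s t, p.IsPath → ℓ < (p.length : ℝ)) :
    ∃ Z : Finset V, (Z.card : ℝ) ≤ (Fintype.card V : ℝ) / 2 ∧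
      (S ⊆ Z ∨ T ⊆ Z) ∧
      (interEdges H' Z Zᶜ : ℝ) <
        (8 * (Δ : ℝ) * Real.log (Fintype.card V) / ℓ) * (Z.card : ℝ) := by
  obtain ⟨k, hk⟩ : ∃ k, k = ⌊ℓ / 2⌋₊ := ⟨_, rfl⟩
  have hkle : (k : ℝ) ≤ ℓ / 2 := hk ▸ Nat.floor_le (by linarith)
  have hklt : ℓ / 2 ≤ k + 1 := hk ▸ (Nat.lt_floor_add_one _).le
  have hcard : ((closedBall H' S k).card : ℝ) + (closedBall H' T k).card ≤ Fintype.card V := by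
    have hdisj : Disjoint (closedBall H' S k) (closedBall H' T k) :=
      disjoint_closedBall hfar (by linarith)
    exact_mod_cast (card_union_of_disjoint hdisj).symm.trans_le (card_le_univ _)
  rcases le_total (closedBall H' S k).card (closedBall H' T k).card with h | h
  · have h' : ((closedBall H' S k).card : ℝ) ≤ (closedBall H' T k).card := by exact_mod_cast h
    obtain ⟨Z, hZ, hSZ, hcut⟩ := exists_sparse_cut_of_card_closedBall_le hn hΔ1 hdeg
      (by linarith) hS hklt (by linarith)
    exact ⟨Z, hZ, .inl hSZ, hcut⟩
  · have h' : ((closedBall H' T k).card : ℝ) ≤ (closedBall H' S k).card := by exact_mod_cast h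
    obtain ⟨Z, hZ, hTZ, hcut⟩ := exists_sparse_cut_of_card_closedBall_le hn hΔ1 hdeg
      (by linarith) hT hklt (by linarith)
    exact ⟨Z, hZ, .inr hTZ, hcut⟩
end
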